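/- arXiv:1809.03631 — 3 statements merged into one kernel-verified Lean document; each statement's English description precedes it below -/
import Mathlib

section
/- Let d ≥ 1, N a seminorm on ℝ^d, S_d the Euclidean unit sphere, K = {s ∈ S_d : N(s) = 0}, C = {s ∈ ℝ^d : N(s) = 1}, Γ a finite Borel measure on S_d and μ⁰ ∈ ℝ^d. Then the following are equivalent: (i) there exist a Borel measure γ on ℝ^d concentrated on C satisfying ∫_C |⟨u,s⟩| · |log|⟨u,s⟩|| dγ(s) < ∞ for every u ∈ ℝ^d, and a vector m ∈ ℝ^d, such that for every u ∈ ℝ^d one has −∫_{S_d} (|⟨u,s⟩| + i(2/π)⟨u,s⟩ log|⟨u,s⟩|) dΓ(s) + i⟨u,μ⁰⟩ = −∫_C (|⟨u,s⟩| + i(2/π)⟨u,s⟩ log|⟨u,s⟩|) dγ(s) + i⟨u,m⟩; (ii) Γ(K) = 0 and ∫_{S_d∖K} |log N(s)| dΓ(s) < ∞. Moreover, when (ii) holds, (i) holds with γ equal to the pushforward under T(s) = N(s)^{-1}s of the measure with density N(s) with respect to Γ restricted to S_d ∖ K, and with m = μ⁰ + μ̃, where μ̃ has coordinates μ̃_j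 = −(2/π) ∫_{S_d∖K} s_j log N(s) dΓ(s). -/
open MeasureTheory
open scoped RealInnerProductSpace

/-- The integrand `|⟨u,s⟩| + i (2/π) ⟨u,s⟩ log|⟨u,s⟩|` appearing in the characteristic
function of a 1-stable random vector (with the convention `0 · log 0 = 0`). -/
noncomputable def oneStableExponent {d : ℕ} (u s : EuclideanSpace ℝ (Fin d)) : ℂ :=
  ((|⟪u, s⟫| : ℝ) : ℂ)
    + Complex.I * ((2 / Real.pi : ℝ) : ℂ) * ((⟪u, s⟫ : ℝ) : ℂ)
      * ((Real.log |⟪u, s⟫| : ℝ) : ℂ)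

/-- The density of the one-dimensional Lévy measure `dr / r²` damped by `1 - cos (r a)`. -/
noncomputable def cosKernel (a r : ℝ) : ℝ := (1 - Real.cos (r * a)) / r ^ 2

lemma cosKernel_nonneg (a r : ℝ) : 0 ≤ cosKernel a r :=
  div_nonneg (sub_nonneg.2 (Real.cos_le_one _)) (sq_nonneg _)

lemma measurable_cosKernel : Measurable (fun p : ℝ × ℝ => cosKernel p.1 p.2) := by
  unfold cosKernel; fun_prop

lemma cosKernel_le (a r : ℝ) : cosKernel a r ≤ (a ^ 2 / 2 + 2) * (1 + r ^ 2)⁻¹ := by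
  have h1 := Real.one_sub_sq_div_two_le_cos (x := r * a)
  have h2 := Real.neg_one_le_cos (r * a)
  rcases eq_or_ne r 0 with rfl | hr
  · simp only [cosKernel, zero_mul, Real.cos_zero, sub_self, zero_div]; positivity
  · have hr2 : 0 < r ^ 2 := by positivity
    rw [cosKernel, ← div_eq_mul_inv, div_le_div_iff₀ hr2 (by positivity)]
    nlinarith

lemma integrable_cosKernel (a : ℝ) : Integrable (cosKernel a) := by
  refine (integrable_inv_one_add_sq.const_mul (a ^ 2 / 2 + 2)).mono' ?_ ?_
  · exact (measurable_cosKernel.comp (measurable_const.prodMk measurable_id)).aestronglyMeasurable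
  · filter_upwards with r
    rw [Real.norm_of_nonneg (cosKernel_nonneg a r)]
    exact cosKernel_le a r

lemma integral_cosKernel (a : ℝ) : ∫ r, cosKernel a r = (∫ r, cosKernel 1 r) * |a| := by
  rcases eq_or_ne a 0 with rfl | ha
  · simp [cosKernel]
  · have h := Measure.integral_comp_mul_left (cosKernel 1) a
    have h2 : ∀ r, cosKernel a r = a ^ 2 * cosKernel 1 (a * r) := by
      intro r
      rcases eq_or_ne r 0 with rfl | hr
      · simp [cosKernel]
      · simp only [cosKernel]; rw [mul_one, mul_comm r a]; field_simp
    simp_rw [h2]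
    rw [integral_const_mul, h, smul_eq_mul, abs_inv, ← sq_abs a]
    have : |a| ≠ 0 := abs_ne_zero.2 ha
    field_simp

lemma integral_cosKernel_one_pos : 0 < ∫ r, cosKernel 1 r := by
  rw [integral_pos_iff_support_of_nonneg (fun r => cosKernel_nonneg 1 r) (integrable_cosKernel 1)]
  refine lt_of_lt_of_le (b := volume (Set.Ioo (0 : ℝ) 1)) (by simp) (measure_mono ?_)
  intro r hr
  have hc : Real.cos r ≠ 1 := fun h =>
    hr.1.ne' ((Real.cos_eq_one_iff_of_lt_of_lt (by linarith [hr.1, Real.pi_pos])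
      (by linarith [hr.2, Real.pi_gt_three])).1 h)
  simp only [Function.mem_support, cosKernel, mul_one]
  exact div_ne_zero (sub_ne_zero.2 hc.symm) (pow_ne_zero _ hr.1.ne')

lemma integrable_cosKernel_mul_exp (x y : ℝ) :
    Integrable (fun r : ℝ => (cosKernel y r : ℂ) * Complex.exp ((r * x : ℝ) * Complex.I)) := by
  refine (integrable_cosKernel y).mono' ?_ ?_
  · refine Measurable.aestronglyMeasurable ?_
    unfold cosKernel; fun_prop
  · filter_upwards with r
    rw [norm_mul, Complex.norm_exp_ofReal_mul_I, mul_one, Complex.norm_real,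
      Real.norm_of_nonneg (cosKernel_nonneg y r)]

/-- The Fourier transform of the kernel is a second difference of the absolute value. -/
lemma integral_cosKernel_mul_exp (x y : ℝ) :
    ∫ r : ℝ, (cosKernel y r : ℂ) * Complex.exp ((r * x : ℝ) * Complex.I)
      = (((∫ r, cosKernel 1 r) * (|x + y| / 2 + |x - y| / 2 - |x|) : ℝ) : ℂ) := by
  have hint := integrable_cosKernel_mul_exp x y
  have hre : ∀ r : ℝ, ((cosKernel y r : ℂ) * Complex.exp ((r * x : ℝ) * Complex.I)).re
      = cosKernel (x + y) r / 2 + cosKernel (x - y) r / 2 - cosKernel x r := by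
    intro r
    rw [Complex.re_ofReal_mul, Complex.exp_ofReal_mul_I_re]
    simp only [cosKernel, mul_add, mul_sub, Real.cos_add, Real.cos_sub]
    ring
  have him : ∀ r : ℝ, ((cosKernel y r : ℂ) * Complex.exp ((r * x : ℝ) * Complex.I)).im
      = cosKernel y r * Real.sin (r * x) := by
    intro r
    rw [Complex.im_ofReal_mul, Complex.exp_ofReal_mul_I_im]
  apply Complex.ext
  · rw [← RCLike.re_eq_complex_re, ← integral_re hint]
    simp only [RCLike.re_eq_complex_re, hre, Complex.ofReal_re]
    have hsum : Integrable (fun r => cosKernel (x + y) r / 2 + cosKernel (x - y) r / 2) :=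
      ((integrable_cosKernel _).div_const 2).add ((integrable_cosKernel _).div_const 2)
    rw [integral_sub hsum (integrable_cosKernel x),
      integral_add ((integrable_cosKernel _).div_const 2) ((integrable_cosKernel _).div_const 2),
      integral_div, integral_div, integral_cosKernel (x + y), integral_cosKernel (x - y),
      integral_cosKernel x]
    ring
  · rw [← RCLike.im_eq_complex_im, ← integral_im hint]
    simp only [RCLike.im_eq_complex_im, him, Complex.ofReal_im]
    have h := integral_neg_eq_self (fun r => cosKernel y r * Real.sin (r * x)) volume
    have h2 : ∀ r, cosKernel y (-r) * Real.sin (-r * x) = -(cosKernel y r * Real.sin (r * x)) := by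
      intro r; simp [cosKernel]
    simp only [h2, integral_neg] at h
    linarith

section Polar

variable {d : ℕ}

/-- The density, in polar coordinates `(s, r)`, of a finite measure equivalent to the Lévy measure
of a symmetric 1-stable vector. -/
noncomputable def polarWeight (p : EuclideanSpace ℝ (Fin d) × ℝ) : ℝ :=
  ∑ i, cosKernel (p.1 i) p.2

/-- The damped Lévy measure of the symmetric 1-stable vector with spectral measure `μ`. -/
noncomputable def dampedLevy (μ : Measure (EuclideanSpace ℝ (Fin d))) :
    Measure (EuclideanSpace ℝ (Fin d)) :=
  ((μ.prod volume).withDensity fun p => ENNReal.ofReal (polarWeight p)).map fun p => p.2 • p.1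

lemma polarWeight_nonneg (p : EuclideanSpace ℝ (Fin d) × ℝ) : 0 ≤ polarWeight p :=
  Finset.sum_nonneg fun _ _ => cosKernel_nonneg _ _

lemma measurable_polarWeight :
    Measurable (polarWeight : EuclideanSpace ℝ (Fin d) × ℝ → ℝ) := by
  unfold polarWeight cosKernel; fun_prop

lemma integrable_polarWeight_right (s : EuclideanSpace ℝ (Fin d)) :
    Integrable fun r => polarWeight (s, r) :=
  integrable_finsetSum _ fun i _ => integrable_cosKernel (s i)

lemma integral_polarWeight (s : EuclideanSpace ℝ (Fin d)) :
    ∫ r, polarWeight (s, r) = (∫ r, cosKernel 1 r) * ∑ i, |s i| := by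
  simp only [polarWeight]
  rw [integral_finsetSum _ fun _ _ => integrable_cosKernel _, Finset.mul_sum]
  exact Finset.sum_congr rfl fun i _ => integral_cosKernel _

variable {μ ν : Measure (EuclideanSpace ℝ (Fin d))}

lemma integrable_abs_inner (hμ : Integrable (fun s => ‖s‖) μ) (u : EuclideanSpace ℝ (Fin d)) :
    Integrable (fun s => |⟪u, s⟫|) μ := by
  refine (hμ.const_mul ‖u‖).mono' (by fun_prop) ?_
  filter_upwards with s
  rw [Real.norm_eq_abs, abs_abs]
  exact abs_real_inner_le_norm u s

lemma integrable_abs_coord (hμ : Integrable (fun s => ‖s‖) μ) (i : Fin d) :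
    Integrable (fun s : EuclideanSpace ℝ (Fin d) => |s i|) μ := by
  refine hμ.mono' (by fun_prop) ?_
  filter_upwards with s
  rw [Real.norm_eq_abs, abs_abs]
  exact PiLp.norm_apply_le s i

lemma integrable_polarWeight (hμ : Integrable (fun s => ‖s‖) μ) :
    Integrable (polarWeight : EuclideanSpace ℝ (Fin d) × ℝ → ℝ) (μ.prod volume) := by
  rw [integrable_prod_iff measurable_polarWeight.aestronglyMeasurable]
  refine ⟨Filter.Eventually.of_forall integrable_polarWeight_right, ?_⟩
  simp_rw [Real.norm_of_nonneg (polarWeight_nonneg _), integral_polarWeight]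
  exact (integrable_finsetSum _ fun i _ => integrable_abs_coord hμ i).const_mul _

lemma isFiniteMeasure_dampedLevy (hμ : Integrable (fun s => ‖s‖) μ) :
    IsFiniteMeasure (dampedLevy μ) := by
  have := isFiniteMeasure_withDensity_ofReal (integrable_polarWeight hμ).2
  unfold dampedLevy
  infer_instance

lemma charFun_dampedLevy [SFinite μ] (hμ : Integrable (fun s => ‖s‖) μ)
    (u : EuclideanSpace ℝ (Fin d)) :
    charFun (dampedLevy μ) u = (((∫ r, cosKernel 1 r) * ∑ i,
      ((∫ s, |⟪u + EuclideanSpace.single i 1, s⟫| ∂μ) / 2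
        + (∫ s, |⟪u - EuclideanSpace.single i 1, s⟫| ∂μ) / 2 - ∫ s, |⟪u, s⟫| ∂μ) : ℝ) : ℂ) := by
  have hexp : ∀ p : EuclideanSpace ℝ (Fin d) × ℝ,
      (ENNReal.ofReal (polarWeight p)).toReal • Complex.exp ((⟪p.2 • p.1, u⟫ : ℝ) * Complex.I)
      = ∑ i, (cosKernel (p.1 i) p.2 : ℂ) * Complex.exp ((p.2 * ⟪u, p.1⟫ : ℝ) * Complex.I) := by
    intro p
    rw [ENNReal.toReal_ofReal (polarWeight_nonneg p), Complex.real_smul, polarWeight,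
      Complex.ofReal_sum, Finset.sum_mul, real_inner_smul_left, real_inner_comm]
  have hint : Integrable (fun p : EuclideanSpace ℝ (Fin d) × ℝ =>
      ∑ i, (cosKernel (p.1 i) p.2 : ℂ) * Complex.exp ((p.2 * ⟪u, p.1⟫ : ℝ) * Complex.I))
      (μ.prod volume) := by
    refine (integrable_polarWeight hμ).mono' ?_ ?_
    · refine Measurable.aestronglyMeasurable ?_
      unfold cosKernel; fun_prop
    · filter_upwards with p
      rw [← Finset.sum_mul, norm_mul, Complex.norm_exp_ofReal_mul_I, mul_one,
        ← Complex.ofReal_sum, Complex.norm_real]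
      exact (Real.norm_of_nonneg (polarWeight_nonneg p)).le
  have habs := integrable_abs_inner hμ
  rw [charFun_apply, dampedLevy, integral_map (by fun_prop) (by fun_prop),
    integral_withDensity_eq_integral_toReal_smul measurable_polarWeight.ennreal_ofReal
      (Filter.Eventually.of_forall fun _ => ENNReal.ofReal_lt_top)]
  simp_rw [hexp]
  rw [integral_prod _ hint]
  have hinner : ∀ s : EuclideanSpace ℝ (Fin d), (∫ r : ℝ, ∑ i, (cosKernel (s i) r : ℂ)
      * Complex.exp ((r * ⟪u, s⟫ : ℝ) * Complex.I)) = (((∫ r, cosKernel 1 r) * ∑ i,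
        (|⟪u + EuclideanSpace.single i 1, s⟫| / 2 + |⟪u - EuclideanSpace.single i 1, s⟫| / 2
          - |⟪u, s⟫|) : ℝ) : ℂ) := by
    intro s
    rw [integral_finsetSum _ fun i _ => integrable_cosKernel_mul_exp _ _, Finset.mul_sum,
      Complex.ofReal_sum]
    refine Finset.sum_congr rfl fun i _ => ?_
    rw [integral_cosKernel_mul_exp, inner_add_left, inner_sub_left,
      EuclideanSpace.inner_single_left]
    simp
  simp only [hinner]
  have hterm : ∀ i : Fin d, Integrable (fun s => |⟪u + EuclideanSpace.single i 1, s⟫| / 2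
      + |⟪u - EuclideanSpace.single i 1, s⟫| / 2 - |⟪u, s⟫|) μ := fun i =>
    (((habs _).div_const 2).add ((habs _).div_const 2)).sub (habs u)
  have hsum : ∀ i : Fin d, Integrable (fun s => |⟪u + EuclideanSpace.single i 1, s⟫| / 2
      + |⟪u - EuclideanSpace.single i 1, s⟫| / 2) μ := fun i =>
    ((habs _).div_const 2).add ((habs _).div_const 2)
  rw [integral_complex_ofReal, integral_const_mul,
    integral_finsetSum _ fun i _ => hterm i]
  congr 3
  funext i
  rw [integral_sub (hsum i) (habs u), integral_add ((habs _).div_const 2) ((habs _).div_const 2),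
    integral_div, integral_div]

lemma lintegral_dampedLevy {h : EuclideanSpace ℝ (Fin d) → ENNReal}
    (hm : Measurable h) (hh : ∀ r : ℝ, r ≠ 0 → ∀ s, h (r • s) = h s) :
    ∫⁻ x, h x ∂(dampedLevy μ)
      = ENNReal.ofReal (∫ r, cosKernel 1 r) * ∫⁻ s, h s * ENNReal.ofReal (∑ i, |s i|) ∂μ := by
  have hm2 : Measurable fun p : EuclideanSpace ℝ (Fin d) × ℝ => h (p.2 • p.1) :=
    hm.comp (by fun_prop)
  have hw : Measurable fun p : EuclideanSpace ℝ (Fin d) × ℝ => ENNReal.ofReal (polarWeight p) :=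
    measurable_polarWeight.ennreal_ofReal
  rw [dampedLevy, lintegral_map hm (by fun_prop), lintegral_withDensity_eq_lintegral_mul _ hw hm2,
    lintegral_prod _ (hw.mul hm2).aemeasurable, ← lintegral_const_mul]
  · refine lintegral_congr fun s => ?_
    have h1 : ∀ᵐ r : ℝ, ((fun p : EuclideanSpace ℝ (Fin d) × ℝ =>
        ENNReal.ofReal (polarWeight p)) * fun p : EuclideanSpace ℝ (Fin d) × ℝ => h (p.2 • p.1)) (s, r)
        = h s * ENNReal.ofReal (polarWeight (s, r)) := by
      filter_upwards [Measure.ae_ne volume (0 : ℝ)] with r hr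
      simp only [Pi.mul_apply, hh r hr s, mul_comm]
    rw [lintegral_congr_ae h1, lintegral_const_mul,
      ← ofReal_integral_eq_lintegral_ofReal (integrable_polarWeight_right s)
        (Filter.Eventually.of_forall fun r => polarWeight_nonneg _), integral_polarWeight,
      ENNReal.ofReal_mul integral_cosKernel_one_pos.le, mul_left_comm]
    exact hw.comp (measurable_const.prodMk measurable_id)
  · exact hm.mul (by fun_prop)

/-- The cosine transform determines the integrals of even `0`-homogeneous functions. -/
lemma lintegral_eq_of_integral_abs_inner_eq [SFinite μ] [SFinite ν]
    (hμ : Integrable (fun s => ‖s‖) μ)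
    (hν : Integrable (fun s => ‖s‖) ν)
    (heq : ∀ u : EuclideanSpace ℝ (Fin d), ∫ s, |⟪u, s⟫| ∂μ = ∫ s, |⟪u, s⟫| ∂ν)
    {h : EuclideanSpace ℝ (Fin d) → ENNReal} (hm : Measurable h)
    (hh : ∀ r : ℝ, r ≠ 0 → ∀ s, h (r • s) = h s) :
    ∫⁻ s, h s * ENNReal.ofReal (∑ i, |s i|) ∂μ = ∫⁻ s, h s * ENNReal.ofReal (∑ i, |s i|) ∂ν := by
  have := isFiniteMeasure_dampedLevy hμ
  have := isFiniteMeasure_dampedLevy hν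
  have h1 : dampedLevy μ = dampedLevy ν := by
    refine Measure.ext_of_charFun (funext fun u => ?_)
    rw [charFun_dampedLevy hμ, charFun_dampedLevy hν]
    simp only [heq]
  have h2 := lintegral_dampedLevy (μ := μ) hm hh
  rw [h1, lintegral_dampedLevy (μ := ν) hm hh] at h2
  exact ((ENNReal.mul_right_inj (ENNReal.ofReal_pos.2 integral_cosKernel_one_pos).ne'
    ENNReal.ofReal_ne_top).1 h2).symm

end Polar

section Exponent

variable {d : ℕ}

lemma EuclideanSpace.norm_le_sum_abs (s : EuclideanSpace ℝ (Fin d)) : ‖s‖ ≤ ∑ i, |s i| := by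
  rw [EuclideanSpace.norm_eq]
  exact Real.sqrt_le_iff.2 ⟨Finset.sum_nonneg fun _ _ => abs_nonneg _,
    Finset.sum_sq_le_sq_sum_of_nonneg fun _ _ => norm_nonneg _⟩

lemma EuclideanSpace.sum_abs_le (s : EuclideanSpace ℝ (Fin d)) : ∑ i, |s i| ≤ d * ‖s‖ := by
  have h : ∑ i, |s i| ≤ ∑ _i : Fin d, ‖s‖ := Finset.sum_le_sum fun i _ => PiLp.norm_apply_le s i
  simpa using h

lemma abs_mul_log_two_le (x : ℝ) :
    |x| * Real.log 2 ≤ |x| * |(Real.log |x|)| + |2 * x| * |(Real.log |2 * x|)| / 2 := by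
  rcases eq_or_ne x 0 with rfl | hx
  · simp
  · have h := Real.log_mul (x := 2) two_ne_zero (abs_ne_zero.2 hx)
    rw [abs_mul, abs_two, h]
    have h1 : Real.log 2 ≤ |(Real.log |x|)| + |(Real.log 2 + Real.log |x|)| := by
      linarith [le_abs_self (Real.log 2 + Real.log |x|), neg_abs_le (Real.log |x|)]
    nlinarith [mul_le_mul_of_nonneg_left h1 (abs_nonneg x)]

lemma norm_mul_abs_log_norm_le (s : EuclideanSpace ℝ (Fin d)) :
    ‖s‖ * |Real.log ‖s‖| ≤ d * ∑ i, (|s i| * |Real.log (|s i|)| + Real.log d * |s i|) := by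
  have hlogd : 0 ≤ Real.log d := Real.log_natCast_nonneg d
  have hnn : ∀ i, 0 ≤ |s i| * |Real.log (|s i|)| + Real.log d * |s i| := fun i => by positivity
  rcases eq_or_ne s 0 with rfl | hs
  · simp
  have hs' : 0 < ‖s‖ := norm_pos_iff.2 hs
  have hle := EuclideanSpace.norm_le_sum_abs s
  have hd : 0 < d := by
    rcases Nat.eq_zero_or_pos d with rfl | h
    · simp only [Finset.univ_eq_empty, Finset.sum_empty] at hle; linarith
    · exact h
  have hd' : (0 : ℝ) < d := by exact_mod_cast hd
  have : Nonempty (Fin d) := ⟨⟨0, hd⟩⟩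
  obtain ⟨i, -, hi⟩ : ∃ i ∈ Finset.univ, ‖s‖ / d ≤ |s i| := by
    refine Finset.exists_le_of_sum_le Finset.univ_nonempty ?_
    simp only [Finset.sum_const, Finset.card_univ, Fintype.card_fin, nsmul_eq_mul]
    rwa [mul_div_cancel₀ _ hd'.ne']
  have hi' : ‖s‖ ≤ d * |s i| := by rwa [div_le_iff₀' hd'] at hi
  have hpos : 0 < |s i| := lt_of_lt_of_le (by positivity) hi
  have hlog1 : Real.log ‖s‖ ≤ Real.log d + Real.log |s i| := by
    rw [← Real.log_mul hd'.ne' hpos.ne']; exact Real.log_le_log hs' hi'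
  have hlog2 : Real.log |s i| ≤ Real.log ‖s‖ := Real.log_le_log hpos (PiLp.norm_apply_le s i)
  have hlog : |Real.log ‖s‖| ≤ |Real.log (|s i|)| + Real.log d :=
    abs_le.2 ⟨by linarith [neg_abs_le (Real.log |s i|)], by linarith [le_abs_self (Real.log |s i|)]⟩
  calc ‖s‖ * |Real.log ‖s‖| ≤ (d * |s i|) * (|Real.log (|s i|)| + Real.log d) := by gcongr
    _ = d * (|s i| * |Real.log (|s i|)| + Real.log d * |s i|) := by ring
    _ ≤ _ := by
      gcongr
      exact Finset.single_le_sum (f := fun i => |s i| * |Real.log (|s i|)| + Real.log d * |s i|)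
        (fun j _ => hnn j) (Finset.mem_univ i)

variable {μ : Measure (EuclideanSpace ℝ (Fin d))}

lemma oneStableExponent_eq (u s : EuclideanSpace ℝ (Fin d)) :
    oneStableExponent u s = ((|⟪u, s⟫| : ℝ) : ℂ)
      + Complex.I * ((2 / Real.pi * (⟪u, s⟫ * Real.log |⟪u, s⟫|) : ℝ) : ℂ) := by
  simp only [oneStableExponent, Complex.ofReal_mul]
  ring

lemma continuous_oneStableExponent (u : EuclideanSpace ℝ (Fin d)) :
    Continuous (oneStableExponent u) := by
  have h : Continuous fun s => ⟪u, s⟫ * Real.log ⟪u, s⟫ :=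
    Real.continuous_mul_log.comp (by fun_prop)
  simp only [funext (oneStableExponent_eq u), Real.log_abs]
  fun_prop

/-- The integrability condition on `|x| |log |x||` for linear images `x`, at all scales, controls
the integral of `|x|`. -/
lemma integrable_abs_of_integrable_mul_log
    (hμ : ∀ u : EuclideanSpace ℝ (Fin d),
      Integrable (fun s => |⟪u, s⟫| * |(Real.log |⟪u, s⟫|)|) μ) (u : EuclideanSpace ℝ (Fin d)) :
    Integrable (fun s => |⟪u, s⟫|) μ := by
  have hlog2 : 0 < Real.log 2 := Real.log_pos one_lt_two
  refine (((hμ u).add ((hμ ((2 : ℝ) • u)).div_const 2)).div_const (Real.log 2)).mono'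
    (by fun_prop) ?_
  filter_upwards with s
  rw [Real.norm_eq_abs, abs_abs, le_div_iff₀ hlog2]
  simpa only [Pi.add_apply, real_inner_smul_left] using abs_mul_log_two_le ⟪u, s⟫

lemma integrable_oneStableExponent {u : EuclideanSpace ℝ (Fin d)}
    (h1 : Integrable (fun s => |⟪u, s⟫|) μ)
    (h2 : Integrable (fun s => |⟪u, s⟫| * |(Real.log |⟪u, s⟫|)|) μ) :
    Integrable (oneStableExponent u) μ := by
  refine (h1.add (h2.const_mul (2 / Real.pi))).mono'
    (continuous_oneStableExponent u).aestronglyMeasurable ?_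
  filter_upwards with s
  rw [oneStableExponent_eq]
  refine (norm_add_le _ _).trans ?_
  simp [abs_of_pos Real.pi_pos]

lemma re_integral_oneStableExponent {u : EuclideanSpace ℝ (Fin d)}
    (h : Integrable (oneStableExponent u) μ) :
    (∫ s, oneStableExponent u s ∂μ).re = ∫ s, |⟪u, s⟫| ∂μ := by
  rw [← RCLike.re_eq_complex_re, ← integral_re h]
  refine integral_congr_ae (Filter.Eventually.of_forall fun s => ?_)
  simp [oneStableExponent_eq]

lemma integrable_norm_of_abs_coord
    (h : ∀ u : EuclideanSpace ℝ (Fin d), Integrable (fun s => |⟪u, s⟫|) μ) :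
    Integrable (fun s => ‖s‖) μ := by
  refine (integrable_finsetSum Finset.univ fun i _ =>
    h (EuclideanSpace.single i 1)).mono' (by fun_prop) ?_
  filter_upwards with s
  simpa [EuclideanSpace.inner_single_left] using EuclideanSpace.norm_le_sum_abs s

lemma integrable_norm_mul_log_norm
    (h : ∀ u : EuclideanSpace ℝ (Fin d),
      Integrable (fun s => |⟪u, s⟫| * |(Real.log |⟪u, s⟫|)|) μ) :
    Integrable (fun s => ‖s‖ * |Real.log ‖s‖|) μ := by
  have h1 := integrable_abs_of_integrable_mul_log h
  refine ((integrable_finsetSum Finset.univ fun i _ => (h (EuclideanSpace.single i 1)).add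
    ((h1 (EuclideanSpace.single i 1)).const_mul (Real.log d))).const_mul (d : ℝ)).mono'
    (by fun_prop) ?_
  filter_upwards with s
  rw [Real.norm_of_nonneg (by positivity)]
  simpa [EuclideanSpace.inner_single_left] using norm_mul_abs_log_norm_le s

end Exponent

lemma Seminorm.continuous_of_finiteDimensional {E : Type*} [NormedAddCommGroup E] [NormedSpace ℝ E]
    [FiniteDimensional ℝ E] (N : Seminorm ℝ E) : Continuous N :=
  N.convexOn.locallyLipschitz.continuous

section Cylinder

variable {d : ℕ} (N : Seminorm ℝ (EuclideanSpace ℝ (Fin d)))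

open Classical in
/-- The even, `0`-homogeneous extension of `|log N|` from the sphere, infinite on the kernel. -/
noncomputable def angularLog (s : EuclideanSpace ℝ (Fin d)) : ENNReal :=
  if N s = 0 then ⊤ else ENNReal.ofReal |Real.log (N s / ‖s‖)|

lemma measurable_angularLog : Measurable (angularLog N) := by
  have hN := N.continuous_of_finiteDimensional.measurable
  exact Measurable.ite (hN (measurableSet_singleton 0)) measurable_const (by fun_prop)

lemma angularLog_smul (r : ℝ) (hr : r ≠ 0) (s : EuclideanSpace ℝ (Fin d)) :
    angularLog N (r • s) = angularLog N s := by
  have hr' : |r| ≠ 0 := abs_ne_zero.2 hr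
  simp only [angularLog, map_smul_eq_mul, norm_smul, Real.norm_eq_abs, mul_eq_zero, hr', false_or,
    mul_div_mul_left _ _ hr']

lemma isFiniteMeasure_of_integrable_norm {γ : Measure (EuclideanSpace ℝ (Fin d))}
    (hγ : γ {s | N s = 1}ᶜ = 0) (hint : Integrable (fun s => ‖s‖) γ) : IsFiniteMeasure γ := by
  obtain ⟨L, hL, hbound⟩ := N.bound_of_continuous_normedSpace N.continuous_of_finiteDimensional
  have hfin := hint.measure_ge_lt_top (ε := 1 / L) (by positivity)
  refine ⟨?_⟩
  rw [← Set.union_compl_self {s : EuclideanSpace ℝ (Fin d) | N s = 1}]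
  refine (measure_union_le _ _).trans_lt ?_
  rw [hγ, add_zero]
  refine (measure_mono fun s hs => ?_).trans_lt hfin
  rw [Set.mem_ofPred_eq, div_le_iff₀ hL, mul_comm]
  exact (show N s = 1 from hs) ▸ hbound s

lemma lintegral_angularLog_lt_top {Γ γ : Measure (EuclideanSpace ℝ (Fin d))} [IsFiniteMeasure Γ]
    (hΓ : ∀ᵐ s ∂Γ, ‖s‖ = 1) (hγ : γ {s | N s = 1}ᶜ = 0)
    (hlog : ∀ u : EuclideanSpace ℝ (Fin d),
      Integrable (fun s => |⟪u, s⟫| * |(Real.log |⟪u, s⟫|)|) γ)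
    (heq : ∀ u : EuclideanSpace ℝ (Fin d), ∫ s, |⟪u, s⟫| ∂Γ = ∫ s, |⟪u, s⟫| ∂γ) :
    ∫⁻ s, angularLog N s ∂Γ < ⊤ := by
  have hnorm := integrable_norm_of_abs_coord (integrable_abs_of_integrable_mul_log hlog)
  have := isFiniteMeasure_of_integrable_norm N hγ hnorm
  have hΓint : Integrable (fun s => ‖s‖) Γ :=
    (integrable_const (1 : ℝ)).congr (hΓ.mono fun s hs => hs.symm)
  have hN : ∀ᵐ s ∂γ, N s = 1 := hγ
  calc ∫⁻ s, angularLog N s ∂Γ ≤ ∫⁻ s, angularLog N s * ENNReal.ofReal (∑ i, |s i|) ∂Γ := by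
        refine lintegral_mono_ae (hΓ.mono fun s hs => ?_)
        refine le_mul_of_one_le_right zero_le ?_
        rw [ENNReal.one_le_ofReal, ← hs]
        exact EuclideanSpace.norm_le_sum_abs s
    _ = ∫⁻ s, angularLog N s * ENNReal.ofReal (∑ i, |s i|) ∂γ :=
        lintegral_eq_of_integral_abs_inner_eq hΓint hnorm heq (measurable_angularLog N)
          (angularLog_smul N)
    _ ≤ ∫⁻ s, ENNReal.ofReal (d * (‖s‖ * |Real.log ‖s‖|)) ∂γ := by
        refine lintegral_mono_ae (hN.mono fun s hs => ?_)
        rw [angularLog, if_neg (by rw [hs]; exact one_ne_zero), hs, one_div, Real.log_inv, abs_neg,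
          ← ENNReal.ofReal_mul (abs_nonneg _)]
        refine ENNReal.ofReal_le_ofReal ?_
        calc |Real.log ‖s‖| * ∑ i, |s i| ≤ |Real.log ‖s‖| * (d * ‖s‖) := by
              gcongr; exact EuclideanSpace.sum_abs_le s
          _ = _ := by ring
    _ < ⊤ := ((integrable_norm_mul_log_norm hlog).const_mul _).lintegral_lt_top

/-- The radial projection onto the unit cylinder of `N` of the part of `Γ` living on `R`. -/
noncomputable def cylinderMeasure (Γ : Measure (EuclideanSpace ℝ (Fin d)))
    (R : Set (EuclideanSpace ℝ (Fin d))) : Measure (EuclideanSpace ℝ (Fin d)) :=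
  Measure.map (fun s => (N s)⁻¹ • s) ((Γ.restrict R).withDensity fun s => ENNReal.ofReal (N s))

variable {Γ : Measure (EuclideanSpace ℝ (Fin d))} {R : Set (EuclideanSpace ℝ (Fin d))}

lemma measurable_radialProjection :
    Measurable fun s : EuclideanSpace ℝ (Fin d) => (N s)⁻¹ • s := by
  have hN := N.continuous_of_finiteDimensional.measurable
  fun_prop

lemma measurable_ofReal_seminorm :
    Measurable fun s : EuclideanSpace ℝ (Fin d) => ENNReal.ofReal (N s) :=
  N.continuous_of_finiteDimensional.measurable.ennreal_ofReal

lemma cylinderMeasure_compl (hR : ∀ s ∈ R, N s ≠ 0) :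
    cylinderMeasure N Γ R {s | N s = 1}ᶜ = 0 := by
  have hN := N.continuous_of_finiteDimensional.measurable
  have hC : MeasurableSet {s : EuclideanSpace ℝ (Fin d) | N s = 1}ᶜ :=
    (hN (measurableSet_singleton 1)).compl
  rw [cylinderMeasure, Measure.map_apply (measurable_radialProjection N) hC]
  refine withDensity_absolutelyContinuous _ _ ?_
  rw [Measure.restrict_apply (measurable_radialProjection N hC)]
  convert measure_empty (μ := Γ)
  ext s
  simp only [Set.mem_inter_iff, Set.mem_preimage, Set.mem_compl_iff, Set.mem_ofPred_eq,
    Set.mem_empty_iff_false, iff_false, not_and, map_smul_eq_mul, norm_inv, Real.norm_eq_abs,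
    abs_of_nonneg (apply_nonneg N s)]
  exact fun h hs => h (inv_mul_cancel₀ (hR s hs))

lemma lintegral_cylinderMeasure {f : EuclideanSpace ℝ (Fin d) → ENNReal} (hf : Measurable f) :
    ∫⁻ s, f s ∂(cylinderMeasure N Γ R) = ∫⁻ s in R, ENNReal.ofReal (N s) * f ((N s)⁻¹ • s) ∂Γ := by
  have hT := measurable_radialProjection N
  rw [cylinderMeasure, lintegral_map hf hT, lintegral_withDensity_eq_lintegral_mul _
    (measurable_ofReal_seminorm N) (g := fun s => f ((N s)⁻¹ • s)) (hf.comp hT)]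
  rfl

lemma integral_cylinderMeasure {f : EuclideanSpace ℝ (Fin d) → ℂ} (hf : Measurable f) :
    ∫ s, f s ∂(cylinderMeasure N Γ R) = ∫ s in R, (N s : ℂ) * f ((N s)⁻¹ • s) ∂Γ := by
  rw [cylinderMeasure, integral_map (measurable_radialProjection N).aemeasurable
    hf.aestronglyMeasurable, integral_withDensity_eq_integral_toReal_smul
    (measurable_ofReal_seminorm N) (Filter.Eventually.of_forall fun _ => ENNReal.ofReal_lt_top)]
  simp only [ENNReal.toReal_ofReal (apply_nonneg N _), Complex.real_smul]

lemma seminorm_mul_oneStableExponent {u s : EuclideanSpace ℝ (Fin d)} (hs : N s ≠ 0) :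
    (N s : ℂ) * oneStableExponent u ((N s)⁻¹ • s)
      = oneStableExponent u s
        + Complex.I * ((⟪u, (-(2 / Real.pi) * Real.log (N s)) • s⟫ : ℝ) : ℂ) := by
  have hpos : 0 < N s := lt_of_le_of_ne (apply_nonneg N s) hs.symm
  simp only [oneStableExponent_eq, real_inner_smul_right, abs_mul, abs_inv, abs_of_pos hpos]
  rcases eq_or_ne ⟪u, s⟫ 0 with h0 | h0
  · simp [h0]
  rw [Real.log_mul (inv_ne_zero hs) (abs_ne_zero.2 h0), Real.log_inv]
  have hs' : (N s : ℂ) ≠ 0 := by exact_mod_cast hs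
  push_cast
  field_simp
  ring

lemma seminorm_mul_abs_mul_log_le {u s : EuclideanSpace ℝ (Fin d)} (hs : N s ≠ 0) :
    N s * (|⟪u, (N s)⁻¹ • s⟫| * |(Real.log |⟪u, (N s)⁻¹ • s⟫|)|)
      ≤ |⟪u, s⟫| * |(Real.log |⟪u, s⟫|)| + ‖u‖ * ‖s‖ * |Real.log (N s)| := by
  have hpos : 0 < N s := lt_of_le_of_ne (apply_nonneg N s) hs.symm
  simp only [real_inner_smul_right, abs_mul, abs_inv, abs_of_pos hpos]
  rcases eq_or_ne ⟪u, s⟫ 0 with h0 | h0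
  · simp only [h0, abs_zero, mul_zero, zero_mul, zero_add]; positivity
  rw [Real.log_mul (inv_ne_zero hs) (abs_ne_zero.2 h0), Real.log_inv, ← mul_assoc,
    mul_inv_cancel_left₀ hs]
  calc |⟪u, s⟫| * |(-Real.log (N s) + Real.log |⟪u, s⟫|)|
      ≤ |⟪u, s⟫| * (|Real.log (N s)| + |(Real.log |⟪u, s⟫|)|) := by
        gcongr
        exact (abs_add_le _ _).trans_eq (by rw [abs_neg])
    _ = |⟪u, s⟫| * |(Real.log |⟪u, s⟫|)| + |⟪u, s⟫| * |Real.log (N s)| := by ring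
    _ ≤ _ := by gcongr; exact abs_real_inner_le_norm u s

lemma integrable_of_ae_norm_eq_one [IsFiniteMeasure Γ] (hΓ : ∀ᵐ s ∂Γ, ‖s‖ = 1)
    {F : Type*} [NormedAddCommGroup F] {f : EuclideanSpace ℝ (Fin d) → F} (hf : Continuous f) :
    Integrable f Γ := by
  have h : Γ.restrict (Metric.sphere 0 1) = Γ :=
    Measure.restrict_eq_self_of_ae_mem (hΓ.mono fun s hs => by simpa using hs)
  rw [← h]
  exact hf.continuousOn.integrableOn_compact (isCompact_sphere 0 1)

lemma continuous_abs_inner_mul_abs_log (u : EuclideanSpace ℝ (Fin d)) :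
    Continuous fun s => |⟪u, s⟫| * |(Real.log |⟪u, s⟫|)| := by
  have h : Continuous fun s => ⟪u, s⟫ * Real.log ⟪u, s⟫ :=
    Real.continuous_mul_log.comp (by fun_prop)
  simpa only [abs_mul, Real.log_abs] using h.abs

lemma lintegral_cylinderMeasure_lt_top [IsFiniteMeasure Γ] (hΓ : ∀ᵐ s ∂Γ, ‖s‖ = 1)
    (hRm : MeasurableSet R) (hR : ∀ s ∈ R, N s ≠ 0)
    (hlog : IntegrableOn (fun s => |Real.log (N s)|) R Γ) (u : EuclideanSpace ℝ (Fin d)) :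
    ∫⁻ s, ENNReal.ofReal (|⟪u, s⟫| * |(Real.log |⟪u, s⟫|)|) ∂(cylinderMeasure N Γ R) < ⊤ := by
  have hcont := continuous_abs_inner_mul_abs_log u
  rw [lintegral_cylinderMeasure N hcont.measurable.ennreal_ofReal]
  have hint : Integrable (fun s => |⟪u, s⟫| * |(Real.log |⟪u, s⟫|)| + ‖u‖ * |Real.log (N s)|)
      (Γ.restrict R) :=
    (integrable_of_ae_norm_eq_one hΓ hcont).integrableOn.add (hlog.const_mul ‖u‖)
  refine (lintegral_mono_ae ?_).trans_lt hint.lintegral_lt_top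
  filter_upwards [ae_restrict_mem hRm, ae_restrict_of_ae hΓ] with s hs hs1
  rw [← ENNReal.ofReal_mul (apply_nonneg N s)]
  refine ENNReal.ofReal_le_ofReal ?_
  simpa only [hs1, mul_one] using seminorm_mul_abs_mul_log_le N (u := u) (hR s hs)

lemma integral_oneStableExponent_cylinderMeasure [IsFiniteMeasure Γ] (hΓ : ∀ᵐ s ∂Γ, ‖s‖ = 1)
    (hRm : MeasurableSet R) (hR : ∀ s ∈ R, N s ≠ 0)
    (hlog : IntegrableOn (fun s => |Real.log (N s)|) R Γ) (u : EuclideanSpace ℝ (Fin d)) :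
    ∫ s, oneStableExponent u s ∂(cylinderMeasure N Γ R) = (∫ s in R, oneStableExponent u s ∂Γ)
      + Complex.I
        * ((⟪u, ∫ s in R, (-(2 / Real.pi) * Real.log (N s)) • s ∂Γ⟫ : ℝ) : ℂ) := by
  have hN := N.continuous_of_finiteDimensional.measurable
  have hvec : Integrable (fun s => (-(2 / Real.pi) * Real.log (N s)) • s) (Γ.restrict R) := by
    refine (Integrable.const_mul hlog (2 / Real.pi)).mono'
      (Measurable.aestronglyMeasurable (by fun_prop)) ?_
    filter_upwards [ae_restrict_of_ae hΓ] with s hs1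
    simp [norm_smul, hs1, abs_of_pos Real.pi_pos]
  have hexp : Integrable (oneStableExponent u) (Γ.restrict R) :=
    (integrable_of_ae_norm_eq_one hΓ (continuous_oneStableExponent u)).integrableOn
  have hinner : Integrable (fun s => Complex.I
      * ((⟪u, (-(2 / Real.pi) * Real.log (N s)) • s⟫ : ℝ) : ℂ)) (Γ.restrict R) :=
    (hvec.const_inner (𝕜 := ℝ) u).ofReal.const_mul _
  rw [integral_cylinderMeasure N (continuous_oneStableExponent u).measurable,
    setIntegral_congr_fun hRm fun s hs => seminorm_mul_oneStableExponent N (u := u) (hR s hs),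
    integral_add hexp hinner, integral_const_mul, integral_complex_ofReal,
    integral_inner hvec u]

end Cylinder

theorem stmt2 (d : ℕ) (hd : 1 ≤ d)
    (N : Seminorm ℝ (EuclideanSpace ℝ (Fin d)))
    (S K C : Set (EuclideanSpace ℝ (Fin d)))
    (hS : S = {s : EuclideanSpace ℝ (Fin d) | ‖s‖ = 1})
    (hK : K = {s ∈ S | N s = 0})
    (hC : C = {s : EuclideanSpace ℝ (Fin d) | N s = 1})
    (Γ : Measure (EuclideanSpace ℝ (Fin d))) [IsFiniteMeasure Γ]
    (hΓS : Γ Sᶜ = 0)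
    (μ0 : EuclideanSpace ℝ (Fin d)) :
    ((∃ (γ : Measure (EuclideanSpace ℝ (Fin d))) (mv : EuclideanSpace ℝ (Fin d)),
        γ Cᶜ = 0 ∧
        (∀ u : EuclideanSpace ℝ (Fin d),
          ∫⁻ s in C, ENNReal.ofReal (|⟪u, s⟫| * |(Real.log |⟪u, s⟫|)|) ∂γ < ⊤) ∧
        (∀ u : EuclideanSpace ℝ (Fin d),
          -(∫ s in S, oneStableExponent u s ∂Γ) + Complex.I * ((⟪u, μ0⟫ : ℝ) : ℂ)
            = -(∫ s in C, oneStableExponent u s ∂γ) + Complex.I * ((⟪u, mv⟫ : ℝ) : ℂ))) ↔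
      (Γ K = 0 ∧ ∫⁻ s in S \ K, ENNReal.ofReal |(Real.log (N s))| ∂Γ < ⊤)) ∧
    ((Γ K = 0 ∧ ∫⁻ s in S \ K, ENNReal.ofReal |(Real.log (N s))| ∂Γ < ⊤) →
      ((Measure.map (fun s => (N s)⁻¹ • s)
          ((Γ.restrict (S \ K)).withDensity fun s => ENNReal.ofReal (N s))) Cᶜ = 0 ∧
       (∀ u : EuclideanSpace ℝ (Fin d),
          ∫⁻ s in C, ENNReal.ofReal (|⟪u, s⟫| * |(Real.log |⟪u, s⟫|)|)
            ∂(Measure.map (fun s => (N s)⁻¹ • s)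
              ((Γ.restrict (S \ K)).withDensity fun s => ENNReal.ofReal (N s))) < ⊤) ∧
       (∀ u : EuclideanSpace ℝ (Fin d),
          -(∫ s in S, oneStableExponent u s ∂Γ) + Complex.I * ((⟪u, μ0⟫ : ℝ) : ℂ)
            = -(∫ s in C, oneStableExponent u s
                ∂(Measure.map (fun s => (N s)⁻¹ • s)
                  ((Γ.restrict (S \ K)).withDensity fun s => ENNReal.ofReal (N s))))
              + Complex.I
                * ((⟪u, μ0 + ∫ s in S \ K, (-(2 / Real.pi) * Real.log (N s)) • s ∂Γ⟫ : ℝ) : ℂ)))) := by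
  subst hS hC
  have hNm := N.continuous_of_finiteDimensional.measurable
  have hΓ : ∀ᵐ s ∂Γ, ‖s‖ = 1 := hΓS
  have hSm : MeasurableSet {s : EuclideanSpace ℝ (Fin d) | ‖s‖ = 1} :=
    measurable_norm (measurableSet_singleton 1)
  have hKm : MeasurableSet K := hK ▸ hSm.inter (hNm (measurableSet_singleton 0))
  have hRm := hSm.diff hKm
  have hR : ∀ s ∈ {s : EuclideanSpace ℝ (Fin d) | ‖s‖ = 1} \ K, N s ≠ 0 :=
    fun s hs h0 => hs.2 (hK ▸ ⟨hs.1, h0⟩)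
  have hΓrestrict : Γ.restrict {s | ‖s‖ = 1} = Γ := Measure.restrict_eq_self_of_ae_mem hΓ
  rw [hΓrestrict]
  refine (fun hii => ⟨⟨?_, fun h => ⟨_, _, hii h⟩⟩, hii⟩) ?_
  · rintro ⟨hK0, hfin⟩
    have hlog : IntegrableOn (fun s => |Real.log (N s)|) ({s | ‖s‖ = 1} \ K) Γ :=
      (lintegral_ofReal_ne_top_iff_integrable (Measurable.aestronglyMeasurable (by fun_prop))
        (Filter.Eventually.of_forall fun _ => abs_nonneg _)).1 hfin.ne
    have hcompl := cylinderMeasure_compl N (Γ := Γ) hR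
    have hrestrict : (cylinderMeasure N Γ ({s | ‖s‖ = 1} \ K)).restrict {s | N s = 1}
        = cylinderMeasure N Γ ({s | ‖s‖ = 1} \ K) := Measure.restrict_eq_self_of_ae_mem hcompl
    have hΓR : Γ.restrict ({s | ‖s‖ = 1} \ K) = Γ :=
      Measure.restrict_eq_self_of_ae_mem (by
        filter_upwards [hΓ, measure_eq_zero_iff_ae_notMem.1 hK0] with s h1 h2 using ⟨h1, h2⟩)
    rw [cylinderMeasure] at hrestrict hcompl
    refine ⟨hcompl, fun u => ?_, fun u => ?_⟩
    · rw [hrestrict]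
      exact lintegral_cylinderMeasure_lt_top N hΓ hRm hR hlog u
    · have h := integral_oneStableExponent_cylinderMeasure N hΓ hRm hR hlog u
      rw [cylinderMeasure] at h
      rw [hrestrict, h, inner_add_right, hΓR]
      push_cast
      ring
  · rintro ⟨γ, m, hγC, hγ, heq⟩
    have hγrestrict : γ.restrict {s | N s = 1} = γ := Measure.restrict_eq_self_of_ae_mem hγC
    rw [hγrestrict] at hγ heq
    have hlog : ∀ u : EuclideanSpace ℝ (Fin d),
        Integrable (fun s => |⟪u, s⟫| * |(Real.log |⟪u, s⟫|)|) γ := fun u =>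
      (lintegral_ofReal_ne_top_iff_integrable
        (continuous_abs_inner_mul_abs_log u).aestronglyMeasurable
        (Filter.Eventually.of_forall fun _ => by positivity)).1 (hγ u).ne
    have habs : ∀ u : EuclideanSpace ℝ (Fin d), ∫ s, |⟪u, s⟫| ∂Γ = ∫ s, |⟪u, s⟫| ∂γ := by
      intro u
      have h := congrArg Complex.re (heq u)
      rw [Complex.add_re, Complex.add_re, Complex.neg_re, Complex.neg_re,
        re_integral_oneStableExponent
          (integrable_of_ae_norm_eq_one hΓ (continuous_oneStableExponent u)),
        re_integral_oneStableExponent (integrable_oneStableExponent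
          (integrable_abs_of_integrable_mul_log hlog u) (hlog u))] at h
      simpa using h
    have hfin := lintegral_angularLog_lt_top N hΓ hγC hlog habs
    constructor
    · have hlt := ae_lt_top (measurable_angularLog N) hfin.ne
      refine measure_mono_null (fun s hs => ?_) (ae_iff.1 hlt)
      rw [hK] at hs
      simp [angularLog, hs.2]
    · refine lt_of_le_of_lt ?_ hfin
      refine le_trans ?_ (setLIntegral_le_lintegral ({s | ‖s‖ = 1} \ K) _)
      refine setLIntegral_mono (measurable_angularLog N) fun s hs => ?_
      rw [angularLog, if_neg (hR s hs), show ‖s‖ = 1 from hs.1, div_one]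
end

section
/- Let J ≥ 1 and let ρ_1, …, ρ_J ∈ (0,1) be pairwise distinct. Let m ≥ 1, h ≥ 1 be integers and N a seminorm on ℝ^{m+h+1} (coordinates indexed by i ∈ {−m,…,h}) satisfying condition (S): N(x) = 0 ⟺ x_{−m} = ⋯ = x_0 = 0. For j ∈ {1,…,J} and −m+1 ≤ k ≤ h define d_{j,k} ∈ ℝ^{m+h+1} by (d_{j,k})_i = ρ_j^{k−i} if k ≥ i and 0 otherwise, and set d_{0,−m} = (1,0,…,0). Let I = {−1,+1} × ({1,…,J}×{−m+1,…,h} ∪ {(0,−m)}) and let f : ℝ^{m+h+1} → ℝ^{m+1} be the projection f(x) = (x_{−m},…,x_0). Then for every (θ₀,j₀,k₀) ∈ I with k₀ ≤ −1, and every (θ′,j′,k′) ∈ I: θ′ N(d_{j′,k′})^{-1} f(d_{j′,k′}) = θ₀ N(d_{j₀,k₀})^{-1} f(d_{j₀,k₀}) holds if and only if (θ′,j′,k′) = (θ₀,j₀,k₀). -/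
theorem stmt15 (J : ℕ) (hJ : 1 ≤ J) (ρ : ℕ → ℝ)
    (hρ : ∀ j, 1 ≤ j → j ≤ J → 0 < ρ j ∧ ρ j < 1)
    (hinj : ∀ j j', 1 ≤ j → j ≤ J → 1 ≤ j' → j' ≤ J → ρ j = ρ j' → j = j')
    (m h : ℕ) (hm : 1 ≤ m) (hh : 1 ≤ h)
    (N : Seminorm ℝ (EuclideanSpace ℝ (Fin (m + h + 1))))
    (hN : ∀ x : EuclideanSpace ℝ (Fin (m + h + 1)),
      N x = 0 ↔ ∀ i : Fin (m + h + 1), (i : ℕ) ≤ m → x i = 0)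
    (D : ℕ → ℤ → EuclideanSpace ℝ (Fin (m + h + 1)))
    (hD : ∀ j, 1 ≤ j → j ≤ J → ∀ k : ℤ, -(m : ℤ) + 1 ≤ k → k ≤ (h : ℤ) →
      ∀ i : Fin (m + h + 1),
        D j k i = if ((i : ℕ) : ℤ) - (m : ℤ) ≤ k
          then ρ j ^ (k + (m : ℤ) - ((i : ℕ) : ℤ)).toNat else 0)
    (hD0 : ∀ i : Fin (m + h + 1), D 0 (-(m : ℤ)) i = if (i : ℕ) = 0 then 1 else 0)
    (f : EuclideanSpace ℝ (Fin (m + h + 1)) → EuclideanSpace ℝ (Fin (m + 1)))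
    (hf : ∀ (x : EuclideanSpace ℝ (Fin (m + h + 1))) (i : Fin (m + 1)),
      f x i = x (Fin.castLE (by omega) i))
    (θ₀ : ℝ) (j₀ : ℕ) (k₀ : ℤ)
    (hθ₀ : θ₀ = -1 ∨ θ₀ = 1)
    (hI₀ : (1 ≤ j₀ ∧ j₀ ≤ J ∧ -(m : ℤ) + 1 ≤ k₀ ∧ k₀ ≤ (h : ℤ))
        ∨ (j₀ = 0 ∧ k₀ = -(m : ℤ)))
    (hk₀ : k₀ ≤ -1)
    (θ' : ℝ) (j' : ℕ) (k' : ℤ)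
    (hθ' : θ' = -1 ∨ θ' = 1)
    (hI' : (1 ≤ j' ∧ j' ≤ J ∧ -(m : ℤ) + 1 ≤ k' ∧ k' ≤ (h : ℤ))
        ∨ (j' = 0 ∧ k' = -(m : ℤ))) :
    (θ' * (N (D j' k'))⁻¹) • f (D j' k') = (θ₀ * (N (D j₀ k₀))⁻¹) • f (D j₀ k₀) ↔
      (θ' = θ₀ ∧ j' = j₀ ∧ k' = k₀) := by
  have pos_of_le : ∀ (j : ℕ) (k : ℤ), ((1 ≤ j ∧ j ≤ J ∧ -(m : ℤ) + 1 ≤ k ∧ k ≤ (h : ℤ))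
      ∨ (j = 0 ∧ k = -(m : ℤ))) → ∀ i : Fin (m + h + 1), ((i : ℕ) : ℤ) - m ≤ k → 0 < D j k i := by
    rintro j k (⟨h1, h2, h3, h4⟩ | ⟨rfl, rfl⟩) i hi
    · rw [hD j h1 h2 k h3 h4, if_pos hi]
      exact pow_pos (hρ j h1 h2).1 _
    · rw [hD0, if_pos (by omega)]
      exact one_pos
  have zero_of_lt : ∀ (j : ℕ) (k : ℤ), ((1 ≤ j ∧ j ≤ J ∧ -(m : ℤ) + 1 ≤ k ∧ k ≤ (h : ℤ))
      ∨ (j = 0 ∧ k = -(m : ℤ))) → ∀ i : Fin (m + h + 1), k < ((i : ℕ) : ℤ) - m → D j k i = 0 := by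
    rintro j k (⟨h1, h2, h3, h4⟩ | ⟨rfl, rfl⟩) i hi
    · rw [hD j h1 h2 k h3 h4, if_neg (by omega)]
    · rw [hD0, if_neg (by omega)]
  have one_of_eq : ∀ (j : ℕ) (k : ℤ), ((1 ≤ j ∧ j ≤ J ∧ -(m : ℤ) + 1 ≤ k ∧ k ≤ (h : ℤ))
      ∨ (j = 0 ∧ k = -(m : ℤ))) → ∀ i : Fin (m + h + 1), ((i : ℕ) : ℤ) - m = k → D j k i = 1 := by
    rintro j k (⟨h1, h2, h3, h4⟩ | ⟨rfl, rfl⟩) i hi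
    · rw [hD j h1 h2 k h3 h4, if_pos hi.le, show (k + (m : ℤ) - ((i : ℕ) : ℤ)).toNat = 0 by omega,
        pow_zero]
    · rw [hD0, if_pos (by omega)]
  have N_ne_zero : ∀ (j : ℕ) (k : ℤ), ((1 ≤ j ∧ j ≤ J ∧ -(m : ℤ) + 1 ≤ k ∧ k ≤ (h : ℤ))
      ∨ (j = 0 ∧ k = -(m : ℤ))) → N (D j k) ≠ 0 := by
    intro j k hI h0
    have hle : (((0 : Fin (m + h + 1)) : ℕ) : ℤ) - m ≤ k := by
      rw [Fin.val_zero]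
      omega
    exact (pos_of_le j k hI 0 hle).ne' ((hN _).1 h0 0 (by simp))
  have sign_ne_zero : ∀ θ : ℝ, θ = -1 ∨ θ = 1 → θ ≠ 0 := by
    rintro θ (rfl | rfl) <;> norm_num
  constructor
  · intro heq
    have hc' : θ' * (N (D j' k'))⁻¹ ≠ 0 :=
      mul_ne_zero (sign_ne_zero θ' hθ') (inv_ne_zero (N_ne_zero j' k' hI'))
    have hc₀ : θ₀ * (N (D j₀ k₀))⁻¹ ≠ 0 :=
      mul_ne_zero (sign_ne_zero θ₀ hθ₀) (inv_ne_zero (N_ne_zero j₀ k₀ hI₀))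
    have coord : ∀ i : Fin (m + h + 1), (i : ℕ) ≤ m →
        θ' * (N (D j' k'))⁻¹ * D j' k' i = θ₀ * (N (D j₀ k₀))⁻¹ * D j₀ k₀ i := by
      intro i hi
      have hi' := congrArg (fun x : EuclideanSpace ℝ (Fin (m + 1)) => x ⟨i, by omega⟩) heq
      simp only [PiLp.smul_apply, smul_eq_mul, hf] at hi'
      exact hi'
    obtain ⟨a, ha⟩ : ∃ a : ℕ, (a : ℤ) = k₀ + m := ⟨(k₀ + m).toNat, by omega⟩
    have hk : k' = k₀ := by
      rcases lt_trichotomy k' k₀ with hlt | hk | hgt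
      · have e := coord ⟨a, by omega⟩ (by simp only; omega)
        rw [zero_of_lt j' k' hI' _ (by simp only; omega),
          one_of_eq j₀ k₀ hI₀ _ (by simp only; omega), mul_zero, mul_one] at e
        exact absurd e.symm hc₀
      · exact hk
      · have e := coord ⟨a + 1, by omega⟩ (by simp only; omega)
        rw [zero_of_lt j₀ k₀ hI₀ _ (by simp only; omega), mul_zero] at e
        exact absurd e (mul_ne_zero hc'
          (pos_of_le j' k' hI' _ (by simp only; omega)).ne')
    subst hk
    have hc : θ' * (N (D j' k'))⁻¹ = θ₀ * (N (D j₀ k'))⁻¹ := by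
      have e := coord ⟨a, by omega⟩ (by simp only; omega)
      rwa [one_of_eq j' k' hI' _ (by simp only; omega),
        one_of_eq j₀ k' hI₀ _ (by simp only; omega), mul_one, mul_one] at e
    have hj : j' = j₀ := by
      rcases hI' with ⟨h1, h2, h3, h4⟩ | ⟨h1, h2⟩ <;> rcases hI₀ with ⟨g1, g2, g3, g4⟩ | ⟨g1, g2⟩
      · have e := coord ⟨a - 1, by omega⟩ (by simp only; omega)
        rw [← hc] at e
        have e' := mul_left_cancel₀ hc' e
        have hexp : (k' + (m : ℤ) - ((a - 1 : ℕ) : ℤ)).toNat = 1 := by omega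
        rw [hD j' h1 h2 k' h3 h4, hD j₀ g1 g2 k' g3 g4, if_pos (by simp only; omega),
          if_pos (by simp only; omega)] at e'
        simp only [hexp, pow_one] at e'
        exact hinj j' j₀ h1 h2 g1 g2 e'
      all_goals omega
    subst hj
    exact ⟨mul_right_cancel₀ (inv_ne_zero (N_ne_zero j' k' hI')) hc, rfl, rfl⟩
  · rintro ⟨rfl, rfl, rfl⟩
    rfl
end

section
/- Let 0 < α < 2, J ≥ 1, pairwise distinct ρ_1,…,ρ_J ∈ (0,1), β_j ∈ [−1,1], π_j > 0, m ≥ 1, h ≥ 1 integers, and N a seminorm on ℝ^{m+h+1} (coordinates indexed by i ∈ {−m,…,h}) satisfying condition (S): N(x) = 0 ⟺ x_{−m} = ⋯ = x_0 = 0; let C = {s : N(s) = 1} and f(x) = (x_{−m},…,x_0). Define d_{j,k} ∈ ℝ^{m+h+1} for j ∈ {1,…,J}, −m+1 ≤ k ≤ h by (d_{j,k})_i = ρ_j^{k−i} if k ≥ i and 0 otherwise, set d_{0,−m} = (1,0,…,0), w_{j,θ} = (1+θβ_j)/2, I = {−1,+1}×({1,…,J}×{−m+1,…,h} ∪ {(0,−m)}),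 and let γ = Σ_{j=1}^J Σ_{θ∈{−1,+1}} Σ_{k=−m}^{∞} w_{j,θ} π_j^α N(d_{j,k})^α δ_{θ N(d_{j,k})^{-1} d_{j,k}} (where d_{j,−m} = d_{0,−m} and d_{j,k} = ρ_j^{k−h} d_{j,h} for k ≥ h). Let μ₀ ∈ ℝ^{m+h+1} and μ a probability measure on ℝ^{m+h+1} with characteristic function φ_μ(u) = exp(−∫_C |⟨u,s⟩|^α (1 − i·sign(⟨u,s⟩)·w(α,⟨u,s⟩)) dγ(s) + i⟨u,μ₀⟩) for all u. Fix (θ₀,j₀,k₀) ∈ I with k₀ ≤ −1 and assume γ({θ₀ N(d_{j₀,k₀})^{-1} d_{j₀,k₀}}) > 0. Let V₀ be a closed subset of {v ∈ ℝ^{m+1} : N((v,0,…,0)) = 1} whose interior contains θ₀ N(d_{j₀,k₀})^{-1} f(d_{j₀,k₀}) and such that for every (θ′,j′,k′) ∈ I, θ′ N(d_{j′,k′})^{-1} f(d_{j′,k′}) ∈ V₀ implies θ′ N(d_{j′,k′})^{-1} f(d_{j′,k′}) = θ₀ N(d_{j₀,k₀})^{-1} f(d_{j₀,k₀}); set B(V₀)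 = {s ∈ C : f(s) ∈ V₀}. For (θ,j,k) ∈ I let A_{θ,j,k} be a closed subset of C whose interior contains θ N(d_{j,k})^{-1} d_{j,k} and such that for every (θ′,j′,k′) ∈ I, θ′ N(d_{j′,k′})^{-1} d_{j′,k′} ∈ A_{θ,j,k} implies (θ′,j′,k′) = (θ,j,k). Then lim_{x→∞} μ({y : N(y) > x, N(y)^{-1}y ∈ A_{θ,j,k} ∩ B(V₀)}) / μ({y : N(y) > x, N(y)^{-1}y ∈ B(V₀)}) equals 1 if (θ,j,k) = (θ₀,j₀,k₀) and equals 0 otherwise. -/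
open MeasureTheory Filter
open scoped RealInnerProductSpace Topology

theorem integrableOn_rpow_mul_cexp_neg_mul {a : ℝ} (ha : 0 < a) {z : ℂ} (hz : 0 < z.re) :
    IntegrableOn (fun r : ℝ => ((r ^ (a - 1) : ℝ) : ℂ) * Complex.exp (-(z * r))) (Set.Ioi 0) := by
  have h := integrableOn_rpow_mul_exp_neg_mul_rpow (s := a - 1) (p := 1) (b := z.re)
    (by linarith) one_pos hz
  refine Integrable.mono' h ?_ ?_
  · apply Measurable.aestronglyMeasurable
    fun_prop
  · filter_upwards [ae_restrict_mem measurableSet_Ioi] with r hr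
    have hr' : (0 : ℝ) < r := hr
    rw [norm_mul, Complex.norm_exp, Complex.norm_real, Real.norm_of_nonneg (by positivity)]
    simp

theorem integral_rpow_mul_cexp_neg_mul {a : ℝ} (ha : 0 < a) {z : ℂ} (hz : 0 < z.re) :
    ∫ r in Set.Ioi (0 : ℝ), ((r ^ (a - 1) : ℝ) : ℂ) * Complex.exp (-(z * r))
      = (Real.Gamma a : ℂ) * z ^ (-(a : ℂ)) := by
  set ν : Measure ℝ := (volume.restrict (Set.Ioi 0)).withDensity
    (fun r => ENNReal.ofReal (r ^ (a - 1))) with hν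
  have hmgf : ∀ w : ℂ, ProbabilityTheory.complexMGF id ν w
      = ∫ r in Set.Ioi (0 : ℝ), ((r ^ (a - 1) : ℝ) : ℂ) * Complex.exp (w * r) := by
    intro w
    rw [ProbabilityTheory.complexMGF, hν, integral_withDensity_eq_integral_toReal_smul
      (by fun_prop) (by simp)]
    refine setIntegral_congr_fun measurableSet_Ioi fun r hr => ?_
    have hr' : (0 : ℝ) < r := hr
    simp only [id_eq, ENNReal.toReal_ofReal (Real.rpow_nonneg hr'.le _), Complex.real_smul]
  have hset : Set.Iio 0 ⊆ interior (ProbabilityTheory.integrableExpSet id ν) := by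
    refine interior_maximal ?_ isOpen_Iio
    intro t (ht : t < 0)
    change Integrable _ ν
    rw [hν, integrable_withDensity_iff_integrable_smul₀' (by fun_prop) (by simp)]
    have h := integrableOn_rpow_mul_exp_neg_mul_rpow (s := a - 1) (p := 1) (b := -t)
      (by linarith) one_pos (by linarith)
    refine IntegrableOn.congr_fun h (fun r hr => ?_) measurableSet_Ioi
    have hr' : (0 : ℝ) < r := hr
    simp [ENNReal.toReal_ofReal (Real.rpow_nonneg hr'.le _)]
  set U : Set ℂ := {z | 0 < z.re} with hU
  have hUo : IsOpen U := isOpen_lt continuous_const Complex.continuous_re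
  have h1 : AnalyticOnNhd ℂ (fun z => ProbabilityTheory.complexMGF id ν (-z)) U := by
    apply DifferentiableOn.analyticOnNhd _ hUo
    have hd : DifferentiableOn ℂ (ProbabilityTheory.complexMGF id ν)
        {z | z.re ∈ interior (ProbabilityTheory.integrableExpSet id ν)} :=
      ProbabilityTheory.differentiableOn_complexMGF
    refine hd.comp (f := fun z : ℂ => -z) (by fun_prop) ?_
    intro z (hz : 0 < z.re)
    apply hset
    simpa using hz
  have h2 : AnalyticOnNhd ℂ (fun z : ℂ => (Real.Gamma a : ℂ) * z ^ (-(a : ℂ))) U := by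
    apply DifferentiableOn.analyticOnNhd _ hUo
    intro z hz
    apply DifferentiableAt.differentiableWithinAt
    apply DifferentiableAt.const_mul
    exact (differentiableAt_id).cpow_const (Or.inl hz)
  have hpre : IsPreconnected U := (convex_halfSpace_re_gt 0).isPreconnected
  have key := h1.eqOn_of_preconnected_of_mem_closure h2 hpre (z₀ := 1) (by simp [hU]) ?_
  · have := key hz
    simp only [hmgf] at this
    simpa using this
  · rw [mem_closure_iff_seq_limit]
    refine ⟨fun n : ℕ => ((1 + 1 / ((n : ℝ) + 1) : ℝ) : ℂ), fun n => ?_, ?_⟩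
    · have hp : (0 : ℝ) < 1 + 1 / ((n : ℝ) + 1) := by positivity
      have hp1 : (0 : ℝ) < 1 / ((n : ℝ) + 1) := by positivity
      set x : ℝ := 1 + 1 / ((n : ℝ) + 1) with hx
      refine ⟨?_, ?_⟩
      · change ProbabilityTheory.complexMGF id ν (-(x : ℂ)) = _
        rw [hmgf]
        have := Real.integral_rpow_mul_exp_neg_mul_Ioi ha hp
        have h3 : (fun r : ℝ => ((r ^ (a - 1) : ℝ) : ℂ) * Complex.exp (-(x : ℂ) * r))
            = fun r : ℝ => ((r ^ (a - 1) * Real.exp (-(x * r)) : ℝ) : ℂ) := by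
          funext r; push_cast; ring_nf
        rw [h3, integral_complex_ofReal, this, one_div, Real.inv_rpow hp.le, ← Real.rpow_neg hp.le,
          ← Complex.ofReal_neg, ← Complex.ofReal_cpow hp.le]
        push_cast; ring
      · simp only [Set.mem_singleton_iff]
        intro hh
        have : x = 1 := Complex.ofReal_eq_one.mp hh
        linarith
    · have h4 : Tendsto (fun n : ℕ => (1 + 1 / ((n : ℝ) + 1) : ℝ)) atTop (𝓝 (1 + 0)) :=
        tendsto_const_nhds.add tendsto_one_div_add_atTop_nhds_zero_nat
      have := (Complex.continuous_ofReal.tendsto _).comp h4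
      simpa [Function.comp_def] using this

theorem norm_one_sub_cexp_neg_le_two {w : ℂ} (hw : 0 ≤ w.re) : ‖1 - Complex.exp (-w)‖ ≤ 2 := by
  have : ‖Complex.exp (-w)‖ ≤ 1 := by
    rw [Complex.norm_exp]; simpa using hw
  calc ‖1 - Complex.exp (-w)‖ ≤ ‖(1 : ℂ)‖ + ‖Complex.exp (-w)‖ := norm_sub_le _ _
    _ ≤ 2 := by rw [norm_one]; linarith

theorem norm_one_sub_cexp_neg_le {w : ℂ} (hw : 0 ≤ w.re) :
    ‖1 - Complex.exp (-w)‖ ≤ 2 * ‖w‖ := by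
  rcases le_total ‖w‖ 1 with h | h
  · rw [norm_sub_rev]
    simpa using Complex.norm_exp_sub_one_le (x := -w) (by simpa using h)
  · linarith [norm_one_sub_cexp_neg_le_two hw]

theorem norm_one_sub_cexp_neg_sub_le {w : ℂ} (hw : 0 ≤ w.re) :
    ‖1 - Complex.exp (-w) - w‖ ≤ 3 * ‖w‖ := by
  have := norm_one_sub_cexp_neg_le hw
  linarith [norm_sub_le (1 - Complex.exp (-w)) w]

theorem norm_one_sub_cexp_neg_sub_le_sq {w : ℂ} (hw : 0 ≤ w.re) :
    ‖1 - Complex.exp (-w) - w‖ ≤ 3 * ‖w‖ ^ 2 := by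
  rcases le_total ‖w‖ 1 with h | h
  · have := Complex.norm_exp_sub_one_sub_id_le (x := -w) (by simpa using h)
    rw [← norm_neg] 
    have e : -(1 - Complex.exp (-w) - w) = Complex.exp (-w) - 1 - -w := by ring
    rw [e]
    rw [norm_neg] at this
    nlinarith [norm_nonneg w]
  · have := norm_one_sub_cexp_neg_sub_le hw
    nlinarith

theorem integrableOn_ite_rpow {e₁ e₂ : ℝ} (h₁ : -1 < e₁) (h₂ : e₂ < -1) :
    IntegrableOn (fun r : ℝ => if r ≤ 1 then r ^ e₁ else r ^ e₂) (Set.Ioi 0) := by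
  rw [← Set.Ioc_union_Ioi_eq_Ioi (zero_le_one' ℝ)]
  refine IntegrableOn.union ?_ ?_
  · have : IntegrableOn (fun r : ℝ => r ^ e₁) (Set.Ioc 0 1) :=
      (intervalIntegrable_iff_integrableOn_Ioc_of_le zero_le_one).1
        (intervalIntegral.intervalIntegrable_rpow' h₁)
    refine this.congr_fun (fun r hr => ?_) measurableSet_Ioc
    simp [hr.2]
  · refine (integrableOn_Ioi_rpow_of_lt h₂ one_pos).congr_fun (fun r hr => ?_) measurableSet_Ioi
    have : ¬ r ≤ 1 := not_le.2 hr
    simp [this]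

theorem norm_mul_rpow_le_ite {u : ℝ → ℂ} {a p q K : ℝ}
    (hp' : ∀ r, 0 < r → ‖u r‖ ≤ K * r ^ p) (hq' : ∀ r, 0 < r → ‖u r‖ ≤ K * r ^ q)
    {r : ℝ} (hr : 0 < r) :
    ‖u r‖ * r ^ (-1 - a) ≤ K * (if r ≤ 1 then r ^ (p - 1 - a) else r ^ (q - 1 - a)) := by
  have hpos : 0 ≤ r ^ (-1 - a) := by positivity
  split_ifs
  · calc _ ≤ K * r ^ p * r ^ (-1 - a) := by gcongr; exact hp' r hr
      _ = _ := by rw [mul_assoc, ← Real.rpow_add hr]; ring_nf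
  · calc _ ≤ K * r ^ q * r ^ (-1 - a) := by gcongr; exact hq' r hr
      _ = _ := by rw [mul_assoc, ← Real.rpow_add hr]; ring_nf

theorem integrableOn_mul_rpow {u : ℝ → ℂ} {a p q K : ℝ} (hu : Measurable u)
    (hp : a < p) (hq : q < a)
    (hp' : ∀ r, 0 < r → ‖u r‖ ≤ K * r ^ p) (hq' : ∀ r, 0 < r → ‖u r‖ ≤ K * r ^ q) :
    IntegrableOn (fun r : ℝ => u r * ((r ^ (-1 - a) : ℝ) : ℂ)) (Set.Ioi 0) := by
  refine Integrable.mono' ((integrableOn_ite_rpow (e₁ := p - 1 - a) (e₂ := q - 1 - a)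
    (by linarith) (by linarith)).const_mul K) ?_ ?_
  · apply Measurable.aestronglyMeasurable
    fun_prop
  · filter_upwards [ae_restrict_mem measurableSet_Ioi] with r hr
    have hr' : (0 : ℝ) < r := hr
    rw [norm_mul, Complex.norm_real, Real.norm_of_nonneg (by positivity)]
    exact norm_mul_rpow_le_ite hp' hq' hr'

theorem integral_mul_rpow_eq {u u' : ℝ → ℂ} {a p q K : ℝ} (ha : 0 < a) (hu : Measurable u)
    (hp : a < p) (hq : q < a)
    (hp' : ∀ r, 0 < r → ‖u r‖ ≤ K * r ^ p) (hq' : ∀ r, 0 < r → ‖u r‖ ≤ K * r ^ q)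
    (hd : ∀ r, 0 < r → HasDerivAt u (u' r) r)
    (hi : IntegrableOn (fun r : ℝ => u' r * ((r ^ (-a) : ℝ) : ℂ)) (Set.Ioi 0)) :
    ∫ r in Set.Ioi (0 : ℝ), u r * ((r ^ (-1 - a) : ℝ) : ℂ)
      = (1 / a : ℂ) * ∫ r in Set.Ioi (0 : ℝ), u' r * ((r ^ (-a) : ℝ) : ℂ) := by
  have hnorm : ∀ r : ℝ, 0 < r → ‖u r * ((-(r ^ (-a)) / a : ℝ) : ℂ)‖ = ‖u r‖ * (r ^ (-a) / a) := by
    intro r hr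
    rw [norm_mul, Complex.norm_real, neg_div, norm_neg, Real.norm_of_nonneg (by positivity)]
  have h := integral_Ioi_mul_deriv_eq_deriv_mul (a := 0) (u := u) (u' := u')
    (v := fun r : ℝ => ((-(r ^ (-a)) / a : ℝ) : ℂ)) (v' := fun r : ℝ => ((r ^ (-1 - a) : ℝ) : ℂ))
    (a' := 0) (b' := 0) hd ?_ (integrableOn_mul_rpow hu hp hq hp' hq') ?_ ?_ ?_
  · rw [h, ← integral_const_mul, sub_zero, zero_sub, ← integral_neg]
    congr 1
    funext r
    push_cast
    ring
  · intro r hr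
    have hr' : (0 : ℝ) < r := hr
    have := ((Real.hasDerivAt_rpow_const (p := -a) (Or.inl hr'.ne')).neg.div_const a).ofReal_comp
    have e : -(-a * r ^ (-a - 1)) / a = r ^ (-1 - a) := by
      rw [show -a - 1 = -1 - a by ring]
      field_simp
    rw [e] at this
    exact this
  · have := hi.mul_const (-(1 / a : ℂ))
    refine this.congr (Eventually.of_forall fun r => ?_)
    simp only [Pi.mul_apply]
    push_cast
    ring
  · refine squeeze_zero_norm' (a := fun r => K / a * r ^ (p - a)) ?_ ?_
    · filter_upwards [self_mem_nhdsWithin] with r hr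
      have hr' : (0 : ℝ) < r := hr
      rw [Pi.mul_apply, hnorm r hr']
      calc _ ≤ K * r ^ p * (r ^ (-a) / a) := by gcongr; exact hp' r hr
        _ = _ := by rw [sub_eq_add_neg, Real.rpow_add hr']; ring
    · have : Tendsto (fun r : ℝ => r ^ (p - a)) (𝓝 0) (𝓝 (0 ^ (p - a))) :=
        (Real.continuousAt_rpow_const 0 (p - a) (Or.inr (by linarith))).tendsto
      rw [Real.zero_rpow (by linarith)] at this
      simpa using (this.mono_left nhdsWithin_le_nhds).const_mul (K / a)
  · refine squeeze_zero_norm' (a := fun r => K / a * r ^ (-(a - q))) ?_ ?_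
    · filter_upwards [eventually_gt_atTop 0] with r hr'
      rw [Pi.mul_apply, hnorm r hr']
      calc _ ≤ K * r ^ q * (r ^ (-a) / a) := by gcongr; exact hq' r hr'
        _ = _ := by rw [show -(a - q) = q + -a by ring, Real.rpow_add hr']; ring
    · simpa using (tendsto_rpow_neg_atTop (y := a - q) (by linarith)).const_mul (K / a)

theorem norm_one_sub_cexp_neg_mul_le {z : ℂ} (hz : 0 ≤ z.re) {r : ℝ} (hr : 0 < r) :
    ‖1 - Complex.exp (-(z * r))‖ ≤ (2 * ‖z‖ + 2) * r ^ (1 : ℝ) := by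
  have := norm_one_sub_cexp_neg_le (w := z * r) (by simpa using mul_nonneg hz hr.le)
  rw [norm_mul, Complex.norm_real, Real.norm_of_nonneg hr.le] at this
  rw [Real.rpow_one]
  linarith

theorem norm_one_sub_cexp_neg_mul_le' {z : ℂ} (hz : 0 ≤ z.re) {r : ℝ} (hr : 0 < r) :
    ‖1 - Complex.exp (-(z * r))‖ ≤ (2 * ‖z‖ + 2) * r ^ (0 : ℝ) := by
  have := norm_one_sub_cexp_neg_le_two (w := z * r) (by simpa using mul_nonneg hz hr.le)
  rw [Real.rpow_zero]
  linarith [norm_nonneg z]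

theorem hasDerivAt_cexp_neg_mul (z : ℂ) (r : ℝ) :
    HasDerivAt (fun r : ℝ => 1 - Complex.exp (-(z * r))) (z * Complex.exp (-(z * r))) r := by
  have h1 : HasDerivAt (fun r : ℝ => -(z * (r : ℂ))) (-(z * 1)) r :=
    ((Complex.ofRealCLM.hasDerivAt (x := r)).const_mul z).neg
  convert! (h1.cexp.const_sub 1) using 1
  ring

theorem integral_one_sub_cexp_mul_rpow_of_re_pos {a : ℝ} (ha : 0 < a) (ha1 : a < 1) {z : ℂ}
    (hz : 0 < z.re) :
    ∫ r in Set.Ioi (0 : ℝ), (1 - Complex.exp (-(z * r))) * ((r ^ (-1 - a) : ℝ) : ℂ)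
      = (Real.Gamma (1 - a) : ℂ) * z ^ (a : ℂ) / a := by
  have hz0 : z ≠ 0 := by rintro rfl; simp at hz
  have hi := integrableOn_rpow_mul_cexp_neg_mul (a := 1 - a) (by linarith) hz
  have hv := integral_rpow_mul_cexp_neg_mul (a := 1 - a) (by linarith) hz
  rw [show 1 - a - 1 = -a by ring] at hi hv
  have e : ∀ r : ℝ, z * Complex.exp (-(z * r)) * ((r ^ (-a) : ℝ) : ℂ)
      = z * (((r ^ (-a) : ℝ) : ℂ) * Complex.exp (-(z * r))) := fun r => by ring
  rw [integral_mul_rpow_eq ha (by fun_prop) ha1 ha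
    (fun r hr => norm_one_sub_cexp_neg_mul_le hz.le hr)
    (fun r hr => norm_one_sub_cexp_neg_mul_le' hz.le hr) (fun r _ => hasDerivAt_cexp_neg_mul z r)]
  · simp_rw [e]
    rw [integral_const_mul, hv]
    have : z ^ (a : ℂ) = z * z ^ (-((1 - a : ℝ) : ℂ)) := by
      have := Complex.cpow_add 1 (-((1 - a : ℝ) : ℂ)) hz0
      rw [Complex.cpow_one] at this
      rw [← this]
      push_cast; ring_nf
    rw [this]; ring
  · simp_rw [e]
    exact hi.const_mul z

theorem integral_one_sub_cexp_mul_rpow {a : ℝ} (ha : 0 < a) (ha1 : a < 1) {z : ℂ}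
    (hz : 0 ≤ z.re) (hz' : z ∈ Complex.slitPlane) :
    ∫ r in Set.Ioi (0 : ℝ), (1 - Complex.exp (-(z * r))) * ((r ^ (-1 - a) : ℝ) : ℂ)
      = (Real.Gamma (1 - a) : ℂ) * z ^ (a : ℂ) / a := by
  have hlim : Tendsto (fun n : ℕ => z + ((1 / ((n : ℝ) + 1) : ℝ) : ℂ)) atTop (𝓝 z) := by
    have := (Complex.continuous_ofReal.tendsto 0).comp (tendsto_one_div_add_atTop_nhds_zero_nat (𝕜 := ℝ))
    simpa [Function.comp_def] using this.const_add z
  have hpos : ∀ n : ℕ, (0 : ℝ) < 1 / ((n : ℝ) + 1) := fun n => by positivity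
  have hle : ∀ n : ℕ, 1 / ((n : ℝ) + 1) ≤ 1 := fun n => by
    rw [div_le_one (by positivity)]; linarith [(Nat.cast_nonneg n : (0 : ℝ) ≤ n)]
  have h1 : Tendsto (fun n : ℕ => (Real.Gamma (1 - a) : ℂ)
      * (z + ((1 / ((n : ℝ) + 1) : ℝ) : ℂ)) ^ (a : ℂ) / a) atTop
      (𝓝 ((Real.Gamma (1 - a) : ℂ) * z ^ (a : ℂ) / a)) :=
    ((hlim.cpow tendsto_const_nhds hz').const_mul _).div_const _
  refine tendsto_nhds_unique ?_ h1
  have hre : ∀ n : ℕ, 0 < (z + ((1 / ((n : ℝ) + 1) : ℝ) : ℂ)).re := fun n => by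
    rw [Complex.add_re, Complex.ofReal_re]; linarith [hpos n]
  have h2 : ∀ n : ℕ, (Real.Gamma (1 - a) : ℂ)
      * (z + ((1 / ((n : ℝ) + 1) : ℝ) : ℂ)) ^ (a : ℂ) / a
      = ∫ r in Set.Ioi (0 : ℝ), (1 - Complex.exp (-((z + ((1 / ((n : ℝ) + 1) : ℝ) : ℂ)) * r)))
        * ((r ^ (-1 - a) : ℝ) : ℂ) := fun n =>
    (integral_one_sub_cexp_mul_rpow_of_re_pos ha ha1 (hre n)).symm
  simp_rw [h2]
  have hnorm : ∀ n : ℕ, ‖z + ((1 / ((n : ℝ) + 1) : ℝ) : ℂ)‖ ≤ ‖z‖ + 1 := fun n => by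
    refine (norm_add_le _ _).trans ?_
    rw [Complex.norm_real, Real.norm_of_nonneg (hpos n).le]
    linarith [hle n]
  refine tendsto_integral_of_dominated_convergence
    (fun r => (2 * (‖z‖ + 1) + 2) * (if r ≤ 1 then r ^ (1 - 1 - a) else r ^ (0 - 1 - a))) ?_ ?_ ?_ ?_
  · intro n
    apply Measurable.aestronglyMeasurable
    fun_prop
  · exact (integrableOn_ite_rpow (by linarith) (by linarith)).const_mul _
  · intro n
    filter_upwards [ae_restrict_mem measurableSet_Ioi] with r hr
    have hr' : (0 : ℝ) < r := hr
    rw [norm_mul, Complex.norm_real, Real.norm_of_nonneg (r := r ^ (-1 - a)) (by positivity)]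
    refine norm_mul_rpow_le_ite (u := fun r : ℝ =>
      1 - Complex.exp (-((z + ((1 / ((n : ℝ) + 1) : ℝ) : ℂ)) * r))) (fun r hr => ?_)
      (fun r hr => ?_) hr'
    · refine (norm_one_sub_cexp_neg_mul_le (hre n).le hr).trans ?_
      gcongr
      exact hnorm n
    · refine (norm_one_sub_cexp_neg_mul_le' (hre n).le hr).trans ?_
      gcongr
      exact hnorm n
  · refine Eventually.of_forall fun r => ?_
    have hc : Continuous fun z : ℂ => (1 - Complex.exp (-(z * r))) * ((r ^ (-1 - a) : ℝ) : ℂ) := by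
      fun_prop
    exact (hc.tendsto z).comp hlim

theorem norm_one_sub_cexp_neg_mul_sub_le {z : ℂ} (hz : 0 ≤ z.re) {r : ℝ} (hr : 0 < r) :
    ‖1 - Complex.exp (-(z * r)) - z * r‖ ≤ (3 * ‖z‖ + 3 * ‖z‖ ^ 2) * r ^ (1 : ℝ) := by
  have := norm_one_sub_cexp_neg_sub_le (w := z * r) (by simpa using mul_nonneg hz hr.le)
  rw [norm_mul, Complex.norm_real, Real.norm_of_nonneg hr.le] at this
  rw [Real.rpow_one]
  nlinarith [mul_nonneg (sq_nonneg ‖z‖) hr.le]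

theorem norm_one_sub_cexp_neg_mul_sub_le_sq {z : ℂ} (hz : 0 ≤ z.re) {r : ℝ} (hr : 0 < r) :
    ‖1 - Complex.exp (-(z * r)) - z * r‖ ≤ (3 * ‖z‖ + 3 * ‖z‖ ^ 2) * r ^ (2 : ℝ) := by
  have := norm_one_sub_cexp_neg_sub_le_sq (w := z * r) (by simpa using mul_nonneg hz hr.le)
  rw [norm_mul, Complex.norm_real, Real.norm_of_nonneg hr.le] at this
  rw [Real.rpow_two]
  nlinarith [mul_nonneg (norm_nonneg z) (sq_nonneg r)]

theorem integral_one_sub_cexp_sub_mul_rpow {a : ℝ} (ha : 1 < a) (ha2 : a < 2) {z : ℂ}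
    (hz : 0 ≤ z.re) (hz' : z ∈ Complex.slitPlane) :
    ∫ r in Set.Ioi (0 : ℝ), (1 - Complex.exp (-(z * r)) - z * r) * ((r ^ (-1 - a) : ℝ) : ℂ)
      = -((Real.Gamma (2 - a) : ℂ) * z ^ (a : ℂ) / (a * (a - 1))) := by
  have hz0 : z ≠ 0 := Complex.slitPlane_ne_zero hz'
  have hd : ∀ r : ℝ, HasDerivAt (fun r : ℝ => 1 - Complex.exp (-(z * r)) - z * r)
      (z * Complex.exp (-(z * r)) - z * 1) r := fun r =>
    (hasDerivAt_cexp_neg_mul z r).sub ((Complex.ofRealCLM.hasDerivAt (x := r)).const_mul z)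
  have hi := integrableOn_mul_rpow (u := fun r : ℝ => 1 - Complex.exp (-(z * r))) (a := a - 1)
    (by fun_prop) (by linarith) (by linarith)
    (fun r hr => norm_one_sub_cexp_neg_mul_le hz hr)
    (fun r hr => norm_one_sub_cexp_neg_mul_le' hz hr)
  have hv := integral_one_sub_cexp_mul_rpow (a := a - 1) (by linarith) (by linarith) hz hz'
  rw [show -1 - (a - 1) = -a by ring] at hi hv
  have e : ∀ r : ℝ, (z * Complex.exp (-(z * r)) - z * 1) * ((r ^ (-a) : ℝ) : ℂ)
      = (-z) * ((1 - Complex.exp (-(z * r))) * ((r ^ (-a) : ℝ) : ℂ)) := fun r => by ring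
  rw [integral_mul_rpow_eq (by linarith) (by fun_prop) ha2 ha
    (fun r hr => norm_one_sub_cexp_neg_mul_sub_le_sq hz hr)
    (fun r hr => norm_one_sub_cexp_neg_mul_sub_le hz hr) (fun r _ => hd r)]
  · simp_rw [e]
    rw [integral_const_mul, hv]
    have : z ^ (a : ℂ) = z * z ^ ((a - 1 : ℝ) : ℂ) := by
      have := Complex.cpow_add 1 ((a - 1 : ℝ) : ℂ) hz0
      rw [Complex.cpow_one] at this
      rw [← this]
      push_cast; ring_nf
    have h1 : (a : ℂ) ≠ 0 := by exact_mod_cast (by linarith : a ≠ 0)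
    have h2 : (a : ℂ) - 1 ≠ 0 := by exact_mod_cast (by linarith : a - 1 ≠ 0)
    rw [this, show 1 - (a - 1) = 2 - a by ring]
    push_cast
    field_simp
  · simp_rw [e]
    exact hi.const_mul (-z)

/-- The Lévy exponent of the standard totally right-skewed `α`-stable law on `ℝ`. -/
noncomputable def stableExponent (α t : ℝ) : ℂ :=
  ((|t| ^ α : ℝ) : ℂ) * (1 - Complex.I * ((Real.sign t
    * (if α = 1 then -(2 / Real.pi) * Real.log |t| else Real.tan (Real.pi * α / 2)) : ℝ) : ℂ))

theorem neg_I_mul_mem_slitPlane {t : ℝ} (ht : t ≠ 0) :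
    -(Complex.I * t) ∈ Complex.slitPlane := by
  rw [Complex.mem_slitPlane_iff]
  right
  simpa using ht

theorem log_neg_I_mul {t : ℝ} (ht : t ≠ 0) :
    Complex.log (-(Complex.I * t))
      = (Real.log |t| : ℂ) - Complex.I * ((Real.sign t * (Real.pi / 2) : ℝ) : ℂ) := by
  rcases ht.lt_or_gt with h | h
  · rw [show -(Complex.I * t) = ((-t : ℝ) : ℂ) * Complex.I by push_cast; ring,
      Complex.log_ofReal_mul (by linarith) Complex.I_ne_zero, Complex.log_I, abs_of_neg h,
      Real.sign_of_neg h]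
    push_cast; ring
  · rw [show -(Complex.I * t) = ((t : ℝ) : ℂ) * (-Complex.I) by ring,
      Complex.log_ofReal_mul h (neg_ne_zero.2 Complex.I_ne_zero), Complex.log_neg_I, abs_of_pos h,
      Real.sign_of_pos h]
    push_cast; ring

theorem neg_I_mul_cpow {t : ℝ} (ht : t ≠ 0) (a : ℝ) :
    (-(Complex.I * t)) ^ (a : ℂ) = ((|t| ^ a : ℝ) : ℂ)
      * ((Real.cos (Real.pi * a / 2) : ℂ)
        - Complex.I * ((Real.sign t * Real.sin (Real.pi * a / 2) : ℝ) : ℂ)) := by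
  rw [Complex.cpow_def_of_ne_zero (Complex.slitPlane_ne_zero (neg_I_mul_mem_slitPlane ht)),
    log_neg_I_mul ht, sub_mul, sub_eq_add_neg, Complex.exp_add,
    Real.rpow_def_of_pos (abs_pos.2 ht)]
  push_cast
  congr 1
  rcases ht.lt_or_gt with h | h
  · rw [Real.sign_of_neg h]
    rw [show -(Complex.I * (((-1 : ℝ) : ℂ) * (Real.pi / 2)) * (a : ℂ))
      = (Real.pi * a / 2 : ℂ) * Complex.I by push_cast; ring, Complex.exp_mul_I]
    push_cast; ring
  · rw [Real.sign_of_pos h]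
    rw [show -(Complex.I * (((1 : ℝ) : ℂ) * (Real.pi / 2)) * (a : ℂ))
      = (-(Real.pi * a / 2) : ℂ) * Complex.I by push_cast; ring, Complex.exp_mul_I,
      Complex.cos_neg, Complex.sin_neg]
    push_cast; ring

theorem stableExponent_eq_cpow {α t : ℝ} (ht : t ≠ 0) (hα : α ≠ 1)
    (hc : Real.cos (Real.pi * α / 2) ≠ 0) :
    stableExponent α t = (-(Complex.I * t)) ^ (α : ℂ) / (Real.cos (Real.pi * α / 2) : ℂ) := by
  rw [stableExponent, if_neg hα, neg_I_mul_cpow ht, Real.tan_eq_sin_div_cos]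
  have : (Real.cos (Real.pi * α / 2) : ℂ) ≠ 0 := by exact_mod_cast hc
  push_cast at this ⊢
  field_simp

theorem stableExponent_one_eq {t : ℝ} (ht : t ≠ 0) :
    stableExponent 1 t
      = -(2 / Real.pi) * (-(Complex.I * t) * Complex.log (-(Complex.I * t))) := by
  rw [stableExponent, if_pos rfl, log_neg_I_mul ht, Real.rpow_one]
  have h1 : ((|t| : ℝ) : ℂ) = ((Real.sign t * t : ℝ) : ℂ) := by
    rcases ht.lt_or_gt with h | h
    · rw [Real.sign_of_neg h, abs_of_neg h]; simp
    · rw [Real.sign_of_pos h, abs_of_pos h]; simp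
  have h2 : (Real.sign t : ℂ) * (Real.sign t : ℂ) = 1 := by
    rcases ht.lt_or_gt with h | h
    · rw [Real.sign_of_neg h]; simp
    · rw [Real.sign_of_pos h]; simp
  have hpi : (Real.pi : ℂ) ≠ 0 := by exact_mod_cast Real.pi_ne_zero
  rw [h1]
  push_cast
  field_simp
  linear_combination (2 * Complex.I * (t : ℂ) * ((Real.log |t| : ℝ) : ℂ)) * h2
    + ((Real.pi : ℂ) * t * Real.sign t) * Complex.I_sq

theorem integral_ite_mul_rpow {a : ℝ} (ha1 : a < 1) :
    IntegrableOn (fun r : ℝ => (if r ≤ 1 then r else 0) * r ^ (-1 - a)) (Set.Ioi 0) ∧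
    ∫ r in Set.Ioi (0 : ℝ), (if r ≤ 1 then r else 0) * r ^ (-1 - a) = 1 / (1 - a) := by
  have e : Set.EqOn (fun r : ℝ => (if r ≤ 1 then r else 0) * r ^ (-1 - a))
      ((Set.Ioc 0 1).indicator fun r => r ^ (-a)) (Set.Ioi 0) := by
    intro r hr
    have hr' : (0 : ℝ) < r := hr
    by_cases h : r ≤ 1
    · simp only [h, if_true]
      have e1 := Real.rpow_add hr' 1 (-1 - a)
      rw [Real.rpow_one] at e1
      rw [Set.indicator_of_mem (show r ∈ Set.Ioc 0 1 from ⟨hr', h⟩), ← e1]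
      ring_nf
    · simp [h]
  have hi : IntegrableOn (fun r : ℝ => r ^ (-a)) (Set.Ioc 0 1) :=
      (intervalIntegrable_iff_integrableOn_Ioc_of_le zero_le_one).1
        (intervalIntegral.intervalIntegrable_rpow' (by linarith))
  constructor
  · refine IntegrableOn.congr_fun ?_ e.symm measurableSet_Ioi
    exact (hi.integrable_indicator measurableSet_Ioc).integrableOn
  · rw [setIntegral_congr_fun measurableSet_Ioi e, setIntegral_indicator measurableSet_Ioc,
      Set.inter_eq_right.2 Set.Ioc_subset_Ioi_self, ← intervalIntegral.integral_of_le zero_le_one,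
      integral_rpow (Or.inl (by linarith)), Real.zero_rpow (by linarith), Real.one_rpow]
    ring_nf

theorem norm_one_sub_cexp_sub_ite_le {z : ℂ} (hz : 0 ≤ z.re) {r : ℝ} (hr : 0 < r) :
    ‖1 - Complex.exp (-(z * r)) - z * ((if r ≤ 1 then r else 0 : ℝ) : ℂ)‖
      ≤ (3 * ‖z‖ ^ 2 + 2) * (if r ≤ 1 then r ^ 2 else 1) := by
  have hz' : 0 ≤ (z * r).re := by simpa using mul_nonneg hz hr.le
  split_ifs
  · have := norm_one_sub_cexp_neg_sub_le_sq hz'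
    rw [norm_mul, Complex.norm_real, Real.norm_of_nonneg hr.le] at this
    nlinarith [sq_nonneg r]
  · have := norm_one_sub_cexp_neg_le_two hz'
    simp only [Complex.ofReal_zero, mul_zero, sub_zero]
    nlinarith [sq_nonneg ‖z‖]

theorem norm_one_sub_cexp_sub_ite_mul_rpow_le {z : ℂ} (hz : 0 ≤ z.re) {r a : ℝ} (hr : 0 < r)
    (ha : 1 / 2 ≤ a) (ha1 : a ≤ 1) :
    ‖1 - Complex.exp (-(z * r)) - z * ((if r ≤ 1 then r else 0 : ℝ) : ℂ)‖ * r ^ (-1 - a)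
      ≤ (3 * ‖z‖ ^ 2 + 2) * (if r ≤ 1 then r ^ (0 : ℝ) else r ^ (-3 / 2 : ℝ)) := by
  have h := norm_one_sub_cexp_sub_ite_le hz hr
  have hp : 0 ≤ r ^ (-1 - a) := by positivity
  refine (mul_le_mul_of_nonneg_right h hp).trans ?_
  rw [mul_assoc]
  gcongr
  split_ifs with h1
  · rw [← Real.rpow_two, ← Real.rpow_add hr]
    exact Real.rpow_le_rpow_of_exponent_ge hr h1 (by linarith)
  · rw [one_mul]
    exact Real.rpow_le_rpow_of_exponent_le (by linarith) (by linarith)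

theorem integral_one_sub_cexp_sub_ite {z : ℂ} (hz : 0 ≤ z.re) (hz' : z ∈ Complex.slitPlane) :
    ∫ r in Set.Ioi (0 : ℝ), (1 - Complex.exp (-(z * r)) - z * ((if r ≤ 1 then r else 0 : ℝ) : ℂ))
        * ((r ^ (-1 - (1 : ℝ)) : ℝ) : ℂ)
      = -(z * Complex.log z) + ((deriv Real.Gamma 1 + 1 : ℝ) : ℂ) * z := by
  have hz0 : z ≠ 0 := Complex.slitPlane_ne_zero hz'
  set G : ℝ → ℂ := fun a => (Real.Gamma (2 - a) : ℂ) * z ^ (a : ℂ) / a with hG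
  have hGd : HasDerivAt G (z * Complex.log z - ((deriv Real.Gamma 1 + 1 : ℝ) : ℂ) * z) 1 := by
    have h1 : HasDerivAt (fun a : ℝ => ((Real.Gamma (2 - a) : ℝ) : ℂ))
        ((-(deriv Real.Gamma 1) : ℝ) : ℂ) 1 := by
      apply HasDerivAt.ofReal_comp
      have hg : HasDerivAt Real.Gamma (deriv Real.Gamma 1) (2 - 1) := by
        norm_num
        exact (Real.differentiableAt_Gamma (fun m => by
          have : (0 : ℝ) ≤ m := Nat.cast_nonneg m
          linarith))
      exact hg.comp_const_sub 2 1
    have h2 : HasDerivAt (fun a : ℝ => z ^ (a : ℂ)) (z ^ ((1 : ℝ) : ℂ) * Complex.log z * 1) 1 :=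
      ((hasDerivAt_id ((1 : ℝ) : ℂ)).const_cpow (Or.inl hz0)).comp_ofReal
    have h3 : HasDerivAt (fun a : ℝ => (a : ℂ)) 1 1 := Complex.ofRealCLM.hasDerivAt
    have := (h1.mul h2).div h3 (by simp)
    convert! this using 1
    norm_num
    ring
  have hlim : Tendsto (fun n : ℕ => 1 - 1 / ((n : ℝ) + 2)) atTop (𝓝[≠] 1) := by
    rw [tendsto_nhdsWithin_iff]
    constructor
    · have := (tendsto_const_div_atTop_nhds_zero_nat (1 : ℝ)).comp (tendsto_add_atTop_nat 2)
      simpa [Function.comp_def] using this.const_sub 1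
    · refine Eventually.of_forall fun n => ?_
      have : (0 : ℝ) < 1 / ((n : ℝ) + 2) := by positivity
      simp only [Set.mem_compl_iff, Set.mem_singleton_iff]
      linarith
  have hslope := ((hasDerivAt_iff_tendsto_slope.1 hGd).comp hlim).neg
  rw [show -(z * Complex.log z - ((deriv Real.Gamma 1 + 1 : ℝ) : ℂ) * z)
    = -(z * Complex.log z) + ((deriv Real.Gamma 1 + 1 : ℝ) : ℂ) * z by ring] at hslope
  refine tendsto_nhds_unique ?_ hslope
  have ha : ∀ n : ℕ, 1 / 2 ≤ 1 - 1 / ((n : ℝ) + 2) ∧ 1 - 1 / ((n : ℝ) + 2) < 1 := fun n => by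
    have h1 : (0 : ℝ) < 1 / ((n : ℝ) + 2) := by positivity
    have h2 : 1 / ((n : ℝ) + 2) ≤ 1 / 2 := by
      apply one_div_le_one_div_of_le (by norm_num)
      linarith [(Nat.cast_nonneg n : (0 : ℝ) ≤ n)]
    constructor <;> linarith
  have hval : ∀ a : ℝ, 1 / 2 ≤ a → a < 1 → -(slope G 1 a)
      = ∫ r in Set.Ioi (0 : ℝ),
        (1 - Complex.exp (-(z * r)) - z * ((if r ≤ 1 then r else 0 : ℝ) : ℂ))
        * ((r ^ (-1 - a) : ℝ) : ℂ) := by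
    intro a ha ha1
    have hi1 := integrableOn_mul_rpow (u := fun r : ℝ => 1 - Complex.exp (-(z * r))) (a := a)
      (by fun_prop) ha1 (by linarith)
      (fun r hr => norm_one_sub_cexp_neg_mul_le hz hr)
      (fun r hr => norm_one_sub_cexp_neg_mul_le' hz hr)
    have hi2 : IntegrableOn (fun r : ℝ => (((if r ≤ 1 then r else 0) * r ^ (-1 - a) : ℝ) : ℂ))
        (Set.Ioi 0) := (integral_ite_mul_rpow ha1).1.ofReal
    have e : ∀ r : ℝ, (1 - Complex.exp (-(z * r)) - z * ((if r ≤ 1 then r else 0 : ℝ) : ℂ))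
        * ((r ^ (-1 - a) : ℝ) : ℂ) = (1 - Complex.exp (-(z * r))) * ((r ^ (-1 - a) : ℝ) : ℂ)
        - z * (((if r ≤ 1 then r else 0) * r ^ (-1 - a) : ℝ) : ℂ) := fun r => by
      rw [Complex.ofReal_mul]; ring
    simp_rw [e]
    rw [integral_sub hi1 (hi2.const_mul z), integral_one_sub_cexp_mul_rpow (by linarith) ha1 hz hz',
      integral_const_mul, integral_complex_ofReal, (integral_ite_mul_rpow ha1).2,
      slope, vsub_eq_sub, Complex.real_smul]
    simp only [hG]
    have hgam : Real.Gamma (2 - a) = (1 - a) * Real.Gamma (1 - a) := by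
      rw [← Real.Gamma_add_one (by linarith)]; ring_nf
    rw [hgam]
    norm_num
    have h1 : (a : ℂ) ≠ 0 := by exact_mod_cast (by linarith : a ≠ 0)
    have h2 : (a : ℂ) - 1 ≠ 0 := by exact_mod_cast (by linarith : a - 1 ≠ 0)
    have h3 : 1 - (a : ℂ) ≠ 0 := by exact_mod_cast (by linarith : 1 - a ≠ 0)
    field_simp
    ring
  have hfun : (fun n : ℕ => -((slope G 1 ∘ fun n : ℕ => 1 - 1 / ((n : ℝ) + 2)) n))
      = fun n : ℕ => ∫ r in Set.Ioi (0 : ℝ),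
        (1 - Complex.exp (-(z * r)) - z * ((if r ≤ 1 then r else 0 : ℝ) : ℂ))
        * ((r ^ (-1 - (1 - 1 / ((n : ℝ) + 2))) : ℝ) : ℂ) :=
    funext fun n => hval _ (ha n).1 (ha n).2
  rw [hfun]
  refine tendsto_integral_of_dominated_convergence
    (fun r => (3 * ‖z‖ ^ 2 + 2) * (if r ≤ 1 then r ^ (0 : ℝ) else r ^ (-3 / 2 : ℝ))) ?_ ?_ ?_ ?_
  · intro n
    apply Measurable.aestronglyMeasurable
    have : Measurable fun r : ℝ => if r ≤ 1 then r else 0 :=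
      Measurable.ite measurableSet_Iic measurable_id measurable_const
    fun_prop
  · exact (integrableOn_ite_rpow (by norm_num) (by norm_num)).const_mul _
  · intro n
    filter_upwards [ae_restrict_mem measurableSet_Ioi] with r hr
    have hr' : (0 : ℝ) < r := hr
    rw [norm_mul, Complex.norm_real, Real.norm_of_nonneg (r := r ^ _) (by positivity)]
    exact norm_one_sub_cexp_sub_ite_mul_rpow_le hz hr' (ha n).1 (ha n).2.le
  · filter_upwards [ae_restrict_mem measurableSet_Ioi] with r hr
    have hr' : (0 : ℝ) < r := hr
    have hc : Continuous fun a : ℝ =>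
        (1 - Complex.exp (-(z * r)) - z * ((if r ≤ 1 then r else 0 : ℝ) : ℂ))
        * ((r ^ (-1 - a) : ℝ) : ℂ) := by
      have : Continuous fun a : ℝ => r ^ (-1 - a) :=
        (Real.continuous_const_rpow hr'.ne').comp (by fun_prop)
      fun_prop
    exact (hc.tendsto 1).comp (hlim.mono_right nhdsWithin_le_nhds)

theorem stableExponent_zero {α : ℝ} (hα : 0 < α) : stableExponent α 0 = 0 := by
  simp [stableExponent, Real.zero_rpow hα.ne']

theorem re_stableExponent (α t : ℝ) : (stableExponent α t).re = |t| ^ α := by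
  rw [stableExponent, Complex.re_ofReal_mul]
  simp

theorem exists_stableExponent_eq_integral {α : ℝ} (hα : 0 < α) (hα2 : α < 2) :
    ∃ c : ℝ, 0 < c ∧ ∃ (B : ℝ) (κ H : ℝ → ℝ), Measurable κ ∧ IntegrableOn H (Set.Ioi 0) ∧
      (∀ r, 0 < r → ∀ t : ℝ, ‖(1 - Complex.exp (Complex.I * ((t * r : ℝ) : ℂ))
        + Complex.I * ((t * κ r : ℝ) : ℂ)) * ((r ^ (-1 - α) : ℝ) : ℂ)‖ ≤ (1 + t ^ 2) * H r) ∧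
      ∀ t : ℝ, stableExponent α t = c * (∫ r in Set.Ioi (0 : ℝ),
        (1 - Complex.exp (Complex.I * ((t * r : ℝ) : ℂ)) + Complex.I * ((t * κ r : ℝ) : ℂ))
          * ((r ^ (-1 - α) : ℝ) : ℂ)) + Complex.I * ((B * t : ℝ) : ℂ) := by
  have hz : ∀ t : ℝ, 0 ≤ (-(Complex.I * t)).re := fun t => by simp
  have hn : ∀ t : ℝ, ‖-(Complex.I * t)‖ = |t| := fun t => by simp
  have hrp : ∀ r : ℝ, 0 < r → ‖((r ^ (-1 - α) : ℝ) : ℂ)‖ = r ^ (-1 - α) := fun r hr => by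
    rw [Complex.norm_real, Real.norm_of_nonneg (by positivity)]
  have hrew : ∀ (t r k : ℝ), 1 - Complex.exp (Complex.I * ((t * r : ℝ) : ℂ))
      + Complex.I * ((t * k : ℝ) : ℂ)
      = 1 - Complex.exp (-(-(Complex.I * t) * r)) - -(Complex.I * t) * ((k : ℝ) : ℂ) :=
    fun t r k => by push_cast; ring_nf
  have hpi := Real.pi_pos
  have h3 : ∀ t : ℝ, |t| ≤ 1 + t ^ 2 := fun t => by
    rw [abs_le]; constructor <;> nlinarith [sq_nonneg (t + 1), sq_nonneg (t - 1)]
  rcases lt_trichotomy α 1 with h1 | rfl | h1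
  · have hcos : 0 < Real.cos (Real.pi * α / 2) :=
      Real.cos_pos_of_mem_Ioo ⟨by nlinarith, by nlinarith⟩
    have hG : 0 < Real.Gamma (1 - α) := Real.Gamma_pos_of_pos (by linarith)
    refine ⟨α / (Real.Gamma (1 - α) * Real.cos (Real.pi * α / 2)), by positivity, 0,
      fun _ => 0, fun r => 4 * if r ≤ 1 then r ^ (1 - 1 - α) else r ^ (0 - 1 - α),
      measurable_const, (integrableOn_ite_rpow (by linarith) (by linarith)).const_mul _, ?_, ?_⟩
    · intro r hr t
      have hb := norm_mul_rpow_le_ite (a := α)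
        (u := fun r : ℝ => 1 - Complex.exp (-(-(Complex.I * t) * r)))
        (fun r hr => norm_one_sub_cexp_neg_mul_le (hz t) hr)
        (fun r hr => norm_one_sub_cexp_neg_mul_le' (hz t) hr) hr
      rw [hrew, Complex.ofReal_zero, mul_zero, sub_zero, norm_mul, hrp r hr]
      refine hb.trans ?_
      rw [hn, ← mul_assoc]
      gcongr
      nlinarith [h3 t, sq_nonneg t]
    · intro t
      rcases eq_or_ne t 0 with rfl | ht
      · simp [stableExponent_zero hα]
      simp_rw [hrew, Complex.ofReal_zero, mul_zero, sub_zero]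
      rw [integral_one_sub_cexp_mul_rpow hα h1 (hz t) (neg_I_mul_mem_slitPlane ht),
        stableExponent_eq_cpow ht h1.ne hcos.ne']
      have e1 : (Real.Gamma (1 - α) : ℂ) ≠ 0 := by exact_mod_cast hG.ne'
      have e2 : (Real.cos (Real.pi * α / 2) : ℂ) ≠ 0 := by exact_mod_cast hcos.ne'
      have e3 : (α : ℂ) ≠ 0 := by exact_mod_cast hα.ne'
      rw [Complex.ofReal_div, Complex.ofReal_mul]
      field_simp
      simp
  · refine ⟨2 / Real.pi, by positivity, 2 / Real.pi * (deriv Real.Gamma 1 + 1),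
      fun r => if r ≤ 1 then r else 0,
      fun r => 4 * if r ≤ 1 then r ^ (0 : ℝ) else r ^ (-3 / 2 : ℝ),
      Measurable.ite measurableSet_Iic measurable_id measurable_const,
      (integrableOn_ite_rpow (by norm_num) (by norm_num)).const_mul _, ?_, ?_⟩
    · intro r hr t
      rw [hrew, norm_mul, hrp r hr]
      refine (norm_one_sub_cexp_sub_ite_mul_rpow_le (hz t) hr (by norm_num) le_rfl).trans ?_
      rw [hn, ← mul_assoc, sq_abs]
      gcongr
      nlinarith [sq_nonneg t]
    · intro t
      rcases eq_or_ne t 0 with rfl | ht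
      · simp [stableExponent_zero hα]
      simp_rw [hrew]
      rw [integral_one_sub_cexp_sub_ite (hz t) (neg_I_mul_mem_slitPlane ht),
        stableExponent_one_eq ht]
      push_cast
      ring
  · have hcos : 0 < -Real.cos (Real.pi * α / 2) :=
      neg_pos.2 (Real.cos_neg_of_pi_div_two_lt_of_lt (by nlinarith) (by nlinarith))
    have hG : 0 < Real.Gamma (2 - α) := Real.Gamma_pos_of_pos (by linarith)
    refine ⟨α * (α - 1) / (Real.Gamma (2 - α) * -Real.cos (Real.pi * α / 2)),
      div_pos (mul_pos hα (by linarith)) (by positivity), 0,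
      fun r => r, fun r => 6 * if r ≤ 1 then r ^ (2 - 1 - α) else r ^ (1 - 1 - α),
      measurable_id, (integrableOn_ite_rpow (by linarith) (by linarith)).const_mul _, ?_, ?_⟩
    · intro r hr t
      have hb := norm_mul_rpow_le_ite (a := α)
        (u := fun r : ℝ => 1 - Complex.exp (-(-(Complex.I * t) * r)) - -(Complex.I * t) * r)
        (fun r hr => norm_one_sub_cexp_neg_mul_sub_le_sq (hz t) hr)
        (fun r hr => norm_one_sub_cexp_neg_mul_sub_le (hz t) hr) hr
      rw [hrew, norm_mul, hrp r hr]
      refine hb.trans ?_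
      rw [hn, ← mul_assoc, sq_abs]
      gcongr
      nlinarith [h3 t, sq_nonneg t]
    · intro t
      rcases eq_or_ne t 0 with rfl | ht
      · simp [stableExponent_zero hα]
      simp_rw [hrew]
      rw [integral_one_sub_cexp_sub_mul_rpow h1 hα2 (hz t) (neg_I_mul_mem_slitPlane ht),
        stableExponent_eq_cpow ht h1.ne' (neg_pos.1 hcos).ne]
      have e1 : (Real.Gamma (2 - α) : ℂ) ≠ 0 := by exact_mod_cast hG.ne'
      have e2 : (Real.cos (Real.pi * α / 2) : ℂ) ≠ 0 := by exact_mod_cast (neg_pos.1 hcos).ne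
      have e3 : (α : ℂ) ≠ 0 := by exact_mod_cast hα.ne'
      have e4 : (α : ℂ) - 1 ≠ 0 := by exact_mod_cast (by linarith : α - 1 ≠ 0)
      rw [Complex.ofReal_div, Complex.ofReal_mul, Complex.ofReal_mul, Complex.ofReal_neg,
        Complex.ofReal_sub, Complex.ofReal_one]
      field_simp
      simp

theorem continuous_stableExponent {α : ℝ} (hα : 0 < α) (hα2 : α < 2) :
    Continuous (stableExponent α) := by
  obtain ⟨c, -, B, κ, H, hκ, hH, hb, he⟩ := exists_stableExponent_eq_integral hα hα2
  rw [show stableExponent α = _ from funext he]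
  refine (continuous_const.mul ?_).add (by fun_prop)
  rw [continuous_iff_continuousAt]
  intro t₀
  refine continuousAt_of_dominated (bound := fun r => (1 + (|t₀| + 1) ^ 2) * H r) ?_ ?_
    (hH.const_mul _) ?_
  · exact Eventually.of_forall fun t => Measurable.aestronglyMeasurable (by fun_prop)
  · filter_upwards [Metric.ball_mem_nhds t₀ one_pos] with t ht
    filter_upwards [ae_restrict_mem measurableSet_Ioi] with r hr
    refine (hb r hr t).trans ?_
    have hHr : 0 ≤ H r := by
      have := (norm_nonneg _).trans (hb r hr 0)
      simpa using this
    have : |t| ≤ |t₀| + 1 := by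
      have h1 := abs_sub_abs_le_abs_sub t t₀
      rw [Metric.mem_ball, Real.dist_eq] at ht
      linarith
    rw [← sq_abs t]
    gcongr
  · exact Eventually.of_forall fun r => Continuous.continuousAt (by fun_prop)

theorem exists_norm_stableExponent_le {α : ℝ} (hα : 0 < α) (hα2 : α < 2) :
    ∃ K : ℝ, 0 ≤ K ∧ ∀ t, ‖stableExponent α t‖ ≤ K * (1 + t ^ 2) := by
  obtain ⟨c, hc, B, κ, H, hκ, hH, hb, he⟩ := exists_stableExponent_eq_integral hα hα2
  have hHr : ∀ r ∈ Set.Ioi (0 : ℝ), 0 ≤ H r := fun r hr => by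
    have := (norm_nonneg _).trans (hb r hr 0)
    simpa using this
  have hI : 0 ≤ ∫ r in Set.Ioi (0 : ℝ), H r := setIntegral_nonneg measurableSet_Ioi hHr
  refine ⟨c * (∫ r in Set.Ioi (0 : ℝ), H r) + |B|, by positivity, fun t => ?_⟩
  rw [he t]
  refine (norm_add_le _ _).trans ?_
  rw [add_mul]
  gcongr
  · rw [norm_mul, Complex.norm_real, Real.norm_of_nonneg hc.le, mul_assoc]
    gcongr
    rw [mul_comm (∫ r in Set.Ioi (0 : ℝ), H r), ← integral_const_mul]
    refine norm_integral_le_of_norm_le (hH.const_mul _) ?_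
    filter_upwards [ae_restrict_mem measurableSet_Ioi] with r hr using hb r hr t
  · rw [norm_mul, Complex.norm_I, one_mul, Complex.norm_real, Real.norm_eq_abs, abs_mul]
    gcongr
    rw [abs_le]
    constructor <;> nlinarith [sq_nonneg (t + 1), sq_nonneg (t - 1)]

/-- `g` is the Fourier transform of the rapidly decreasing continuous function `q`. -/
structure IsFourierPair {V : Type*} [NormedAddCommGroup V] [InnerProductSpace ℝ V]
    [FiniteDimensional ℝ V] [MeasurableSpace V] [BorelSpace V] (q g : V → ℂ) : Prop where
  continuous : Continuous q
  integrable : ∀ k : ℕ, Integrable fun v => ‖v‖ ^ k * ‖q v‖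
  eq_integral : ∀ z, g z
    = ∫ v, q v * Complex.exp (Complex.I * ((⟪(2 * Real.pi) • v, z⟫ : ℝ) : ℂ))

section

variable {V : Type*} [NormedAddCommGroup V] [InnerProductSpace ℝ V]
  [FiniteDimensional ℝ V] [MeasurableSpace V] [BorelSpace V] {q g : V → ℂ}

theorem exists_isFourierPair (g : SchwartzMap V ℂ) : ∃ q : V → ℂ, IsFourierPair q g := by
  refine ⟨FourierTransform.fourier g, (FourierTransform.fourier g).continuous,
    fun k => (FourierTransform.fourier g).integrable_pow_mul volume k, fun z => ?_⟩
  have h1 : g z = (FourierTransformInv.fourierInv (FourierTransform.fourier g)) z := by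
    rw [FourierTransform.fourierInv_fourier_eq]
  rw [h1, SchwartzMap.fourierInv_coe, Real.fourierInv_eq']
  refine integral_congr_ae (Eventually.of_forall fun v => ?_)
  simp only [smul_eq_mul]
  rw [mul_comm, real_inner_smul_left]
  congr 2
  push_cast
  ring

theorem norm_cexp_I_mul_ofReal (t : ℝ) : ‖Complex.exp (Complex.I * (t : ℂ))‖ = 1 := by
  rw [mul_comm]
  exact Complex.norm_exp_ofReal_mul_I t

namespace IsFourierPair

theorem integrable_norm (h : IsFourierPair q g) : Integrable q := by
  have := h.integrable 0
  simp only [pow_zero, one_mul] at this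
  exact (integrable_norm_iff h.continuous.aestronglyMeasurable).1 this

theorem integrable_mul_of_bound (h : IsFourierPair q g) {u : V → ℂ} (hu : Continuous u) {K : ℝ}
    (hb : ∀ v, ‖u v‖ ≤ K * (1 + ‖v‖ ^ 2)) : Integrable fun v => q v * u v := by
  refine Integrable.mono' (((h.integrable 0).add (h.integrable 2)).const_mul K)
    (h.continuous.mul hu).aestronglyMeasurable (Eventually.of_forall fun v => ?_)
  rw [norm_mul, Pi.add_apply]
  have := mul_le_mul_of_nonneg_left (hb v) (norm_nonneg (q v))
  linarith

theorem apply_zero (h : IsFourierPair q g) : g 0 = ∫ v, q v := by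
  rw [h.eq_integral]
  simp

theorem integral_eq (h : IsFourierPair q g) (ν : Measure V) [IsProbabilityMeasure ν] :
    ∫ z, g z ∂ν
      = ∫ v, q v * ∫ z, Complex.exp (Complex.I * ((⟪(2 * Real.pi) • v, z⟫ : ℝ) : ℂ)) ∂ν := by
  simp_rw [h.eq_integral, ← integral_const_mul]
  rw [integral_integral_swap]
  have h1 : Integrable (fun p : V × V => q p.2) (ν.prod volume) :=
    h.integrable_norm.comp_snd ν
  have hc : Continuous fun p : V × V =>
      Complex.exp (Complex.I * ((⟪(2 * Real.pi) • p.2, p.1⟫ : ℝ) : ℂ)) := by fun_prop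
  refine Integrable.mono' h1.norm
    ((h.continuous.comp continuous_snd).mul hc).aestronglyMeasurable
    (Eventually.of_forall fun p => ?_)
  simp only [Function.uncurry]
  rw [norm_mul, norm_cexp_I_mul_ofReal, mul_one]

theorem tendsto_integral (h : IsFourierPair q g) {α : ℝ} (hα : 0 < α) (ν : ℝ → Measure V)
    [∀ x, IsProbabilityMeasure (ν x)] {ψ : V → ℂ} (hψc : Continuous ψ) (hψr : ∀ u, 0 ≤ (ψ u).re)
    {K : ℝ} (hψK : ∀ u, ‖ψ u‖ ≤ K * (1 + ‖u‖ ^ 2))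
    (hchar : ∀ x, 0 < x → ∀ u : V, ∫ z, Complex.exp (Complex.I * ((⟪u, z⟫ : ℝ) : ℂ)) ∂(ν x)
      = Complex.exp (-(((x ^ (-α) : ℝ) : ℂ) * ψ u))) :
    Tendsto (fun x : ℝ => ((x ^ α : ℝ) : ℂ) * (∫ z, g z ∂(ν x) - g 0)) atTop
      (𝓝 (-∫ v, q v * ψ ((2 * Real.pi) • v))) := by
  have hK : 0 ≤ K := by simpa using (norm_nonneg _).trans (hψK 0)
  have hbd : ∀ v, ‖ψ ((2 * Real.pi) • v)‖ ≤ K * (1 + (2 * Real.pi) ^ 2) * (1 + ‖v‖ ^ 2) := by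
    intro v
    refine (hψK _).trans ?_
    rw [norm_smul, Real.norm_of_nonneg (by positivity), mul_assoc K]
    refine mul_le_mul_of_nonneg_left ?_ hK
    rw [mul_pow]
    nlinarith [sq_nonneg ‖v‖, sq_nonneg (2 * Real.pi)]
  have hψc' : Continuous fun v => ψ ((2 * Real.pi) • v) := by fun_prop
  have hint := h.integrable_mul_of_bound hψc' hbd
  have key : ∀ x : ℝ, 0 < x → ∫ v, q v * (((x ^ α : ℝ) : ℂ) *
      (Complex.exp (-(((x ^ (-α) : ℝ) : ℂ) * ψ ((2 * Real.pi) • v))) - 1))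
      = ((x ^ α : ℝ) : ℂ) * (∫ z, g z ∂(ν x) - g 0) := by
    intro x hx
    rw [h.integral_eq, h.apply_zero]
    simp_rw [hchar x hx]
    rw [← integral_sub _ h.integrable_norm, ← integral_const_mul]
    · congr 1
      ext v
      ring
    · refine h.integrable_mul_of_bound (K := 1) (by fun_prop) fun v => ?_
      rw [Complex.norm_exp, Complex.neg_re, Complex.re_ofReal_mul]
      have h1 : Real.exp (-(x ^ (-α) * (ψ ((2 * Real.pi) • v)).re)) ≤ 1 := by
        rw [Real.exp_le_one_iff]
        have := mul_nonneg (Real.rpow_nonneg hx.le (-α)) (hψr ((2 * Real.pi) • v))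
        linarith
      nlinarith [sq_nonneg ‖v‖]
  rw [← integral_neg]
  refine (tendsto_integral_filter_of_dominated_convergence
    (fun v => 2 * ‖q v * ψ ((2 * Real.pi) • v)‖) ?_ ?_ (hint.norm.const_mul 2) ?_).congr'
    ((eventually_gt_atTop 0).mono key)
  · exact Eventually.of_forall fun x =>
      (h.continuous.mul (by fun_prop)).aestronglyMeasurable
  · filter_upwards [eventually_gt_atTop 0] with x hx
    refine Eventually.of_forall fun v => ?_
    have hxp : 0 < x ^ (-α) := by positivity
    have h1 := norm_one_sub_cexp_neg_le (w := ((x ^ (-α) : ℝ) : ℂ) * ψ ((2 * Real.pi) • v))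
      (by rw [Complex.re_ofReal_mul]; exact mul_nonneg hxp.le (hψr _))
    rw [norm_sub_rev, norm_mul, Complex.norm_real, Real.norm_of_nonneg hxp.le] at h1
    rw [norm_mul, norm_mul, norm_mul, Complex.norm_real, Real.norm_of_nonneg (by positivity)]
    have h2 : x ^ α * x ^ (-α) = 1 := by
      rw [← Real.rpow_add hx, add_neg_cancel, Real.rpow_zero]
    calc _ ≤ ‖q v‖ * (x ^ α * (2 * (x ^ (-α) * ‖ψ ((2 * Real.pi) • v)‖))) := by gcongr
      _ = 2 * (‖q v‖ * ‖ψ ((2 * Real.pi) • v)‖) * (x ^ α * x ^ (-α)) := by ring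
      _ = _ := by rw [h2, mul_one]
  · refine Eventually.of_forall fun v => ?_
    rw [← mul_neg]
    refine Tendsto.const_mul _ ?_
    set c := ψ ((2 * Real.pi) • v)
    have hd : HasDerivAt (fun e : ℝ => Complex.exp (-((e : ℂ) * c))) (-c) 0 := by
      have h1 : HasDerivAt (fun e : ℝ => -((e : ℂ) * c)) (-(1 * c)) 0 :=
        ((Complex.ofRealCLM.hasDerivAt (x := (0 : ℝ))).mul_const c).neg
      simpa using h1.cexp
    have ht : Tendsto (fun x : ℝ => x ^ (-α)) atTop (𝓝[≠] 0) := by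
      rw [tendsto_nhdsWithin_iff]
      refine ⟨tendsto_rpow_neg_atTop hα, ?_⟩
      filter_upwards [eventually_gt_atTop 0] with x hx
      exact (Real.rpow_pos_of_pos hx _).ne'
    refine ((hasDerivAt_iff_tendsto_slope.1 hd).comp ht).congr' ?_
    filter_upwards [eventually_gt_atTop 0] with x hx
    simp only [Function.comp_apply, slope, vsub_eq_sub, sub_zero, Complex.ofReal_zero, zero_mul,
      neg_zero, Complex.exp_zero, Complex.real_smul]
    rw [← Real.rpow_neg hx.le, neg_neg]

end IsFourierPair

end

theorem norm_inner_two_pi_smul_le {V : Type*} [NormedAddCommGroup V] [InnerProductSpace ℝ V]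
    (v s : V) : |⟪(2 * Real.pi) • v, s⟫| ≤ 2 * Real.pi * ‖s‖ * ‖v‖ := by
  refine (abs_real_inner_le_norm _ _).trans (le_of_eq ?_)
  rw [norm_smul, Real.norm_of_nonneg (by positivity)]
  ring

section

variable {V : Type*} [NormedAddCommGroup V] [InnerProductSpace ℝ V]
  [FiniteDimensional ℝ V] [MeasurableSpace V] [BorelSpace V] {q g : V → ℂ}

namespace IsFourierPair

theorem integral_mul_inner (h : IsFourierPair q g) (hg : g =ᶠ[𝓝 0] 0) (s : V) :
    ∫ v, q v * ((⟪(2 * Real.pi) • v, s⟫ : ℝ) : ℂ) = 0 := by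
  have hd := hasDerivAt_integral_of_dominated_loc_of_deriv_le
    (μ := (volume : Measure V)) (𝕜 := ℝ) (x₀ := (0 : ℝ)) (s := Set.univ)
    (F := fun (r : ℝ) v =>
      q v * Complex.exp (Complex.I * ((⟪(2 * Real.pi) • v, s⟫ * r : ℝ) : ℂ)))
    (F' := fun (r : ℝ) v => q v * (Complex.exp (Complex.I * ((⟪(2 * Real.pi) • v, s⟫ * r : ℝ) : ℂ))
      * (Complex.I * ((⟪(2 * Real.pi) • v, s⟫ : ℝ) : ℂ))))
    (bound := fun v => 2 * Real.pi * ‖s‖ * (‖v‖ ^ 1 * ‖q v‖))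
    Filter.univ_mem
    (Eventually.of_forall fun r => (h.continuous.mul (by fun_prop)).aestronglyMeasurable)
    (by simpa using h.integrable_norm)
    (h.continuous.mul (by fun_prop)).aestronglyMeasurable
    (Eventually.of_forall fun v r _ => by
      rw [norm_mul, norm_mul, norm_cexp_I_mul_ofReal, one_mul, norm_mul, Complex.norm_I, one_mul,
        Complex.norm_real, Real.norm_eq_abs, pow_one]
      have := mul_le_mul_of_nonneg_left (norm_inner_two_pi_smul_le v s) (norm_nonneg (q v))
      linarith)
    ((h.integrable 1).const_mul _)
    (Eventually.of_forall fun v r _ => by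
      have h1 : HasDerivAt (fun r : ℝ => Complex.I * ((⟪(2 * Real.pi) • v, s⟫ * r : ℝ) : ℂ))
          (Complex.I * ((⟪(2 * Real.pi) • v, s⟫ * 1 : ℝ) : ℂ)) r :=
        ((((hasDerivAt_id r).const_mul _).ofReal_comp).const_mul _)
      rw [mul_one] at h1
      exact h1.cexp.const_mul (q v))
  have hd' := hd.2
  have hg0 : HasDerivAt (fun r : ℝ => g (r • s)) 0 0 := by
    refine (hasDerivAt_const (0 : ℝ) (0 : ℂ)).congr_of_eventuallyEq ?_
    have : Tendsto (fun r : ℝ => r • s) (𝓝 0) (𝓝 0) := by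
      have : Continuous fun r : ℝ => r • s := by fun_prop
      simpa using this.tendsto 0
    exact this.eventually hg
  have hfun : (fun r : ℝ => g (r • s)) = fun r : ℝ => ∫ v,
      q v * Complex.exp (Complex.I * ((⟪(2 * Real.pi) • v, s⟫ * r : ℝ) : ℂ)) := by
    funext r
    rw [h.eq_integral]
    simp_rw [real_inner_smul_right, mul_comm r]
  rw [hfun] at hg0
  have := hd'.unique hg0
  simp only [mul_zero, Complex.ofReal_zero, Complex.exp_zero, one_mul] at this
  simp_rw [mul_left_comm _ Complex.I] at this
  rw [integral_const_mul] at this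
  exact (mul_eq_zero.1 this).resolve_left Complex.I_ne_zero

end IsFourierPair

theorem exists_integral_mul_stableExponent {α : ℝ} (hα : 0 < α) (hα2 : α < 2) :
    ∃ c : ℝ, 0 < c ∧ ∀ (q g : V → ℂ), IsFourierPair q g → g =ᶠ[𝓝 0] 0 → ∀ s : V,
      IntegrableOn (fun r : ℝ => g (r • s) * ((r ^ (-1 - α) : ℝ) : ℂ)) (Set.Ioi 0) ∧
      -∫ v, q v * stableExponent α ⟪(2 * Real.pi) • v, s⟫
        = c * ∫ r in Set.Ioi (0 : ℝ), g (r • s) * ((r ^ (-1 - α) : ℝ) : ℂ) := by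
  obtain ⟨c, hc, B, κ, H, hκ, hH, hb, he⟩ := exists_stableExponent_eq_integral hα hα2
  refine ⟨c, hc, fun q g h hg s => ?_⟩
  set T : V → ℝ := fun v => ⟪(2 * Real.pi) • v, s⟫ with hT
  have hTc : Continuous T := by fun_prop
  have hTb : ∀ v, |T v| ≤ 2 * Real.pi * ‖s‖ * ‖v‖ := fun v => norm_inner_two_pi_smul_le v s
  set Φ : V → ℝ → ℂ := fun v r => q v * ((1 - Complex.exp (Complex.I * ((T v * r : ℝ) : ℂ))
    + Complex.I * ((T v * κ r : ℝ) : ℂ)) * ((r ^ (-1 - α) : ℝ) : ℂ)) with hΦ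
  have hint : Integrable (Function.uncurry Φ) (volume.prod (volume.restrict (Set.Ioi 0))) := by
    have h1 : Integrable (fun v => ‖q v‖ * (1 + T v ^ 2)) := by
      refine Integrable.mono' ((h.integrable 0).add
        ((h.integrable 2).const_mul ((2 * Real.pi * ‖s‖) ^ 2)))
        (h.continuous.norm.mul (by fun_prop)).aestronglyMeasurable
        (Eventually.of_forall fun v => ?_)
      rw [Real.norm_of_nonneg (by positivity), Pi.add_apply]
      have h2 : T v ^ 2 ≤ (2 * Real.pi * ‖s‖ * ‖v‖) ^ 2 := by
        rw [← sq_abs]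
        have := hTb v
        gcongr
      have := mul_le_mul_of_nonneg_left h2 (norm_nonneg (q v))
      rw [mul_pow] at this
      linarith
    refine Integrable.mono' (h1.mul_prod hH) ?_ ?_
    · apply Measurable.aestronglyMeasurable
      have := h.continuous.measurable
      have := hTc.measurable
      simp only [hΦ]
      fun_prop
    · filter_upwards [Measure.quasiMeasurePreserving_snd.ae
        (ae_restrict_mem (measurableSet_Ioi (a := (0 : ℝ))))] with p hp
      simp only [Function.uncurry, hΦ]
      rw [norm_mul, mul_assoc]
      gcongr
      exact hb p.2 hp (T p.1)
  have hD : ∫ v, q v * ((T v : ℝ) : ℂ) = 0 := h.integral_mul_inner hg s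
  have hTi : Integrable fun v => q v * ((T v : ℝ) : ℂ) := by
    refine h.integrable_mul_of_bound (K := 2 * Real.pi * ‖s‖) (by fun_prop) fun v => ?_
    rw [Complex.norm_real, Real.norm_eq_abs]
    refine (hTb v).trans ?_
    gcongr
    nlinarith [sq_nonneg (‖v‖ - 1)]
  have hg0 : g 0 = 0 := hg.self_of_nhds
  have hinner : ∀ r : ℝ, ∫ v, Φ v r = -(g (r • s) * ((r ^ (-1 - α) : ℝ) : ℂ)) := by
    intro r
    have hei : Integrable fun v => q v * Complex.exp (Complex.I * ((T v * r : ℝ) : ℂ)) := by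
      refine h.integrable_mul_of_bound (K := 1) (by fun_prop) fun v => ?_
      rw [norm_cexp_I_mul_ofReal]
      nlinarith [sq_nonneg ‖v‖]
    have e : ∀ v, Φ v r = ((r ^ (-1 - α) : ℝ) : ℂ) *
        ((q v - q v * Complex.exp (Complex.I * ((T v * r : ℝ) : ℂ)))
          + (Complex.I * (κ r : ℂ)) * (q v * ((T v : ℝ) : ℂ))) := fun v => by
      simp only [hΦ]
      push_cast
      ring
    have hsub : Integrable fun v =>
        q v - q v * Complex.exp (Complex.I * ((T v * r : ℝ) : ℂ)) := h.integrable_norm.sub hei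
    simp_rw [e]
    rw [integral_const_mul, integral_add hsub (hTi.const_mul _),
      integral_sub h.integrable_norm hei, integral_const_mul, hD, ← h.apply_zero, hg0,
      h.eq_integral (r • s)]
    simp_rw [real_inner_smul_right, hT, mul_comm r]
    ring
  have hsplit : ∀ v, q v * stableExponent α (T v)
      = c * (∫ r in Set.Ioi (0 : ℝ), Φ v r) + (Complex.I * B) * (q v * ((T v : ℝ) : ℂ)) := by
    intro v
    rw [he]
    simp only [hΦ]
    rw [integral_const_mul]
    push_cast
    ring
  constructor
  · have h1 : IntegrableOn (fun r => ∫ v, Φ v r) (Set.Ioi 0) := hint.integral_prod_right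
    rw [funext hinner] at h1
    exact integrable_neg_iff.1 h1
  · have h1 : ∫ v, q v * stableExponent α ⟪(2 * Real.pi) • v, s⟫
        = ∫ v, (c * (∫ r in Set.Ioi (0 : ℝ), Φ v r)
          + (Complex.I * B) * (q v * ((T v : ℝ) : ℂ))) :=
      integral_congr_ae (Eventually.of_forall hsplit)
    have h2 : Integrable fun v => ∫ r in Set.Ioi (0 : ℝ), Φ v r := hint.integral_prod_left
    rw [h1, integral_add (h2.const_mul _) (hTi.const_mul _),
      integral_const_mul, integral_const_mul, hD, integral_integral_swap hint]
    rw [funext hinner, integral_neg]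
    ring

end

theorem exists_stableExponent_inv_mul (α : ℝ) :
    ∃ e : ℝ → ℝ, Tendsto e atTop (𝓝 0) ∧ ∀ x, 0 < x → ∀ t,
      stableExponent α (x⁻¹ * t) = ((x ^ (-α) : ℝ) : ℂ) * stableExponent α t
        - Complex.I * ((e x * t : ℝ) : ℂ) := by
  have habs : ∀ x : ℝ, 0 < x → ∀ t, |x⁻¹ * t| ^ α = x ^ (-α) * |t| ^ α := fun x hx t => by
    rw [abs_mul, abs_of_pos (inv_pos.2 hx), Real.mul_rpow (inv_pos.2 hx).le (abs_nonneg _),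
      Real.inv_rpow hx.le, Real.rpow_neg hx.le]
  have hsign : ∀ x : ℝ, 0 < x → ∀ t, Real.sign (x⁻¹ * t) = Real.sign t := fun x hx t => by
    have hx' := inv_pos.2 hx
    rcases lt_trichotomy t 0 with h | rfl | h
    · rw [Real.sign_of_neg h, Real.sign_of_neg (mul_neg_of_pos_of_neg hx' h)]
    · simp
    · rw [Real.sign_of_pos h, Real.sign_of_pos (mul_pos hx' h)]
  by_cases hα : α = 1
  · subst hα
    refine ⟨fun x => 2 / Real.pi * (Real.log x / x), ?_, fun x hx t => ?_⟩
    · simpa using (Real.isLittleO_log_id_atTop.tendsto_div_nhds_zero).const_mul (2 / Real.pi)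
    · rcases eq_or_ne t 0 with rfl | ht
      · simp [stableExponent_zero one_pos]
      rw [stableExponent, stableExponent, habs x hx, hsign x hx, if_pos rfl, if_pos rfl,
        abs_mul, abs_of_pos (inv_pos.2 hx),
        Real.log_mul (inv_pos.2 hx).ne' (abs_pos.2 ht).ne', Real.log_inv, Real.rpow_one,
        Real.rpow_neg_one]
      have h1 : ((Real.sign t : ℝ) : ℂ) * ((|t| : ℝ) : ℂ) = (t : ℂ) := by
        rw [← Complex.ofReal_mul]
        congr 1
        rcases ht.lt_or_gt with h | h
        · rw [Real.sign_of_neg h, abs_of_neg h]; ring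
        · rw [Real.sign_of_pos h, abs_of_pos h]; ring
      push_cast
      rw [← h1]
      ring
  · refine ⟨fun _ => 0, tendsto_const_nhds, fun x hx t => ?_⟩
    rw [stableExponent, stableExponent, habs x hx, hsign x hx, if_neg hα, if_neg hα]
    push_cast
    ring

/-- `μ` is the `α`-stable law with shift `μ₀` whose spectral measure is `∑ s ∈ S, w s • δ_s`. -/
structure IsStableLaw {V : Type*} [NormedAddCommGroup V] [InnerProductSpace ℝ V]
    [MeasurableSpace V] (μ : Measure V) (α : ℝ) (S : Finset V) (w : V → ℝ) (μ₀ : V) : Prop where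
  nonneg : ∀ s ∈ S, 0 ≤ w s
  integral_cexp : ∀ u, ∫ x, Complex.exp (Complex.I * ((⟪u, x⟫ : ℝ) : ℂ)) ∂μ
    = Complex.exp (-(∑ s ∈ S, (w s : ℂ) * stableExponent α ⟪u, s⟫)
      + Complex.I * ((⟪u, μ₀⟫ : ℝ) : ℂ))

theorem exists_contDiff_eq_one_of_isCompact {V : Type*} [NormedAddCommGroup V] [InnerProductSpace ℝ V]
    [FiniteDimensional ℝ V] {K U : Set V} (hK : IsCompact K) (hU : IsOpen U)
    (hKU : K ⊆ U) : ∃ g : V → ℝ, ContDiff ℝ (⊤ : ℕ∞) g ∧ HasCompactSupport g ∧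
      (∀ z, 0 ≤ g z ∧ g z ≤ 1) ∧ (∀ᶠ z in 𝓝ˢ K, g z = 1) ∧ ∀ z ∉ U, g =ᶠ[𝓝 z] 0 := by
  obtain ⟨T, hT, hKT, hTU⟩ := exists_compact_between hK hU hKU
  obtain ⟨g, h1, h0, h01⟩ := exists_contMDiffMap_one_nhds_of_subset_interior
    (modelWithCornersSelf ℝ V) (n := (⊤ : ℕ∞)) hK.isClosed hKT
  refine ⟨g, g.contMDiff.contDiff, HasCompactSupport.intro hT h0, fun z => h01 z, h1,
    fun z hz => ?_⟩
  filter_upwards [hT.isClosed.isOpen_compl.mem_nhds fun h => hz (hTU h)] with y hy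
  exact h0 y hy

section

variable {V : Type*} [NormedAddCommGroup V] [InnerProductSpace ℝ V]
  [FiniteDimensional ℝ V] [MeasurableSpace V] [BorelSpace V]

namespace IsStableLaw

variable {μ : Measure V} {α : ℝ} {S : Finset V} {w : V → ℝ} {μ₀ : V}

theorem exists_integral_cexp_map (h : IsStableLaw μ α S w μ₀) :
    ∃ b : ℝ → V, Tendsto b atTop (𝓝 0) ∧ ∀ x, 0 < x → ∀ u,
      ∫ z, Complex.exp (Complex.I * ((⟪u, z⟫ : ℝ) : ℂ)) ∂(μ.map fun y => x⁻¹ • y - b x)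
        = Complex.exp (-(((x ^ (-α) : ℝ) : ℂ)
          * ∑ s ∈ S, (w s : ℂ) * stableExponent α ⟪u, s⟫)) := by
  obtain ⟨e, he, hex⟩ := exists_stableExponent_inv_mul α
  refine ⟨fun x => x⁻¹ • μ₀ + e x • ∑ s ∈ S, w s • s, ?_, fun x hx u => ?_⟩
  · simpa using (tendsto_inv_atTop_zero.smul_const μ₀).add (he.smul_const (∑ s ∈ S, w s • s))
  · rw [integral_map (by fun_prop) (by fun_prop)]
    beta_reduce
    set b := x⁻¹ • μ₀ + e x • ∑ s ∈ S, w s • s with hb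
    have h1 : ∀ y, Complex.exp (Complex.I * ((⟪u, x⁻¹ • y - b⟫ : ℝ) : ℂ))
        = Complex.exp (-(Complex.I * ((⟪u, b⟫ : ℝ) : ℂ)))
          * Complex.exp (Complex.I * ((⟪x⁻¹ • u, y⟫ : ℝ) : ℂ)) := fun y => by
      rw [← Complex.exp_add, inner_sub_right, real_inner_smul_left, real_inner_smul_right]
      congr 1
      push_cast
      ring
    simp_rw [h1]
    rw [integral_const_mul, h.integral_cexp, ← Complex.exp_add]
    congr 1
    simp_rw [real_inner_smul_left, hex x hx]
    rw [hb, inner_add_right, real_inner_smul_right, real_inner_smul_right, inner_sum,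
      Finset.mul_sum]
    simp_rw [real_inner_smul_right, mul_sub, Finset.sum_sub_distrib]
    push_cast
    simp_rw [Finset.mul_sum]
    have h2 : ∑ s ∈ S, (w s : ℂ) * (Complex.I * ((e x : ℂ) * ((⟪u, s⟫ : ℝ) : ℂ)))
        = ∑ s ∈ S, Complex.I * ((e x : ℂ) * ((w s : ℂ) * ((⟪u, s⟫ : ℝ) : ℂ))) :=
      Finset.sum_congr rfl fun s _ => by ring
    have h3 : ∑ s ∈ S, (w s : ℂ) * (((x ^ (-α) : ℝ) : ℂ) * stableExponent α ⟪u, s⟫)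
        = ∑ s ∈ S, ((x ^ (-α) : ℝ) : ℂ) * ((w s : ℂ) * stableExponent α ⟪u, s⟫) :=
      Finset.sum_congr rfl fun s _ => by ring
    rw [h2, h3, mul_add, Finset.mul_sum]
    ring

theorem exists_tendsto_integral [IsProbabilityMeasure μ] (hα : 0 < α) (hα2 : α < 2)
    (h : IsStableLaw μ α S w μ₀) :
    ∃ b : ℝ → V, Tendsto b atTop (𝓝 0) ∧ ∃ c : ℝ, 0 < c ∧
      ∀ g : V → ℝ, ContDiff ℝ (⊤ : ℕ∞) g → HasCompactSupport g →
        (∃ L, Tendsto (fun x : ℝ => x ^ α * (∫ y, g (x⁻¹ • y - b x) ∂μ - g 0)) atTop (𝓝 L)) ∧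
        (g =ᶠ[𝓝 0] 0 →
          (∀ s, IntegrableOn (fun r : ℝ => g (r • s) * r ^ (-1 - α)) (Set.Ioi 0)) ∧
          Tendsto (fun x : ℝ => x ^ α * ∫ y, g (x⁻¹ • y - b x) ∂μ) atTop
            (𝓝 (c * ∑ s ∈ S, w s * ∫ r in Set.Ioi (0 : ℝ), g (r • s) * r ^ (-1 - α)))) := by
  obtain ⟨b, hb, hbx⟩ := h.exists_integral_cexp_map
  obtain ⟨c, hc, hcI⟩ := exists_integral_mul_stableExponent (V := V) hα hα2
  obtain ⟨K, hK, hKb⟩ := exists_norm_stableExponent_le hα hα2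
  have hΨ := continuous_stableExponent hα hα2
  refine ⟨b, hb, c, hc, fun g hg hgc => ?_⟩
  have hgc' : HasCompactSupport fun z => (g z : ℂ) :=
    hgc.comp_left (g := ((↑) : ℝ → ℂ)) Complex.ofReal_zero
  have hg' : ContDiff ℝ (⊤ : ℕ∞) fun z => (g z : ℂ) := Complex.ofRealCLM.contDiff.comp hg
  obtain ⟨q, hq⟩ := exists_isFourierPair (hgc'.toSchwartzMap hg')
  have hq' : IsFourierPair q fun z => (g z : ℂ) := hq
  have hν : ∀ x, IsProbabilityMeasure (μ.map fun y => x⁻¹ • y - b x) := fun x =>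
    Measure.isProbabilityMeasure_map (by fun_prop)
  have hi : ∀ s, Integrable fun v => q v * stableExponent α ⟪(2 * Real.pi) • v, s⟫ := fun s => by
    refine hq'.integrable_mul_of_bound (K := K * (1 + (2 * Real.pi * ‖s‖) ^ 2))
      (by fun_prop) fun v => (hKb _).trans ?_
    rw [mul_assoc K]
    refine mul_le_mul_of_nonneg_left ?_ hK
    have h1 : ⟪(2 * Real.pi) • v, s⟫ ^ 2 ≤ (2 * Real.pi * ‖s‖ * ‖v‖) ^ 2 := by
      rw [← sq_abs]
      have := norm_inner_two_pi_smul_le v s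
      gcongr
    rw [mul_pow] at h1
    nlinarith [sq_nonneg ‖v‖, sq_nonneg (2 * Real.pi * ‖s‖)]
  have hψb : ∀ u, ‖∑ s ∈ S, (w s : ℂ) * stableExponent α ⟪u, s⟫‖
      ≤ (∑ s ∈ S, w s * (K * (1 + ‖s‖ ^ 2))) * (1 + ‖u‖ ^ 2) := fun u => by
    refine (norm_sum_le _ _).trans ?_
    rw [Finset.sum_mul]
    refine Finset.sum_le_sum fun s hs => ?_
    have hw := h.nonneg s hs
    rw [norm_mul, Complex.norm_real, Real.norm_of_nonneg hw, mul_assoc, mul_assoc]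
    refine mul_le_mul_of_nonneg_left ((hKb _).trans (mul_le_mul_of_nonneg_left ?_ hK)) hw
    have h1 : ⟪u, s⟫ ^ 2 ≤ (‖u‖ * ‖s‖) ^ 2 := by
      rw [← sq_abs]
      have := abs_real_inner_le_norm u s
      gcongr
    rw [mul_pow] at h1
    nlinarith [sq_nonneg ‖u‖, sq_nonneg ‖s‖]
  have key := hq'.tendsto_integral hα (fun x => μ.map fun y => x⁻¹ • y - b x)
    (ψ := fun u => ∑ s ∈ S, (w s : ℂ) * stableExponent α ⟪u, s⟫) (by fun_prop)
    (fun u => by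
      rw [Complex.re_sum]
      refine Finset.sum_nonneg fun s hs => ?_
      rw [Complex.re_ofReal_mul, re_stableExponent]
      exact mul_nonneg (h.nonneg s hs) (by positivity))
    hψb hbx
  have hmap : ∀ x : ℝ, ∫ z, (g z : ℂ) ∂(μ.map fun y => x⁻¹ • y - b x)
      = ((∫ y, g (x⁻¹ • y - b x) ∂μ : ℝ) : ℂ) := fun x => by
    rw [integral_map (by fun_prop) (by have := hg.continuous; fun_prop), integral_complex_ofReal]
  simp_rw [hmap] at key
  have keyre := (Complex.continuous_re.tendsto _).comp key
  have hfun : (Complex.re ∘ fun x : ℝ => ((x ^ α : ℝ) : ℂ)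
      * (((∫ y, g (x⁻¹ • y - b x) ∂μ : ℝ) : ℂ) - (g 0 : ℂ)))
      = fun x : ℝ => x ^ α * (∫ y, g (x⁻¹ • y - b x) ∂μ - g 0) := by
    funext x
    simp only [Function.comp_apply]
    rw [← Complex.ofReal_sub, ← Complex.ofReal_mul, Complex.ofReal_re]
  rw [hfun] at keyre
  refine ⟨⟨_, keyre⟩, fun hg0 => ?_⟩
  have hg0' : (fun z => (g z : ℂ)) =ᶠ[𝓝 0] 0 := by
    filter_upwards [hg0] with z hz
    simp [hz]
  have hcast : ∀ (s : V) (r : ℝ), (g (r • s) : ℂ) * ((r ^ (-1 - α) : ℝ) : ℂ)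
      = ((g (r • s) * r ^ (-1 - α) : ℝ) : ℂ) := fun s r => by push_cast; ring
  have hL : -∫ v, q v * ∑ s ∈ S, (w s : ℂ) * stableExponent α ⟪(2 * Real.pi) • v, s⟫
      = ((c * ∑ s ∈ S, w s * ∫ r in Set.Ioi (0 : ℝ), g (r • s) * r ^ (-1 - α) : ℝ) : ℂ) := by
    simp_rw [Finset.mul_sum, mul_left_comm (q _)]
    rw [integral_finsetSum _ fun s _ => (hi s).const_mul _, ← Finset.sum_neg_distrib,
      Complex.ofReal_sum]
    refine Finset.sum_congr rfl fun s _ => ?_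
    rw [integral_const_mul, ← mul_neg, (hcI q _ hq' hg0' s).2]
    simp_rw [hcast]
    rw [integral_complex_ofReal]
    push_cast
    ring
  rw [hL, Complex.ofReal_re] at keyre
  refine ⟨fun s => ?_, ?_⟩
  · have h1 := (hcI q _ hq' hg0' s).1
    simp_rw [hcast] at h1
    exact (h1.re : IntegrableOn _ _ _)
  · simpa [hg0.self_of_nhds] using keyre

end IsStableLaw

end

namespace IsStableLaw

variable {V : Type*} [NormedAddCommGroup V] [InnerProductSpace ℝ V]
  [FiniteDimensional ℝ V] [MeasurableSpace V] [BorelSpace V]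
  {μ : Measure V} [IsProbabilityMeasure μ] {α : ℝ} {S : Finset V} {w : V → ℝ} {μ₀ : V}

theorem exists_rpow_mul_measureReal_le (hα : 0 < α) (hα2 : α < 2)
    (h : IsStableLaw μ α S w μ₀) :
    ∃ L : ℝ, ∀ᶠ x in atTop, x ^ α * μ.real {y | 3 * x ≤ ‖y‖} ≤ L := by
  obtain ⟨b, hb, c, hc, hg⟩ := h.exists_tendsto_integral hα hα2
  obtain ⟨g, hgs, hgc, hg01, hg1, hgU⟩ := exists_contDiff_eq_one_of_isCompact
    (K := {(0 : V)}) (U := Metric.ball 0 2) isCompact_singleton Metric.isOpen_ball (by simp)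
  obtain ⟨L, hL⟩ := (hg g hgs hgc).1
  have hg0 : g 0 = 1 := hg1.self_of_nhdsSet 0 rfl
  rw [hg0] at hL
  refine ⟨-L + 1, ?_⟩
  filter_upwards [hL.neg.eventually (gt_mem_nhds (lt_add_one (-L))), eventually_gt_atTop 0,
    hb.eventually (Metric.ball_mem_nhds 0 one_pos)] with x hx hx0 hbx
  refine le_trans ?_ hx.le
  rw [← mul_neg, neg_sub]
  refine mul_le_mul_of_nonneg_left ?_ (by positivity)
  have hgi : Integrable (fun y => g (x⁻¹ • y - b x)) μ := by
    refine Integrable.mono' (integrable_const (1 : ℝ))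
      (hgs.continuous.comp (by fun_prop)).aestronglyMeasurable (Eventually.of_forall fun y => ?_)
    rw [Real.norm_of_nonneg (hg01 _).1]
    exact (hg01 _).2
  have hmk := mul_meas_ge_le_integral_of_nonneg (μ := μ)
    (f := fun y => 1 - g (x⁻¹ • y - b x))
    (Eventually.of_forall fun y => sub_nonneg.2 (hg01 _).2) ((integrable_const 1).sub hgi) 1
  rw [one_mul, integral_sub (integrable_const 1) hgi, integral_const, probReal_univ, one_smul]
    at hmk
  refine (measureReal_mono fun y hy => ?_).trans hmk
  have hy' : 3 * x ≤ ‖y‖ := hy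
  have hz : x⁻¹ • y - b x ∉ Metric.ball (0 : V) 2 := by
    rw [mem_ball_zero_iff, not_lt]
    rw [dist_zero_right] at hbx
    have h1 : 3 ≤ ‖x⁻¹ • y‖ := by
      rw [norm_smul, Real.norm_of_nonneg (inv_pos.2 hx0).le, inv_mul_eq_div, le_div_iff₀ hx0]
      exact hy'
    linarith [norm_sub_norm_le (x⁻¹ • y) (b x)]
  have := (hgU _ hz).self_of_nhds
  show 1 ≤ 1 - g (x⁻¹ • y - b x)
  rw [this]
  simp

theorem tendsto_rpow_mul_measureReal_zero (hα : 0 < α) (hα2 : α < 2)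
    (h : IsStableLaw μ α S w μ₀) {T : Set V} (hT : IsClosed T) (hT0 : (0 : V) ∉ T)
    (hTS : ∀ s ∈ S, ∀ r : ℝ, r • s ∉ T) :
    Tendsto (fun x : ℝ => x ^ α * μ.real {y | x⁻¹ • y ∈ T}) atTop (𝓝 0) := by
  obtain ⟨L, hL⟩ := h.exists_rpow_mul_measureReal_le hα hα2
  obtain ⟨b, hb, c, hc, hg⟩ := h.exists_tendsto_integral hα hα2
  rw [Metric.tendsto_nhds]
  intro η hη
  obtain ⟨M, hM, hM0⟩ : ∃ M : ℝ, M ^ (-α) * L < η / 2 ∧ 0 < M := by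
    have h1 : Tendsto (fun M : ℝ => M ^ (-α) * L) atTop (𝓝 0) := by
      simpa using (tendsto_rpow_neg_atTop hα).mul_const L
    exact ((h1.eventually (gt_mem_nhds (half_pos hη))).and (eventually_gt_atTop 0)).exists
  set R : Set V := insert 0 (⋃ s ∈ S, (Submodule.span ℝ {s} : Set V)) with hR
  have hRc : IsClosed R := by
    rw [hR, Set.insert_eq]
    exact isClosed_singleton.union (S.finite_toSet.isClosed_biUnion fun s _ =>
      Submodule.closed_of_finiteDimensional _)
  obtain ⟨g, hgs, hgc, hg01, hg1, hgU⟩ := exists_contDiff_eq_one_of_isCompact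
    (K := T ∩ Metric.closedBall 0 (3 * M)) (U := Rᶜ)
    ((isCompact_closedBall _ _).inter_left hT) hRc.isOpen_compl (by
      rintro z ⟨hz, -⟩ hzR
      rcases hzR with rfl | hzR
      · exact hT0 hz
      · simp only [Set.mem_iUnion, SetLike.mem_coe, Submodule.mem_span_singleton] at hzR
        obtain ⟨s, hs, r, rfl⟩ := hzR
        exact hTS s hs r hz)
  have hg0 := hgU 0 (by simp [hR])
  have hlim := ((hg g hgs hgc).2 hg0).2
  have hzero : ∀ s ∈ S, ∀ r : ℝ, g (r • s) = 0 := fun s hs r => by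
    refine (hgU _ ?_).self_of_nhds
    simp only [hR, Set.mem_compl_iff, not_not]
    right
    simp only [Set.mem_iUnion, SetLike.mem_coe]
    exact ⟨s, hs, Submodule.mem_span_singleton.2 ⟨r, rfl⟩⟩
  rw [Finset.sum_eq_zero (fun s hs => by simp [hzero s hs]), mul_zero] at hlim
  rw [Filter.Eventually, mem_nhdsSet_iff_exists] at hg1
  obtain ⟨O, hO, hKO, hO1⟩ := hg1
  obtain ⟨δ, hδ, hδO⟩ := ((isCompact_closedBall _ _).inter_left hT).exists_thickening_subset_open
    hO hKO
  filter_upwards [hlim.eventually (gt_mem_nhds (half_pos hη)), eventually_gt_atTop 0,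
    hb.eventually (Metric.ball_mem_nhds 0 hδ),
    (tendsto_id.const_mul_atTop hM0).eventually hL] with x hx hx0 hbx hLx
  have hxα : 0 < x ^ α := by positivity
  have hgi : Integrable (fun y => g (x⁻¹ • y - b x)) μ := by
    refine Integrable.mono' (integrable_const (1 : ℝ))
      (hgs.continuous.comp (by fun_prop)).aestronglyMeasurable (Eventually.of_forall fun y => ?_)
    rw [Real.norm_of_nonneg (hg01 _).1]
    exact (hg01 _).2
  have hmk := mul_meas_ge_le_integral_of_nonneg (μ := μ)
    (f := fun y => g (x⁻¹ • y - b x)) (Eventually.of_forall fun y => (hg01 _).1) hgi 1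
  rw [one_mul] at hmk
  have hsub : {y : V | x⁻¹ • y ∈ T}
      ⊆ {y | 1 ≤ g (x⁻¹ • y - b x)} ∪ {y | 3 * (M * x) ≤ ‖y‖} := by
    intro y hy
    by_cases hyM : 3 * (M * x) ≤ ‖y‖
    · exact Or.inr hyM
    left
    have hK : x⁻¹ • y ∈ T ∩ Metric.closedBall 0 (3 * M) := by
      refine ⟨hy, ?_⟩
      rw [mem_closedBall_zero_iff, norm_smul, Real.norm_of_nonneg (inv_pos.2 hx0).le,
        inv_mul_eq_div, div_le_iff₀ hx0]
      linarith
    have : x⁻¹ • y - b x ∈ Metric.thickening δ (T ∩ Metric.closedBall 0 (3 * M)) := by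
      rw [Metric.mem_thickening_iff]
      refine ⟨_, hK, ?_⟩
      rw [dist_zero_right] at hbx
      rwa [dist_eq_norm, sub_sub_cancel_left, norm_neg]
    exact (hO1 (hδO this)).ge
  have h1 := (measureReal_mono hsub).trans (measureReal_union_le (μ := μ) _ _)
  have h2 : x ^ α * μ.real {y | 3 * (M * x) ≤ ‖y‖} < η / 2 := by
    refine lt_of_le_of_lt ?_ hM
    simp only [id] at hLx
    rw [Real.mul_rpow hM0.le hx0.le] at hLx
    rw [Real.rpow_neg hM0.le, inv_mul_eq_div, le_div_iff₀ (by positivity)]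
    linarith
  have h3 := mul_le_mul_of_nonneg_left h1 hxα.le
  have h4 := mul_le_mul_of_nonneg_left hmk hxα.le
  rw [Real.dist_0_eq_abs, abs_of_nonneg (by positivity)]
  linarith

theorem exists_le_rpow_mul_measureReal (hα : 0 < α) (hα2 : α < 2)
    (h : IsStableLaw μ α S w μ₀) {s₀ : V} (hs₀ : s₀ ∈ S) (hw : 0 < w s₀) (hs₀0 : s₀ ≠ 0)
    {t : ℝ} (ht : 0 < t) {U : Set V} (hU : U ∈ 𝓝 (t • s₀)) :
    ∃ c : ℝ, 0 < c ∧ ∀ᶠ x : ℝ in atTop, c ≤ x ^ α * μ.real {y | x⁻¹ • y ∈ U} := by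
  obtain ⟨b, hb, c, hc, hg⟩ := h.exists_tendsto_integral hα hα2
  have hp : 0 < ‖t • s₀‖ := norm_pos_iff.2 (smul_ne_zero ht.ne' hs₀0)
  obtain ⟨ε, hε, hεU⟩ := Metric.mem_nhds_iff.1 hU
  set ε' := min (ε / 2) ‖t • s₀‖ with hε'
  have hε'0 : 0 < ε' := lt_min (half_pos hε) hp
  obtain ⟨g, hgs, hgc, hg01, hg1, hgU⟩ := exists_contDiff_eq_one_of_isCompact
    (K := {t • s₀}) (U := Metric.ball (t • s₀) ε') isCompact_singleton Metric.isOpen_ball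
    (by simpa using hε'0)
  have hg0 := hgU 0 (by
    rw [Metric.mem_ball, dist_zero_left, not_lt]
    exact min_le_right _ _)
  obtain ⟨hint, hlim⟩ := (hg g hgs hgc).2 hg0
  have hnn : ∀ s : V, ∀ r ∈ Set.Ioi (0 : ℝ), 0 ≤ g (r • s) * r ^ (-1 - α) := fun s r hr =>
    mul_nonneg (hg01 _).1 (Real.rpow_nonneg (le_of_lt hr) _)
  have hpos : 0 < ∫ r in Set.Ioi (0 : ℝ), g (r • s₀) * r ^ (-1 - α) := by
    rw [setIntegral_pos_iff_support_of_nonneg_ae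
      ((ae_restrict_mem measurableSet_Ioi).mono (hnn s₀)) (hint s₀)]
    have hO : IsOpen ({r : ℝ | g (r • s₀) ≠ 0} ∩ Set.Ioi 0) := by
      have := hgs.continuous
      exact (isOpen_ne_fun (by fun_prop) continuous_const).inter isOpen_Ioi
    refine (hO.measure_pos volume ⟨t, ?_, ht⟩).trans_le (measure_mono ?_)
    · have : g (t • s₀) = 1 := hg1.self_of_nhdsSet _ rfl
      simp [this]
    · rintro r ⟨hr, hr0⟩
      exact ⟨mul_ne_zero hr (Real.rpow_pos_of_pos hr0 _).ne', hr0⟩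
  have hlpos : 0 < c * ∑ s ∈ S, w s * ∫ r in Set.Ioi (0 : ℝ), g (r • s) * r ^ (-1 - α) :=
    mul_pos hc (Finset.sum_pos' (fun s hs => mul_nonneg (h.nonneg s hs)
      (setIntegral_nonneg measurableSet_Ioi (hnn s))) ⟨s₀, hs₀, mul_pos hw hpos⟩)
  refine ⟨_, half_pos hlpos, ?_⟩
  filter_upwards [hlim.eventually (lt_mem_nhds (half_lt_self hlpos)), eventually_gt_atTop 0,
    hb.eventually (Metric.ball_mem_nhds 0 (half_pos hε))] with x hx hx0 hbx
  refine hx.le.trans (mul_le_mul_of_nonneg_left ?_ (by positivity))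
  have hm : MeasurableSet {y : V | x⁻¹ • y - b x ∈ Metric.ball (t • s₀) ε'} :=
    (by fun_prop : Measurable fun y : V => x⁻¹ • y - b x) measurableSet_ball
  calc ∫ y, g (x⁻¹ • y - b x) ∂μ
      ≤ ∫ y, {y : V | x⁻¹ • y - b x ∈ Metric.ball (t • s₀) ε'}.indicator 1 y ∂μ := by
        refine integral_mono_of_nonneg (Eventually.of_forall fun y => (hg01 _).1)
          ((integrable_const (1 : ℝ)).indicator hm) (Eventually.of_forall fun y => ?_)
        by_cases hy : x⁻¹ • y - b x ∈ Metric.ball (t • s₀) ε'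
        · simp only
          rw [Set.indicator_of_mem
            (show y ∈ {y : V | x⁻¹ • y - b x ∈ Metric.ball (t • s₀) ε'} from hy)]
          exact (hg01 _).2
        · simp only
          rw [Set.indicator_of_notMem
            (show y ∉ {y : V | x⁻¹ • y - b x ∈ Metric.ball (t • s₀) ε'} from hy), (hgU _ hy).self_of_nhds]
          simp
    _ = μ.real {y : V | x⁻¹ • y - b x ∈ Metric.ball (t • s₀) ε'} := integral_indicator_one hm
    _ ≤ _ := by
        refine measureReal_mono fun y hy => hεU ?_
        have hy' : dist (x⁻¹ • y - b x) (t • s₀) < ε' := hy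
        rw [dist_zero_right] at hbx
        rw [Metric.mem_ball]
        have h1 : dist (x⁻¹ • y) (x⁻¹ • y - b x) = ‖b x‖ := by
          rw [dist_eq_norm, sub_sub_cancel]
        have h2 := dist_triangle (x⁻¹ • y) (x⁻¹ • y - b x) (t • s₀)
        have h3 : ε' ≤ ε / 2 := min_le_left _ _
        linarith

end IsStableLaw

theorem eq_of_mul_geometric_eq {m p p₀ : ℕ} (hp₀ : p₀ < m) {c c₀ r r₀ : ℝ} (hc : c ≠ 0)
    (hc₀ : c₀ ≠ 0) (hr : r ≠ 0)
    (H : ∀ i ≤ m, c * (if i ≤ p then r ^ (p - i) else 0)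
      = c₀ * (if i ≤ p₀ then r₀ ^ (p₀ - i) else 0)) :
    p = p₀ ∧ c = c₀ ∧ (p = 0 ∨ r = r₀) := by
  have hpp : p = p₀ := by
    rcases lt_trichotomy p p₀ with h | h | h
    · have := H p₀ hp₀.le
      rw [if_neg h.not_ge, if_pos le_rfl] at this
      simp [hc₀.symm] at this
    · exact h
    · have := H (p₀ + 1) hp₀
      rw [if_pos (Nat.succ_le_of_lt h), if_neg (by omega)] at this
      simp [hc, hr] at this
  subst hpp
  have hcc : c = c₀ := by simpa using H p hp₀.le
  refine ⟨rfl, hcc, ?_⟩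
  rcases Nat.eq_zero_or_pos p with h | h
  · exact Or.inl h
  right
  have := H (p - 1) (by omega)
  rw [if_pos (by omega), if_pos (by omega), show p - (p - 1) = 1 by omega, pow_one, pow_one,
    hcc] at this
  exact mul_left_cancel₀ hc₀ this

theorem setIntegral_eq_sum_of_measure_compl_eq_zero {V : Type*} [MeasurableSpace V]
    [MeasurableSingletonClass V] {γ : Measure V} {S : Finset V} {C : Set V} (hSC : (S : Set V) ⊆ C)
    (hS : γ (S : Set V)ᶜ = 0) (hfin : ∀ s ∈ S, γ {s} < ⊤) (F : V → ℂ) :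
    ∫ s in C, F s ∂γ = ∑ s ∈ S, (γ.real {s} : ℂ) * F s := by
  have h1 : C =ᵐ[γ] (S : Set V) := by
    have : ∀ᵐ s ∂γ, s ∈ (S : Set V) := hS
    filter_upwards [this] with s hs
    exact propext ⟨fun _ => hs, fun _ => hSC hs⟩
  rw [setIntegral_congr_set h1, setIntegral_finset]
  · simp
  · rw [← Set.biUnion_of_singleton (S : Set V)]
    exact (integrableOn_finite_biUnion S.finite_toSet).2 fun s hs =>
      integrableOn_singleton (hx := hfin s hs)

namespace IsStableLaw

variable {V : Type*} [NormedAddCommGroup V] [InnerProductSpace ℝ V]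
  [FiniteDimensional ℝ V] [MeasurableSpace V] [BorelSpace V]
  {μ : Measure V} [IsProbabilityMeasure μ] {α : ℝ} {S : Finset V} {w : V → ℝ} {μ₀ : V}

theorem tendsto_seminorm_zero (hα : 0 < α) (hα2 : α < 2) (h : IsStableLaw μ α S w μ₀)
    (N : Seminorm ℝ V) (hSN : ∀ s ∈ S, N s = 1) {F : Set V} (hF : IsClosed F)
    (hFS : ∀ s ∈ S, s ∉ F ∧ -s ∉ F) :
    Tendsto (fun x : ℝ => x ^ α * μ.real {y | x < N y ∧ (N y)⁻¹ • y ∈ F}) atTop (𝓝 0) := by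
  have hNc : Continuous N := N.convexOn.locallyLipschitz.continuous
  have hT : IsClosed ({z | 1 ≤ N z} ∩ (fun z => (N z)⁻¹ • z) ⁻¹' F) := by
    refine ContinuousOn.preimage_isClosed_of_isClosed ?_ (isClosed_le continuous_const hNc) hF
    refine ContinuousOn.smul (hNc.continuousOn.inv₀ fun z hz => ?_) continuousOn_id
    exact (zero_lt_one.trans_le hz).ne'
  have := h.tendsto_rpow_mul_measureReal_zero hα hα2 hT (fun h0 => by
      have h1 : 1 ≤ N 0 := h0.1
      rw [map_zero] at h1
      linarith) (fun s hs r hr => by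
      obtain ⟨h1, h2⟩ := hr
      have hNr : N (r • s) = |r| := by rw [map_smul_eq_mul, hSN s hs, mul_one, Real.norm_eq_abs]
      have h1' : 1 ≤ N (r • s) := h1
      have h2' : (N (r • s))⁻¹ • r • s ∈ F := h2
      rw [hNr] at h1' h2'
      rw [smul_smul] at h2'
      have hr0 : r ≠ 0 := by rintro rfl; simp at h1'; linarith
      rcases hr0.lt_or_gt with h | h
      · rw [abs_of_neg h, inv_neg, neg_mul, inv_mul_cancel₀ hr0, neg_smul, one_smul] at h2'
        exact (hFS s hs).2 h2'
      · rw [abs_of_pos h, inv_mul_cancel₀ hr0, one_smul] at h2'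
        exact (hFS s hs).1 h2')
  refine squeeze_zero' ?_ ?_ this
  · filter_upwards [eventually_gt_atTop 0] with x hx
    positivity
  · filter_upwards [eventually_gt_atTop 0] with x hx
    refine mul_le_mul_of_nonneg_left (measureReal_mono ?_) (by positivity)
    rintro y ⟨h1, h2⟩
    have hNy : N (x⁻¹ • y) = x⁻¹ * N y := by
      rw [map_smul_eq_mul, Real.norm_of_nonneg (inv_pos.2 hx).le]
    refine ⟨?_, ?_⟩
    · show 1 ≤ N (x⁻¹ • y)
      rw [hNy, inv_mul_eq_div, le_div_iff₀ hx, one_mul]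
      exact h1.le
    · show (N (x⁻¹ • y))⁻¹ • x⁻¹ • y ∈ F
      rw [hNy, smul_smul, mul_inv, inv_inv, mul_comm x, mul_assoc, mul_inv_cancel₀ hx.ne', mul_one]
      exact h2

theorem exists_le_seminorm (hα : 0 < α) (hα2 : α < 2) (h : IsStableLaw μ α S w μ₀)
    (N : Seminorm ℝ V) {s₀ : V} (hs₀ : s₀ ∈ S) (hw : 0 < w s₀) (hN : N s₀ = 1) {B : Set V}
    (hB : B ∈ 𝓝[{s | N s = 1}] s₀) :
    ∃ c : ℝ, 0 < c ∧
      ∀ᶠ x : ℝ in atTop, c ≤ x ^ α * μ.real {y | x < N y ∧ (N y)⁻¹ • y ∈ B} := by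
  have hNc : Continuous N := N.convexOn.locallyLipschitz.continuous
  have hN2 : N ((2 : ℝ) • s₀) = 2 := by simp [map_smul_eq_mul, hN]
  have hU : {z | 1 < N z ∧ (N z)⁻¹ • z ∈ B} ∈ 𝓝 ((2 : ℝ) • s₀) := by
    have h1 : ∀ᶠ z in 𝓝 ((2 : ℝ) • s₀), 1 < N z :=
      hNc.continuousAt.eventually (lt_mem_nhds (by rw [hN2]; norm_num))
    have h2 : Tendsto (fun z => (N z)⁻¹ • z) (𝓝 ((2 : ℝ) • s₀)) (𝓝[{s | N s = 1}] s₀) := by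
      rw [tendsto_nhdsWithin_iff]
      constructor
      · have : ContinuousAt (fun z => (N z)⁻¹ • z) ((2 : ℝ) • s₀) :=
          (hNc.continuousAt.inv₀ (by rw [hN2]; norm_num)).smul continuousAt_id
        rw [ContinuousAt, hN2, smul_smul] at this
        simpa using this
      · filter_upwards [h1] with z hz
        show N ((N z)⁻¹ • z) = 1
        have hz0 : 0 < N z := zero_lt_one.trans hz
        rw [map_smul_eq_mul, Real.norm_of_nonneg (inv_pos.2 hz0).le, inv_mul_cancel₀ hz0.ne']
    exact h1.and (h2 hB)
  obtain ⟨c, hc, hcx⟩ := h.exists_le_rpow_mul_measureReal hα hα2 hs₀ hw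
    (by rintro rfl; simp at hN) two_pos hU
  refine ⟨c, hc, ?_⟩
  filter_upwards [hcx, eventually_gt_atTop 0] with x hx hx0
  refine hx.trans (mul_le_mul_of_nonneg_left (measureReal_mono ?_) (by positivity))
  rintro y ⟨h1, h2⟩
  have hNy : N (x⁻¹ • y) = x⁻¹ * N y := by
    rw [map_smul_eq_mul, Real.norm_of_nonneg (inv_pos.2 hx0).le]
  rw [hNy] at h1 h2
  refine ⟨?_, ?_⟩
  · rwa [inv_mul_eq_div, lt_div_iff₀ hx0, one_mul] at h1
  · rwa [smul_smul, mul_inv, inv_inv, mul_comm x, mul_assoc, mul_inv_cancel₀ hx0.ne', mul_one] at h2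

theorem tendsto_div_zero (hα : 0 < α) (hα2 : α < 2) (h : IsStableLaw μ α S w μ₀)
    (N : Seminorm ℝ V) (hSN : ∀ s ∈ S, N s = 1) {s₀ : V} (hs₀ : s₀ ∈ S) (hw : 0 < w s₀)
    {B F : Set V} (hB : B ∈ 𝓝[{s | N s = 1}] s₀) (hF : IsClosed F)
    (hFS : ∀ s ∈ S, s ∉ F ∧ -s ∉ F) :
    Tendsto (fun x : ℝ => μ.real {y | x < N y ∧ (N y)⁻¹ • y ∈ F}
      / μ.real {y | x < N y ∧ (N y)⁻¹ • y ∈ B}) atTop (𝓝 0) := by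
  obtain ⟨c, hc, hcx⟩ := h.exists_le_seminorm hα hα2 N hs₀ hw (hSN s₀ hs₀) hB
  have h1 := (h.tendsto_seminorm_zero hα hα2 N hSN hF hFS).div_const c
  rw [zero_div] at h1
  refine squeeze_zero' (Eventually.of_forall fun x => by positivity) ?_ h1
  filter_upwards [hcx, eventually_gt_atTop 0] with x hx hx0
  have hxα : 0 < x ^ α := by positivity
  rw [← mul_div_mul_left _ _ hxα.ne']
  exact div_le_div_of_nonneg_left (by positivity) hc hx

theorem tendsto_div_one (hα : 0 < α) (hα2 : α < 2) (h : IsStableLaw μ α S w μ₀)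
    (N : Seminorm ℝ V) (hSN : ∀ s ∈ S, N s = 1) {s₀ : V} (hs₀ : s₀ ∈ S) (hw : 0 < w s₀)
    {A B : Set V} (hA : A ∈ 𝓝[{s | N s = 1}] s₀) (hB : B ∈ 𝓝[{s | N s = 1}] s₀)
    (hBN : B ⊆ {s | N s = 1}) (hBc : IsClosed B)
    (hBS : ∀ s ∈ S, s ≠ s₀ → s ∉ B) (hBS' : ∀ s ∈ S, -s ≠ s₀ → -s ∉ B) :
    Tendsto (fun x : ℝ => μ.real {y | x < N y ∧ (N y)⁻¹ • y ∈ A ∩ B}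
      / μ.real {y | x < N y ∧ (N y)⁻¹ • y ∈ B}) atTop (𝓝 1) := by
  obtain ⟨O, hO, hsO, hOA⟩ := mem_nhdsWithin.1 hA
  have hz := h.tendsto_div_zero hα hα2 N hSN hs₀ hw hB (F := B ∩ Oᶜ)
    (hBc.inter hO.isClosed_compl) (fun s hs => by
      refine ⟨fun hsF => ?_, fun hsF => ?_⟩
      · by_cases hss : s = s₀
        · exact hsF.2 (hss ▸ hsO)
        · exact hBS s hs hss hsF.1
      · by_cases hss : -s = s₀
        · exact hsF.2 (hss ▸ hsO)
        · exact hBS' s hs hss hsF.1)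
  obtain ⟨c, hc, hcx⟩ := h.exists_le_seminorm hα hα2 N hs₀ hw (hSN s₀ hs₀) hB
  refine tendsto_of_tendsto_of_tendsto_of_le_of_le' (by simpa using hz.const_sub 1)
    tendsto_const_nhds ?_ (Eventually.of_forall fun x => ?_)
  · filter_upwards [hcx, eventually_gt_atTop 0] with x hx hx0
    have hpos : 0 < μ.real {y | x < N y ∧ (N y)⁻¹ • y ∈ B} := by
      have hxα : 0 < x ^ α := by positivity
      exact pos_of_mul_pos_right (hc.trans_le hx) hxα.le
    rw [sub_le_iff_le_add, ← add_div, one_le_div hpos]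
    refine (measureReal_mono ?_).trans (measureReal_union_le _ _)
    rintro y ⟨h1, h2⟩
    by_cases hy : (N y)⁻¹ • y ∈ O
    · exact Or.inl ⟨h1, hOA ⟨hy, hBN h2⟩, h2⟩
    · exact Or.inr ⟨h1, h2, hy⟩
  · refine div_le_one_of_le₀ (measureReal_mono ?_) (by positivity)
    rintro y ⟨h1, h2⟩
    exact ⟨h1, h2.2⟩

end IsStableLaw

theorem stmt19 (α : ℝ) (hα0 : 0 < α) (hα2 : α < 2)
    (J : ℕ) (hJ : 1 ≤ J) (ρ β π : ℕ → ℝ)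
    (hρ : ∀ j, 1 ≤ j → j ≤ J → 0 < ρ j ∧ ρ j < 1)
    (hinj : ∀ j j', 1 ≤ j → j ≤ J → 1 ≤ j' → j' ≤ J → ρ j = ρ j' → j = j')
    (hβ : ∀ j, 1 ≤ j → j ≤ J → |β j| ≤ 1)
    (hπ : ∀ j, 1 ≤ j → j ≤ J → 0 < π j)
    (m h : ℕ) (hm : 1 ≤ m) (hh : 1 ≤ h)
    (N : Seminorm ℝ (EuclideanSpace ℝ (Fin (m + h + 1))))
    (hN : ∀ x : EuclideanSpace ℝ (Fin (m + h + 1)),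
      N x = 0 ↔ ∀ i : Fin (m + h + 1), (i : ℕ) ≤ m → x i = 0)
    (C : Set (EuclideanSpace ℝ (Fin (m + h + 1))))
    (hC : C = {s : EuclideanSpace ℝ (Fin (m + h + 1)) | N s = 1})
    (f : EuclideanSpace ℝ (Fin (m + h + 1)) → EuclideanSpace ℝ (Fin (m + 1)))
    (hf : ∀ (x : EuclideanSpace ℝ (Fin (m + h + 1))) (i : Fin (m + 1)),
      f x i = x (Fin.castLE (by omega) i))
    (emb : EuclideanSpace ℝ (Fin (m + 1)) → EuclideanSpace ℝ (Fin (m + h + 1)))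
    (hemb : ∀ (v : EuclideanSpace ℝ (Fin (m + 1))) (i : Fin (m + h + 1)),
      emb v i = if hi : (i : ℕ) ≤ m then v ⟨(i : ℕ), by omega⟩ else 0)
    (D : ℕ → ℤ → EuclideanSpace ℝ (Fin (m + h + 1)))
    (hD : ∀ j, 1 ≤ j → j ≤ J → ∀ k : ℤ, -(m : ℤ) ≤ k →
      ∀ i : Fin (m + h + 1),
        D j k i = if ((i : ℕ) : ℤ) - (m : ℤ) ≤ k
          then ρ j ^ (k + (m : ℤ) - ((i : ℕ) : ℤ)).toNat else 0)
    (hD0 : ∀ i : Fin (m + h + 1), D 0 (-(m : ℤ)) i = if (i : ℕ) = 0 then 1 else 0)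
    (γ : Measure (EuclideanSpace ℝ (Fin (m + h + 1))))
    (hγ : γ = Measure.sum (fun n : ℕ => ∑ j ∈ Finset.Icc 1 J,
        ∑ θ ∈ ({-1, 1} : Finset ℝ),
          ENNReal.ofReal ((1 + θ * β j) / 2 * π j ^ α * N (D j ((n : ℤ) - (m : ℤ))) ^ α)
            • Measure.dirac ((θ * (N (D j ((n : ℤ) - (m : ℤ))))⁻¹) • D j ((n : ℤ) - (m : ℤ)))))
    (hint1 : α ≠ 1 → ∀ u : EuclideanSpace ℝ (Fin (m + h + 1)),
      ∫⁻ s in C, ENNReal.ofReal (|⟪u, s⟫| ^ α) ∂γ < ⊤)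
    (hint2 : α = 1 → ∀ u : EuclideanSpace ℝ (Fin (m + h + 1)),
      ∫⁻ s in C, ENNReal.ofReal (|⟪u, s⟫| * (1 + |(Real.log |⟪u, s⟫|)|)) ∂γ < ⊤)
    (μ₀ : EuclideanSpace ℝ (Fin (m + h + 1)))
    (μ : Measure (EuclideanSpace ℝ (Fin (m + h + 1)))) [IsProbabilityMeasure μ]
    (hchar : ∀ u : EuclideanSpace ℝ (Fin (m + h + 1)),
      ∫ x, Complex.exp (Complex.I * ((⟪u, x⟫ : ℝ) : ℂ)) ∂μ
        = Complex.exp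
            (-(∫ s in C, ((|⟪u, s⟫| ^ α : ℝ) : ℂ)
                * (1 - Complex.I * ((Real.sign ⟪u, s⟫
                    * (if α = 1 then -(2 / Real.pi) * Real.log |⟪u, s⟫|
                       else Real.tan (Real.pi * α / 2)) : ℝ) : ℂ)) ∂γ)
              + Complex.I * ((⟪u, μ₀⟫ : ℝ) : ℂ)))
    (θ₀ : ℝ) (j₀ : ℕ) (k₀ : ℤ)
    (hθ₀ : θ₀ = -1 ∨ θ₀ = 1)
    (hI₀ : (1 ≤ j₀ ∧ j₀ ≤ J ∧ -(m : ℤ) + 1 ≤ k₀ ∧ k₀ ≤ (h : ℤ))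
        ∨ (j₀ = 0 ∧ k₀ = -(m : ℤ)))
    (hk₀ : k₀ ≤ -1)
    (hatom : 0 < γ {(θ₀ * (N (D j₀ k₀))⁻¹) • D j₀ k₀})
    (V₀ : Set (EuclideanSpace ℝ (Fin (m + 1))))
    (hV₀closed : IsClosed V₀)
    (hV₀sub : V₀ ⊆ {v : EuclideanSpace ℝ (Fin (m + 1)) | N (emb v) = 1})
    (hV₀nhd : V₀ ∈ nhdsWithin ((θ₀ * (N (D j₀ k₀))⁻¹) • f (D j₀ k₀))
        {v : EuclideanSpace ℝ (Fin (m + 1)) | N (emb v) = 1})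
    (hV₀id : ∀ (θ' : ℝ) (j' : ℕ) (k' : ℤ), (θ' = -1 ∨ θ' = 1) →
      ((1 ≤ j' ∧ j' ≤ J ∧ -(m : ℤ) + 1 ≤ k' ∧ k' ≤ (h : ℤ)) ∨ (j' = 0 ∧ k' = -(m : ℤ))) →
      (θ' * (N (D j' k'))⁻¹) • f (D j' k') ∈ V₀ →
      (θ' * (N (D j' k'))⁻¹) • f (D j' k') = (θ₀ * (N (D j₀ k₀))⁻¹) • f (D j₀ k₀))
    (θ : ℝ) (j : ℕ) (k : ℤ)
    (hθ : θ = -1 ∨ θ = 1)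
    (hI : (1 ≤ j ∧ j ≤ J ∧ -(m : ℤ) + 1 ≤ k ∧ k ≤ (h : ℤ)) ∨ (j = 0 ∧ k = -(m : ℤ)))
    (A : Set (EuclideanSpace ℝ (Fin (m + h + 1))))
    (hAclosed : IsClosed A) (hAC : A ⊆ C)
    (hAnhd : A ∈ nhdsWithin ((θ * (N (D j k))⁻¹) • D j k) C)
    (hAid : ∀ (θ' : ℝ) (j' : ℕ) (k' : ℤ), (θ' = -1 ∨ θ' = 1) →
      ((1 ≤ j' ∧ j' ≤ J ∧ -(m : ℤ) + 1 ≤ k' ∧ k' ≤ (h : ℤ)) ∨ (j' = 0 ∧ k' = -(m : ℤ))) →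
      (θ' * (N (D j' k'))⁻¹) • D j' k' ∈ A → (θ' = θ ∧ j' = j ∧ k' = k)) :
    Tendsto (fun x : ℝ =>
        (μ {y | x < N y ∧ (N y)⁻¹ • y ∈ A ∩ {s | s ∈ C ∧ f s ∈ V₀}}).toReal
          / (μ {y | x < N y ∧ (N y)⁻¹ • y ∈ {s | s ∈ C ∧ f s ∈ V₀}}).toReal) atTop
      (𝓝 (if θ = θ₀ ∧ j = j₀ ∧ k = k₀ then (1 : ℝ) else 0)) := by
  classical
  subst hC
  have hNc : Continuous N := N.convexOn.locallyLipschitz.continuous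
  have hneg : ∀ t : ℝ, (t = -1 ∨ t = 1) → (-t = -1 ∨ -t = 1) ∧ |t| = 1 ∧ t ≠ 0 := by
    rintro t (rfl | rfl) <;> norm_num
  let I : ℕ → ℤ → Prop := fun j k =>
    (1 ≤ j ∧ j ≤ J ∧ -(m : ℤ) + 1 ≤ k ∧ k ≤ (h : ℤ)) ∨ (j = 0 ∧ k = -(m : ℤ))
  let p : ℝ → ℕ → ℤ → EuclideanSpace ℝ (Fin (m + h + 1)) :=
    fun t j k => (t * (N (D j k))⁻¹) • D j k
  have hIk : ∀ j k, I j k → -(m : ℤ) ≤ k := by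
    rintro j k (⟨-, -, h1, -⟩ | ⟨-, h1⟩) <;> omega
  obtain ⟨r, hr⟩ : ∃ r : ℕ → ℝ, r = fun j => if j = 0 then 1 else ρ j := ⟨_, rfl⟩
  have hr0 : ∀ j k, I j k → r j ≠ 0 := by
    rintro j k (⟨h1, h2, -, -⟩ | ⟨rfl, -⟩)
    · rw [hr]
      simp only [if_neg (show j ≠ 0 by omega)]
      exact (hρ j h1 h2).1.ne'
    · simp [hr]
  have hDr : ∀ j k, I j k → ∀ i : Fin (m + h + 1),
      D j k i = if (i : ℕ) ≤ (k + m).toNat then r j ^ ((k + m).toNat - i) else 0 := by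
    rintro j k (⟨h1, h2, h3, h4⟩ | ⟨rfl, rfl⟩) i
    · rw [hD j h1 h2 k (by omega) i, hr]
      simp only [if_neg (show j ≠ 0 by omega)]
      by_cases hi : (i : ℕ) ≤ (k + m).toNat
      · rw [if_pos hi, if_pos (by omega)]
        congr 1
        omega
      · rw [if_neg hi, if_neg (by omega)]
    · rw [hD0, hr]
      simp
  have hND : ∀ j k, I j k → 0 < N (D j k) := fun j k hjk => by
    refine (apply_nonneg N _).lt_of_ne' fun h0 => ?_
    have h1 := (hN _).1 h0 0 (by simp)
    rw [hDr j k hjk, if_pos (by simp)] at h1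
    exact pow_ne_zero _ (hr0 j k hjk) h1
  have hNp : ∀ t j k, (t = -1 ∨ t = 1) → I j k → N (p t j k) = 1 := fun t j k ht hjk => by
    have := hND j k hjk
    rw [map_smul_eq_mul, norm_mul, Real.norm_eq_abs, (hneg t ht).2.1, one_mul,
      Real.norm_of_nonneg (inv_pos.2 this).le, inv_mul_cancel₀ this.ne']
  have hpneg : ∀ t j k, -p t j k = p (-t) j k := fun t j k => by
    simp only [p]
    rw [← neg_smul, neg_mul]
  have hfs : ∀ (c : ℝ) x, f (c • x) = c • f x := fun c x => by
    ext i
    simp [hf]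
  have hfc : Continuous f := by
    have : f = fun x => WithLp.toLp 2 fun i : Fin (m + 1) => x (Fin.castLE (by omega) i) := by
      funext x
      ext i
      simp [hf]
    rw [this]
    fun_prop
  have hNf : ∀ x, N (emb (f x)) = N x := fun x => by
    have h1 : N (emb (f x) - x) = 0 := (hN _).2 fun i hi => by
      show emb (f x) i - x i = 0
      rw [hemb, dif_pos hi, hf]
      exact sub_self (x i)
    have h2 := abs_sub_map_le_sub N (emb (f x)) x
    rw [h1] at h2
    exact sub_eq_zero.1 (abs_eq_zero.1 (le_antisymm h2 (abs_nonneg _)))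
  have hpinj : ∀ t j k, (t = -1 ∨ t = 1) → I j k → f (p t j k) = f (p θ₀ j₀ k₀) →
      t = θ₀ ∧ j = j₀ ∧ k = k₀ := fun t j k ht hjk hff => by
    have hk := hIk j k hjk
    have hk' := hIk j₀ k₀ hI₀
    obtain ⟨h1, h2, h3⟩ := eq_of_mul_geometric_eq (m := m) (p := (k + m).toNat)
      (p₀ := (k₀ + m).toNat) (c := t * (N (D j k))⁻¹) (c₀ := θ₀ * (N (D j₀ k₀))⁻¹)
      (r := r j) (r₀ := r j₀) (by omega)
      (mul_ne_zero (hneg t ht).2.2 (inv_ne_zero (hND j k hjk).ne'))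
      (mul_ne_zero (hneg θ₀ hθ₀).2.2 (inv_ne_zero (hND j₀ k₀ hI₀).ne')) (hr0 j k hjk)
      fun i hi => by
        have := congrArg (fun v : EuclideanSpace ℝ (Fin (m + 1)) => v ⟨i, Nat.lt_succ_of_le hi⟩) hff
        simpa [p, hf, hDr j k hjk, hDr j₀ k₀ hI₀] using this
    have hkk : k = k₀ := by omega
    subst hkk
    have hjj : j = j₀ := by
      rcases hjk with ⟨a1, a2, a3, a4⟩ | ⟨a1, a2⟩ <;>
        rcases hI₀ with ⟨b1, b2, b3, b4⟩ | ⟨b1, b2⟩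
      · have h4 : r j = r j₀ := h3.resolve_left (by omega)
        simp only [hr, if_neg (show j ≠ 0 by omega), if_neg (show j₀ ≠ 0 by omega)] at h4
        exact hinj _ _ a1 a2 b1 b2 h4
      · omega
      · omega
      · omega
    subst hjj
    exact ⟨mul_right_cancel₀ (inv_ne_zero (hND j k hjk).ne') h2, rfl, rfl⟩
  obtain ⟨S, hS⟩ : ∃ S : Finset (EuclideanSpace ℝ (Fin (m + h + 1))),
      ∀ s, s ∈ S ↔ ∃ t j k, (t = -1 ∨ t = 1) ∧ I j k ∧ s = p t j k := by
    have hfin : {s | ∃ t j k, (t = -1 ∨ t = 1) ∧ I j k ∧ s = p t j k}.Finite := by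
      refine (((Set.toFinite ({-1, 1} : Set ℝ)).prod ((Set.finite_Iic J).prod
        (Set.finite_Icc (-(m : ℤ)) h))).image fun q => p q.1 q.2.1 q.2.2).subset ?_
      rintro _ ⟨t, j, k, ht, hjk, rfl⟩
      refine ⟨(t, j, k), ⟨by simpa using ht, ?_⟩, rfl⟩
      have hjk' : (1 ≤ j ∧ j ≤ J ∧ -(m : ℤ) + 1 ≤ k ∧ k ≤ (h : ℤ))
        ∨ (j = 0 ∧ k = -(m : ℤ)) := hjk
      simp only [Set.mem_prod, Set.mem_Iic, Set.mem_Icc]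
      omega
    exact ⟨hfin.toFinset, fun s => by simp⟩
  have hSN : ∀ s ∈ S, N s = 1 := fun s hs => by
    obtain ⟨t, j, k, ht, hjk, rfl⟩ := (hS s).1 hs
    exact hNp t j k ht hjk
  have hSC : (S : Set (EuclideanSpace ℝ (Fin (m + h + 1)))) ⊆ {s | N s = 1} := fun s hs => hSN s hs
  have hSneg : ∀ s ∈ S, -s ∈ S := fun s hs => by
    obtain ⟨t, j, k, ht, hjk, rfl⟩ := (hS s).1 hs
    exact (hS _).2 ⟨-t, j, k, (hneg t ht).1, hjk, hpneg t j k⟩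
  have hatoms : ∀ j, 1 ≤ j → j ≤ J → ∀ t : ℝ, (t = -1 ∨ t = 1) → ∀ n : ℕ,
      p t j ((n : ℤ) - m) ∈ S := fun j h1 h2 t ht n => by
    rw [hS]
    rcases Nat.eq_zero_or_pos n with rfl | hn
    · refine ⟨t, 0, -(m : ℤ), ht, Or.inr ⟨rfl, rfl⟩, ?_⟩
      have : D j (((0 : ℕ) : ℤ) - m) = D 0 (-(m : ℤ)) := by
        ext i
        rw [hD j h1 h2 _ (by omega), hD0]
        by_cases hi : (i : ℕ) = 0
        · simp [hi]
        · rw [if_neg hi, if_neg (by omega)]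
      simp only [p, this]
    rcases le_or_gt n (m + h) with hn' | hn'
    · exact ⟨t, j, (n : ℤ) - m, ht, Or.inl ⟨h1, h2, by omega, by omega⟩, rfl⟩
    refine ⟨t, j, h, ht, Or.inl ⟨h1, h2, by omega, le_rfl⟩, ?_⟩
    have hρ0 := (hρ j h1 h2).1
    have : D j ((n : ℤ) - m) = ρ j ^ (n - (m + h)) • D j h := by
      ext i
      have hi := i.2
      rw [PiLp.smul_apply, hD j h1 h2 _ (by omega), hD j h1 h2 _ (by omega), if_pos (by omega),
        if_pos (by omega), smul_eq_mul, ← pow_add]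
      congr 1
      omega
    have hc : 0 < ρ j ^ (n - (m + h)) := pow_pos hρ0 _
    simp only [p, this]
    rw [map_smul_eq_mul, Real.norm_of_nonneg hc.le, smul_smul, mul_inv]
    congr 1
    field_simp
  have hγS : γ (S : Set _)ᶜ = 0 := by
    have hm : MeasurableSet ((S : Set (EuclideanSpace ℝ (Fin (m + h + 1))))ᶜ) :=
      S.finite_toSet.measurableSet.compl
    rw [hγ, Measure.sum_apply _ hm, ENNReal.tsum_eq_zero]
    intro n
    simp only [Measure.finsetSum_apply, Measure.smul_apply, Measure.dirac_apply' _ hm]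
    refine Finset.sum_eq_zero fun j hj => Finset.sum_eq_zero fun t ht => ?_
    rw [Finset.mem_Icc] at hj
    have := hatoms j hj.1 hj.2 t (by simpa using ht) n
    rw [Set.indicator_of_notMem (by simpa using this), smul_zero]
  have hfin : ∀ s ∈ S, γ {s} < ⊤ := fun s hs => by
    have hs0 : 0 < ⟪s, s⟫ := by
      refine real_inner_self_pos.2 ?_
      rintro rfl
      simpa using hSN 0 hs
    have key : ∀ F : EuclideanSpace ℝ (Fin (m + h + 1)) → ℝ, 0 < F s →
        ∫⁻ x in {s | N s = 1}, ENNReal.ofReal (F x) ∂γ < ⊤ → γ {s} < ⊤ := fun F hF hlt => by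
      have h1 : ∫⁻ x in {s}, ENNReal.ofReal (F x) ∂γ < ⊤ :=
        (lintegral_mono_set (Set.singleton_subset_iff.2 (hSC hs))).trans_lt hlt
      rw [lintegral_singleton] at h1
      rw [lt_top_iff_ne_top] at h1 ⊢
      rintro h2
      rw [h2, ENNReal.mul_top (by simpa using hF)] at h1
      exact h1 rfl
    by_cases hα : α = 1
    · exact key (fun x => |⟪s, x⟫| * (1 + |(Real.log |⟪s, x⟫|)|))
        (mul_pos (abs_pos.2 hs0.ne') (by positivity)) (hint2 hα s)
    · exact key (fun x => |⟪s, x⟫| ^ α) (Real.rpow_pos_of_pos (abs_pos.2 hs0.ne') _) (hint1 hα s)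
  have hstable : IsStableLaw μ α S (fun s => γ.real {s}) μ₀ := by
    refine ⟨fun s _ => measureReal_nonneg, fun u => ?_⟩
    rw [hchar u, setIntegral_eq_sum_of_measure_compl_eq_zero hSC hγS hfin]
    rfl
  have hs₀ : p θ₀ j₀ k₀ ∈ S := (hS _).2 ⟨θ₀, j₀, k₀, hθ₀, hI₀, rfl⟩
  have hw : 0 < γ.real {p θ₀ j₀ k₀} := ENNReal.toReal_pos hatom.ne' (hfin _ hs₀).ne
  have hB : {s | s ∈ {s | N s = 1} ∧ f s ∈ V₀} ∈ 𝓝[{s | N s = 1}] (p θ₀ j₀ k₀) := by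
    refine inter_mem self_mem_nhdsWithin ?_
    have h1 : Tendsto f (𝓝[{s | N s = 1}] (p θ₀ j₀ k₀))
        (𝓝[{v | N (emb v) = 1}] ((θ₀ * (N (D j₀ k₀))⁻¹) • f (D j₀ k₀))) := by
      rw [tendsto_nhdsWithin_iff, ← hfs]
      refine ⟨hfc.continuousAt.tendsto.mono_left nhdsWithin_le_nhds, ?_⟩
      filter_upwards [self_mem_nhdsWithin] with s hs
      exact (hNf s).trans hs
    exact h1 hV₀nhd
  have hBc : IsClosed {s | s ∈ {s | N s = 1} ∧ f s ∈ V₀} :=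
    (isClosed_eq hNc continuous_const).inter (hV₀closed.preimage hfc)
  have hBS : ∀ t j k, (t = -1 ∨ t = 1) → I j k →
      p t j k ∈ {s | s ∈ {s | N s = 1} ∧ f s ∈ V₀} → t = θ₀ ∧ j = j₀ ∧ k = k₀ :=
    fun t j k ht hjk hp => by
      have h1 := hp.2
      rw [hfs] at h1
      have h2 := hV₀id t j k ht hjk h1
      rw [← hfs, ← hfs] at h2
      exact hpinj t j k ht hjk h2
  have hBS' : ∀ s ∈ S, s ≠ p θ₀ j₀ k₀ → s ∉ {s | s ∈ {s | N s = 1} ∧ f s ∈ V₀} :=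
    fun s hs hne hsB => by
      obtain ⟨t, j, k, ht, hjk, rfl⟩ := (hS s).1 hs
      obtain ⟨rfl, rfl, rfl⟩ := hBS t j k ht hjk hsB
      exact hne rfl
  by_cases heq : θ = θ₀ ∧ j = j₀ ∧ k = k₀
  · rw [if_pos heq]
    obtain ⟨rfl, rfl, rfl⟩ := heq
    exact hstable.tendsto_div_one hα0 hα2 N hSN hs₀ hw hAnhd hB (fun s hs => hs.1) hBc hBS'
      fun s hs => hBS' _ (hSneg s hs)
  · rw [if_neg heq]
    have hAB : ∀ s ∈ S, s ∉ A ∩ {s | s ∈ {s | N s = 1} ∧ f s ∈ V₀} := fun s hs hsF => by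
      obtain ⟨t, j', k', ht, hjk, rfl⟩ := (hS s).1 hs
      obtain ⟨rfl, rfl, rfl⟩ := hBS t j' k' ht hjk hsF.2
      obtain ⟨rfl, rfl, rfl⟩ := hAid t j' k' ht hjk hsF.1
      exact heq ⟨rfl, rfl, rfl⟩
    exact hstable.tendsto_div_zero hα0 hα2 N hSN hs₀ hw hB (hAclosed.inter hBc)
      fun s hs => ⟨hAB s hs, hAB _ (hSneg s hs)⟩
end
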